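/- For every integer n ≥ 5 and every real ε > 0 there exists a constant C = C(n,ε) > 0 such that for every prime number q, the number field K = ℚ[X]/(Xⁿ − q) (the polynomial Xⁿ − q being irreducible over ℚ by Eisenstein's criterion) satisfies #h₂(K) ≤ C · D_K^{1/2 − 2/(3n) + 1/(3n(n−1)) + ε}. -/

import Mathlib

open NumberField


namespace PureTwoTorsion

/-- Tauberian pigeonhole. -/
lemma dyadic_of_dirichlet (b : ℕ → ℝ) (hb : ∀ k, 0 ≤ b k) (hbl : ∀ k, b k ≤ Real.log k)
    (c C : ℝ) (hc : 0 < c) (hC : 0 ≤ C)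
    (hs : ∀ x : ℝ, 1 < x → Summable fun k : ℕ => b k / (k : ℝ) ^ x)
    (hlo : ∀ x : ℝ, 1 < x → x ≤ 2 → c / (x - 1) - C ≤ ∑' k : ℕ, b k / (k : ℝ) ^ x)
    (hup : ∀ x : ℝ, 1 < x → x ≤ 2 → ∑' k : ℕ, b k / (k : ℝ) ^ x ≤ c / (x - 1) + C)
    (η : ℝ) (hη : 0 < η) :
    ∃ δ : ℝ, 0 < δ ∧ δ ≤ 1 ∧ ∃ W0 : ℝ, 1 ≤ W0 ∧ ∀ W : ℝ, W0 ≤ W → ∃ j : ℕ,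
      W ^ δ ≤ 2 ^ (j + 1) ∧ (2 : ℝ) ^ j ≤ W ∧
      ((2 : ℝ) ^ j) ^ (1 - η) ≤
        (((Finset.Ico (2 ^ j) (2 ^ (j + 1))).filter (fun k => b k ≠ 0)).card : ℝ) := by
  -- the constant
  have hsum : Summable fun j : ℕ => ((j : ℝ) + 1) * ((2 : ℝ) ^ (-η)) ^ j := by
    have h1 : ‖(2 : ℝ) ^ (-η)‖ < 1 := by
      rw [Real.norm_of_nonneg (by positivity)]
      exact Real.rpow_lt_one_of_one_lt_of_neg (by norm_num) (by linarith)
    have h2 := summable_pow_mul_geometric_of_norm_lt_one 1 h1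
    have h3 := summable_geometric_of_norm_lt_one h1
    refine (h2.add h3).congr fun j => ?_
    simp; ring
  set C3 : ℝ := ∑' j : ℕ, ((j : ℝ) + 1) * ((2 : ℝ) ^ (-η)) ^ j with hC3
  have hC3n : 0 ≤ C3 := tsum_nonneg fun j => by positivity
  set L0 : ℝ := 100 + (5 * C + C3) * 20 / c with hL0
  have hL0' : 100 ≤ L0 := by
    have : 0 ≤ (5 * C + C3) * 20 / c := by positivity
    linarith
  refine ⟨1/40, by norm_num, by norm_num, Real.exp L0, Real.one_le_exp (by linarith), ?_⟩
  intro W hW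
  have hWpos : 0 < W := lt_of_lt_of_le (Real.exp_pos _) hW
  set L := Real.log W with hL
  have hLL : L0 ≤ L := by rw [hL, Real.le_log_iff_exp_le hWpos]; exact hW
  have hLpos : 0 < L := by linarith
  by_contra hcon
  push Not at hcon
  set V : ℝ := W ^ ((1 : ℝ) / 40) with hV
  have hVlog : Real.log V = L / 40 := by rw [hV, Real.log_rpow hWpos]; ring
  have hVpos : 0 < V := by positivity
  set M : Finset ℕ := (Finset.range (⌊W⌋₊ + 1)).filter (fun k => V ≤ k) with hM
  have hmem : ∀ k, k ∈ M ↔ V ≤ k ∧ (k : ℝ) ≤ W := by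
    intro k
    simp only [hM, Finset.mem_filter, Finset.mem_range, Nat.lt_succ_iff, Nat.le_floor_iff hWpos.le]
    tauto
  -- mid sum
  have hmid : ∑ k ∈ M, b k / k ≤ C3 := by
    have h1 : ∑ k ∈ M, b k / k =
        ∑ j ∈ M.image (Nat.log 2), ∑ k ∈ M.filter (fun k => Nat.log 2 k = j), b k / k := by
      rw [Finset.sum_fiberwise_of_maps_to]
      intro k hk
      exact Finset.mem_image_of_mem _ hk
    rw [h1]
    refine le_trans (Finset.sum_le_sum (g := fun j : ℕ => ((j : ℝ) + 1) * ((2 : ℝ) ^ (-η)) ^ j) ?_)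
      (hsum.sum_le_tsum _ (fun j _ => by positivity))
    intro j hj
    obtain ⟨k0, hk0, rfl⟩ := Finset.mem_image.1 hj
    set j := Nat.log 2 k0 with hjdef
    have hk0V := (hmem k0).1 hk0
    have hk0pos : k0 ≠ 0 := by
      rintro rfl
      have := hk0V.1
      simp at this; linarith
    have hlow : 2 ^ j ≤ k0 := Nat.pow_log_le_self 2 hk0pos
    have hhigh : k0 < 2 ^ (j + 1) := Nat.lt_pow_succ_log_self (by norm_num) k0
    have hbd := hcon j (le_trans hk0V.1 (by exact_mod_cast hhigh.le))
      (le_trans (by exact_mod_cast hlow) hk0V.2)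
    set S := (Finset.Ico (2 ^ j) (2 ^ (j + 1))).filter (fun k => b k ≠ 0) with hS
    have h2 : ∑ k ∈ M.filter (fun k => Nat.log 2 k = j), b k / k
        ≤ ∑ k ∈ S, b k / k := by
      have : ∑ k ∈ M.filter (fun k => Nat.log 2 k = j), b k / k =
        ∑ k ∈ (M.filter (fun k => Nat.log 2 k = j)).filter (fun k => b k ≠ 0), b k / k := by
        symm
        apply Finset.sum_filter_of_ne
        intro x _ hx h0
        apply hx; rw [h0]; simp
      rw [this]
      apply Finset.sum_le_sum_of_subset_of_nonneg
      · intro k hk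
        simp only [Finset.mem_filter, hS, Finset.mem_Ico] at hk ⊢
        refine ⟨?_, hk.2⟩
        have hkpos : k ≠ 0 := by
          rintro rfl
          have := ((hmem 0).1 hk.1.1).1
          simp at this; linarith
        rw [← hk.1.2]
        exact ⟨Nat.pow_log_le_self 2 hkpos, Nat.lt_pow_succ_log_self (by norm_num) k⟩
      · intro k _ _
        have := hb k
        positivity
    have h3 : ∑ k ∈ S, b k / k ≤ S.card • (((j : ℝ) + 1) / 2 ^ j) := by
      apply Finset.sum_le_card_nsmul
      intro k hk
      simp only [Finset.mem_filter, hS, Finset.mem_Ico] at hk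
      have hk2 : (2 : ℝ) ^ j ≤ k := by exact_mod_cast hk.1.1
      have hk3 : (k : ℝ) ≤ 2 ^ (j + 1) := by exact_mod_cast hk.1.2.le
      have hkp : (0 : ℝ) < k := lt_of_lt_of_le (by positivity) hk2
      have hlog : Real.log k ≤ (j : ℝ) + 1 := by
        calc Real.log k ≤ Real.log (2 ^ (j + 1)) := Real.log_le_log hkp hk3
          _ = (j + 1 : ℝ) * Real.log 2 := by rw [Real.log_pow]; push_cast; ring
          _ ≤ (j + 1 : ℝ) * 1 := by
            gcongr
            have := Real.log_two_lt_d9; linarith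
          _ = _ := by ring
      have := hbl k
      gcongr
      linarith
    refine h2.trans (h3.trans ?_)
    rw [nsmul_eq_mul]
    calc (S.card : ℝ) * (((j : ℝ) + 1) / 2 ^ j) ≤ ((2 : ℝ) ^ j) ^ (1 - η) * (((j : ℝ) + 1) / 2 ^ j) := by
          gcongr
      _ = ((j : ℝ) + 1) * ((2 : ℝ) ^ (-η)) ^ j := by
          rw [← Real.rpow_natCast, ← Real.rpow_natCast, ← Real.rpow_mul (by norm_num),
            ← Real.rpow_mul (by norm_num)]
          rw [show (j : ℝ) * (1 - η) = j + (-η * j) by ring, Real.rpow_add (by norm_num)]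
          field_simp
  -- main inequality
  have hx1 : (1 : ℝ) < 1 + 4 / L := by have : 0 < 4 / L := by positivity
                                       linarith
  have hx2 : 1 + 4 / L ≤ 2 := by
    have : 4 / L ≤ 1 := by rw [div_le_one hLpos]; linarith
    linarith
  have hy1 : (1 : ℝ) < 1 + 40 / L := by have : 0 < 40 / L := by positivity
                                        linarith
  have hy2 : 1 + 40 / L ≤ 2 := by
    have : 40 / L ≤ 1 := by rw [div_le_one hLpos]; linarith
    linarith
  have hz1 : (1 : ℝ) < 1 + 2 / L := by have : 0 < 2 / L := by positivity
                                       linarith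
  have hz2 : 1 + 2 / L ≤ 2 := by
    have : 2 / L ≤ 1 := by rw [div_le_one hLpos]; linarith
    linarith
  have hpt : ∀ k : ℕ, b k / (k : ℝ) ^ (1 + 4 / L) ≤
      Real.exp 1 * (b k / (k : ℝ) ^ (1 + 40 / L)) + Real.exp (-2) * (b k / (k : ℝ) ^ (1 + 2 / L))
        + (if k ∈ M then b k / k else 0) := by
    intro k
    have hbk := hb k
    rcases Nat.eq_zero_or_pos k with hk | hk
    · have : b k = 0 := le_antisymm (by simpa [hk] using hbl k) hbk
      simp [this]
    have hkp : (0 : ℝ) < k := by exact_mod_cast hk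
    have hk1 : (1 : ℝ) ≤ k := by exact_mod_cast hk
    have hA : 0 ≤ Real.exp 1 * (b k / (k : ℝ) ^ (1 + 40 / L)) := by positivity
    have hB : 0 ≤ Real.exp (-2) * (b k / (k : ℝ) ^ (1 + 2 / L)) := by positivity
    by_cases hkM : k ∈ M
    · rw [if_pos hkM]
      have : b k / (k : ℝ) ^ (1 + 4 / L) ≤ b k / k := by
        gcongr
        calc (k : ℝ) = (k : ℝ) ^ (1 : ℝ) := (Real.rpow_one _).symm
          _ ≤ _ := Real.rpow_le_rpow_of_exponent_le hk1 hx1.le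
      linarith
    · rw [if_neg hkM]
      rw [hmem] at hkM
      by_cases hkV : (k : ℝ) < V
      · have : b k / (k : ℝ) ^ (1 + 4 / L) ≤ Real.exp 1 * (b k / (k : ℝ) ^ (1 + 40 / L)) := by
          rw [mul_div_left_comm, div_eq_mul_inv]
          gcongr
          rw [le_div_iff₀ (by positivity), ← Real.rpow_neg hkp.le, ← Real.rpow_add hkp,
            Real.rpow_def_of_pos hkp]
          apply Real.exp_le_exp.2
          have hlogk : Real.log k ≤ L / 40 := by
            rw [← hVlog]; exact Real.log_le_log hkp hkV.le
          have h36 : (-(1 + 4 / L) + (1 + 40 / L)) = 36 / L := by ring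
          rw [h36]
          calc Real.log k * (36 / L) ≤ L / 40 * (36 / L) := by gcongr
            _ = 36 / 40 := by field_simp
            _ ≤ 1 := by norm_num
        linarith
      · have hkW : W < k := by
          by_contra h
          exact hkM ⟨not_lt.1 hkV, not_lt.1 h⟩
        have : b k / (k : ℝ) ^ (1 + 4 / L) ≤ Real.exp (-2) * (b k / (k : ℝ) ^ (1 + 2 / L)) := by
          rw [mul_div_left_comm, div_eq_mul_inv]
          gcongr
          rw [le_div_iff₀ (by positivity), ← Real.rpow_neg hkp.le, ← Real.rpow_add hkp,
            Real.rpow_def_of_pos hkp]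
          apply Real.exp_le_exp.2
          have hlogk : L ≤ Real.log k := Real.log_le_log hWpos hkW.le
          have h36 : (-(1 + 4 / L) + (1 + 2 / L)) = -(2 / L) := by ring
          rw [h36]
          have : L * (2 / L) ≤ Real.log k * (2 / L) := by gcongr
          have h2 : L * (2 / L) = 2 := by field_simp
          linarith
        linarith
  have hsx := hs _ hx1
  have hsy := hs _ hy1
  have hsz := hs _ hz1
  have hsM : HasSum (fun k => if k ∈ M then b k / (k : ℝ) else 0) (∑ k ∈ M, b k / k) := by
    have : HasSum (fun k => if k ∈ M then b k / (k : ℝ) else 0)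
        (∑ k ∈ M, if k ∈ M then b k / (k : ℝ) else 0) :=
      hasSum_sum_of_ne_finset_zero (fun k hk => by simp [hk])
    convert this using 1
    exact Finset.sum_congr rfl fun k hk => by simp [hk]
  have htot := hsx.tsum_le_tsum hpt
    (((hsy.mul_left _).add (hsz.mul_left _)).add hsM.summable)
  rw [((hsy.mul_left _).add (hsz.mul_left _)).tsum_add hsM.summable,
    (hsy.mul_left _).tsum_add (hsz.mul_left _), tsum_mul_left, tsum_mul_left, hsM.tsum_eq] at htot
  have a1 := hlo _ hx1 hx2
  have a2 := hup _ hy1 hy2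
  have a3 := hup _ hz1 hz2
  have e1 : c / (1 + 4 / L - 1) = c * L / 4 := by field_simp; ring
  have e2 : c / (1 + 40 / L - 1) = c * L / 40 := by field_simp; ring
  have e3 : c / (1 + 2 / L - 1) = c * L / 2 := by field_simp; ring
  rw [e1] at a1; rw [e2] at a2; rw [e3] at a3
  have hexp1 : Real.exp 1 ≤ 2.8 := by have := Real.exp_one_lt_d9; linarith
  have hexp2 : Real.exp (-2) ≤ 0.14 := by
    have h := Real.exp_one_gt_d9
    rw [Real.exp_neg, show (2 : ℝ) = 1 + 1 by norm_num, Real.exp_add]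
    rw [inv_le_comm₀ (by positivity) (by norm_num)]
    nlinarith
  have hcL : 0 < c * L := by positivity
  have b2 : Real.exp 1 * ∑' k : ℕ, b k / (k : ℝ) ^ (1 + 40 / L) ≤ 2.8 * (c * L / 40 + C) := by
    calc _ ≤ Real.exp 1 * (c * L / 40 + C) := by gcongr
      _ ≤ _ := by gcongr
  have b3 : Real.exp (-2) * ∑' k : ℕ, b k / (k : ℝ) ^ (1 + 2 / L) ≤ 0.14 * (c * L / 2 + C) := by
    calc _ ≤ Real.exp (-2) * (c * L / 2 + C) := by gcongr
      _ ≤ _ := by gcongr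
  have hfin : c * L ≥ c * L0 := by gcongr
  have hcL0 : c * L0 = 100 * c + (5 * C + C3) * 20 := by rw [hL0]; field_simp
  linarith

open ArithmeticFunction in
lemma primes_AP (N : ℕ) (hN : N ≠ 0) (a : ZMod N) (ha : IsUnit a) (η : ℝ) (hη : 0 < η) :
    ∃ δ : ℝ, 0 < δ ∧ δ ≤ 1 ∧ ∃ W0 : ℝ, 1 ≤ W0 ∧ ∀ W : ℝ, W0 ≤ W → ∃ j : ℕ,
      W ^ δ ≤ 2 ^ (j + 1) ∧ (2 : ℝ) ^ j ≤ W ∧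
      ((2 : ℝ) ^ j) ^ (1 - η) ≤
        (((Finset.Ico (2 ^ j) (2 ^ (j + 1))).filter
          (fun k : ℕ => k.Prime ∧ (k : ZMod N) = a)).card : ℝ) := by
  have : NeZero N := ⟨hN⟩
  set r := vonMangoldt.residueClass a with hr
  set b : ℕ → ℝ := fun k => if k.Prime then r k else 0 with hb
  set b' : ℕ → ℝ := fun k => if k.Prime then 0 else r k with hb'
  have hrn : ∀ k, 0 ≤ r k := fun k => vonMangoldt.residueClass_nonneg a k
  have hsumr : ∀ x : ℝ, 1 < x → Summable fun k : ℕ => r k / (k : ℝ) ^ x := by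
    intro x hx
    have h1 : LSeriesSummable (fun n => ((r n : ℝ) : ℂ)) x := by
      apply LSeriesSummable_of_abscissaOfAbsConv_lt_re
      refine lt_of_le_of_lt (vonMangoldt.abscissaOfAbsConv_residueClass_le_one a) ?_
      simpa using by exact_mod_cast hx
    have h2 := h1.norm
    refine h2.congr fun k => ?_
    rw [LSeries.norm_term_eq]
    rcases eq_or_ne k 0 with rfl | hk
    · simp [hr]
    · simp [hk, abs_of_nonneg (hrn k)]
  have hval : ∀ x : ℝ, 1 < x → ∑' k : ℕ, r k / (k : ℝ) ^ x =
      (vonMangoldt.LFunctionResidueClassAux a x).re + (N.totient : ℝ)⁻¹ / (x - 1) := by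
    intro x hx
    apply Complex.ofReal_injective
    push_cast
    rw [← vonMangoldt.LFunctionResidueClassAux_real ha hx,
      vonMangoldt.eqOn_LFunctionResidueClassAux ha (by simpa using hx)]
    simp only [sub_add_cancel]
    rw [LSeries]
    congr 1; ext k
    rw [LSeries.term_def]
    rcases eq_or_ne k 0 with rfl | hk
    · simp [hr]
    · simp only [hk, if_false]
      rw [Complex.ofReal_cpow (Nat.cast_nonneg _), Complex.ofReal_natCast]
  obtain ⟨C1, hC1⟩ : ∃ C1 : ℝ, ∀ x : ℝ, 1 ≤ x → x ≤ 2 →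
      |(vonMangoldt.LFunctionResidueClassAux a x).re| ≤ C1 := by
    have hcont : ContinuousOn (fun x : ℝ ↦ (vonMangoldt.LFunctionResidueClassAux a x).re) (Set.Icc 1 2) :=
      Complex.continuous_re.continuousOn.comp (t := Set.univ)
        (vonMangoldt.continuousOn_LFunctionResidueClassAux a)
        (fun ⦃x⦄ a ↦ trivial) |>.comp Complex.continuous_ofReal.continuousOn fun x hx ↦ by
          simpa using hx.1
    obtain ⟨C, hC⟩ := isCompact_Icc.exists_bound_of_continuousOn hcont
    exact ⟨C, fun x h1 h2 => by simpa using hC x ⟨h1, h2⟩⟩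
  have hnp : Summable fun k : ℕ => b' k / (k : ℝ) := vonMangoldt.summable_residueClass_non_primes_div a
  set C2 : ℝ := ∑' k : ℕ, b' k / (k : ℝ) with hC2
  have hb'n : ∀ k, 0 ≤ b' k := fun k => by simp only [hb']; split_ifs <;> simp [hrn]
  have hbn : ∀ k, 0 ≤ b k := fun k => by simp only [hb]; split_ifs <;> simp [hrn]
  have hC2n : 0 ≤ C2 := tsum_nonneg fun k => div_nonneg (hb'n k) (by positivity)
  have hC1n : 0 ≤ C1 := le_trans (abs_nonneg _) (hC1 1 le_rfl (by norm_num))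
  have hsb : ∀ x : ℝ, 1 < x → Summable fun k : ℕ => b k / (k : ℝ) ^ x := by
    intro x hx
    refine Summable.of_nonneg_of_le (fun k => div_nonneg (hbn k) (by positivity)) (fun k => ?_) (hsumr x hx)
    gcongr
    simp only [hb]; split_ifs <;> simp [hrn]
  have htot : (N.totient : ℝ)⁻¹ > 0 := by
    have := Nat.totient_pos.2 (Nat.pos_of_ne_zero hN)
    positivity
  have q1 : ∀ k, b k ≤ Real.log k := by
    intro k
    simp only [hb]
    split_ifs
    · exact (vonMangoldt.residueClass_le a k).trans vonMangoldt_le_log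
    · exact Real.log_natCast_nonneg k
  have q2 : ∀ x : ℝ, 1 < x → x ≤ 2 →
      (N.totient : ℝ)⁻¹ / (x - 1) - (C1 + C2) ≤ ∑' k : ℕ, b k / (k : ℝ) ^ x := by
    intro x hx hx2
    have e : ∑' k : ℕ, r k / (k : ℝ) ^ x ≤ ∑' k : ℕ, b k / (k : ℝ) ^ x + C2 := by
      rw [hC2, ← (hsb x hx).tsum_add hnp]
      refine (hsumr x hx).tsum_le_tsum (fun k => ?_) ((hsb x hx).add hnp)
      simp only [hb, hb']
      by_cases hp : k.Prime
      · simp [hp]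
      · simp only [hp, if_false, zero_div, zero_add]
        rcases Nat.eq_zero_or_pos k with rfl | hk
        · simp [hr]
        have hk1 : (1 : ℝ) ≤ k := by exact_mod_cast hk
        have := hrn k
        gcongr
        calc (k : ℝ) = (k : ℝ) ^ (1 : ℝ) := (Real.rpow_one _).symm
          _ ≤ _ := Real.rpow_le_rpow_of_exponent_le hk1 hx.le
    rw [hval x hx] at e
    have := (abs_le.1 (hC1 x hx.le hx2)).1
    linarith
  have q3 : ∀ x : ℝ, 1 < x → x ≤ 2 →
      ∑' k : ℕ, b k / (k : ℝ) ^ x ≤ (N.totient : ℝ)⁻¹ / (x - 1) + (C1 + C2) := by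
    intro x hx hx2
    have e : ∑' k : ℕ, b k / (k : ℝ) ^ x ≤ ∑' k : ℕ, r k / (k : ℝ) ^ x := by
      refine (hsb x hx).tsum_le_tsum (fun k => ?_) (hsumr x hx)
      gcongr
      simp only [hb]; split_ifs <;> simp [hrn]
    rw [hval x hx] at e
    have := (abs_le.1 (hC1 x hx.le hx2)).2
    linarith
  obtain ⟨δ, h0, h1, W0, hW0, H⟩ := dyadic_of_dirichlet b hbn q1 (N.totient : ℝ)⁻¹ (C1 + C2) htot (by positivity) hsb q2 q3 η hη
  · refine ⟨δ, h0, h1, W0, hW0, fun W hW => ?_⟩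
    obtain ⟨j, hj1, hj2, hj3⟩ := H W hW
    refine ⟨j, hj1, hj2, hj3.trans ?_⟩
    norm_cast
    apply Finset.card_le_card
    intro k hk
    simp only [Finset.mem_filter] at hk ⊢
    refine ⟨hk.1, ?_⟩
    have h2 := hk.2
    simp only [hb, hr, vonMangoldt.residueClass] at h2
    by_cases hp : k.Prime
    · refine ⟨hp, ?_⟩
      rw [if_pos hp] at h2
      by_contra hne
      exact h2 (Set.indicator_of_notMem (s := {n : ℕ | (n : ZMod N) = a}) hne _)
    · simp [hp] at h2

end PureTwoTorsion


namespace PureTwoTorsion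
open NumberField

lemma tuple_count (n : ℕ) : ∀ (X : ℕ), 1 ≤ X → ∀ T : Finset (Fin n → ℕ),
    (∀ d ∈ T, (∀ i, 1 ≤ d i) ∧ ∏ i, d i ≤ X) →
    (T.card : ℝ) ≤ X * (1 + Real.log X) ^ n := by
  induction n with
  | zero =>
    intro X hX T _
    have : T.card ≤ 1 := Finset.card_le_one_of_subsingleton T
    simp only [pow_zero, mul_one]
    exact_mod_cast this.trans hX
  | succ n ih =>
    intro X hX T hT
    have hXr : (1 : ℝ) ≤ X := by exact_mod_cast hX
    have hlog : 0 ≤ Real.log X := Real.log_nonneg hXr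
    have h1 : T.card = ∑ a ∈ Finset.Icc 1 X, (T.filter (fun d => d 0 = a)).card := by
      apply Finset.card_eq_sum_card_fiberwise
      intro d hd
      obtain ⟨h1, h2⟩ := hT d hd
      simp only [Finset.coe_Icc, Set.mem_Icc]
      refine ⟨h1 0, le_trans ?_ h2⟩
      exact Nat.le_of_dvd (Finset.prod_pos (fun i _ => h1 i)) (Finset.dvd_prod_of_mem d (Finset.mem_univ 0))
    have h2 : ∀ a ∈ Finset.Icc 1 X, ((T.filter (fun d => d 0 = a)).card : ℝ) ≤
        (X * (1 + Real.log X) ^ n) * (a : ℝ)⁻¹ := by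
      intro a ha
      obtain ⟨ha1, ha2⟩ := Finset.mem_Icc.mp ha
      have hinj : ((T.filter (fun d => d 0 = a)).image (fun d => Fin.tail d)).card =
          (T.filter (fun d => d 0 = a)).card := by
        apply Finset.card_image_of_injOn
        intro d hd d' hd' hdd
        have e1 := (Finset.mem_filter.mp hd).2
        have e2 := (Finset.mem_filter.mp hd').2
        rw [← Fin.cons_self_tail d, ← Fin.cons_self_tail d']
        simp only at hdd
        rw [hdd, e1, e2]
      rw [← hinj]
      have hdiv : 1 ≤ X / a := Nat.div_pos ha2 ha1
      have := ih (X / a) hdiv ((T.filter (fun d => d 0 = a)).image (fun d => Fin.tail d)) ?_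
      · refine this.trans ?_
        have hc : ((X / a : ℕ) : ℝ) ≤ X / a := Nat.cast_div_le
        have hc1 : (1 : ℝ) ≤ ((X / a : ℕ) : ℝ) := by exact_mod_cast hdiv
        have hl : Real.log ((X / a : ℕ) : ℝ) ≤ Real.log X := by
          apply Real.log_le_log (by linarith)
          exact_mod_cast Nat.div_le_self X a
        have hl0 := Real.log_nonneg hc1
        calc ((X / a : ℕ) : ℝ) * (1 + Real.log ((X / a : ℕ) : ℝ)) ^ n
            ≤ (X / a) * (1 + Real.log X) ^ n := by gcongr
          _ = _ := by ring
      · intro d hd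
        obtain ⟨d', hd', rfl⟩ := Finset.mem_image.mp hd
        obtain ⟨hm, he⟩ := Finset.mem_filter.mp hd'
        obtain ⟨g1, g2⟩ := hT d' hm
        refine ⟨fun i => g1 _, ?_⟩
        rw [Nat.le_div_iff_mul_le (by omega)]
        rw [Fin.prod_univ_succ, he] at g2
        rw [mul_comm]; exact g2
    rw [h1]
    push_cast
    refine (Finset.sum_le_sum h2).trans ?_
    rw [← Finset.mul_sum]
    have h3 : ∑ a ∈ Finset.Icc 1 X, (a : ℝ)⁻¹ ≤ 1 + Real.log X := by
      have := harmonic_le_one_add_log X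
      rw [harmonic_eq_sum_Icc] at this
      push_cast at this
      exact this
    calc _ ≤ (X * (1 + Real.log X) ^ n) * (1 + Real.log X) := by gcongr
      _ = _ := by ring

lemma exists_prime_index (K : Type) [Field K] [NumberField K] :
    ∃ e : Ideal (𝓞 K) → Fin (Module.finrank ℚ K), ∀ P Q : Ideal (𝓞 K), P.IsPrime → P ≠ ⊥ →
      Q.IsPrime → Q ≠ ⊥ → P.under ℤ = Q.under ℤ → e P = e Q → P = Q := by
  classical
  have hpos : 0 < Module.finrank ℚ K := Module.finrank_pos
  have key : ∀ p : Ideal ℤ, ∃ f : Ideal (𝓞 K) → Fin (Module.finrank ℚ K), (p.IsMaximal ∧ p ≠ ⊥) →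
      Set.InjOn f (IsDedekindDomain.primesOverFinset p (𝓞 K)) := by
    intro p
    by_cases hp : p.IsMaximal ∧ p ≠ ⊥
    · obtain ⟨hp1, hp0⟩ := hp
      have hc := Ideal.card_primesOverFinset_le_finrank (𝓞 K) ℚ K (p := p) hp0
      obtain ⟨f, -, hf⟩ := Finset.exists_subset_card_eq
        (s := (Finset.univ : Finset (Fin (Module.finrank ℚ K)))) (by simpa using hc)
      have : Nonempty (Fin (Module.finrank ℚ K)) := ⟨⟨0, hpos⟩⟩
      have := Finset.equivOfCardEq hf.symm
      refine ⟨fun P => if h : P ∈ IsDedekindDomain.primesOverFinset p (𝓞 K) then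
        (this ⟨P, h⟩ : Fin _) else ⟨0, hpos⟩, fun _ P hP Q hQ hPQ => ?_⟩
      simp only [Finset.mem_coe.mp hP, Finset.mem_coe.mp hQ, dif_pos] at hPQ
      have := this.injective (Subtype.ext hPQ)
      exact congrArg Subtype.val this
    · exact ⟨fun _ => ⟨0, hpos⟩, fun h => absurd h hp⟩
  choose f hf using key
  refine ⟨fun P => f (P.under ℤ) P, fun P Q hP hP0 hQ hQ0 hPQ he => ?_⟩
  have hmax : P.IsMaximal := hP.isMaximal hP0
  have h1 : (P.under ℤ).IsMaximal := Ideal.isMaximal_comap_of_isIntegral_of_isMaximal P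
  have h0 : P.under ℤ ≠ ⊥ := mt Ideal.eq_bot_of_comap_eq_bot hP0
  refine hf (P.under ℤ) ⟨h1, h0⟩ ?_ ?_ (by simpa [hPQ] using he)
  · rw [Finset.mem_coe, IsDedekindDomain.mem_primesOverFinset_iff h0]
    exact ⟨hP, ⟨rfl⟩⟩
  · rw [Finset.mem_coe, IsDedekindDomain.mem_primesOverFinset_iff h0]
    exact ⟨hQ, ⟨hPQ⟩⟩

open UniqueFactorizationMonoid in
lemma ideal_count (K : Type) [Field K] [NumberField K] (X : ℕ) (hX : 1 ≤ X)
    (S : Finset (Ideal (𝓞 K))) (hS : ∀ A ∈ S, A ≠ ⊥ ∧ Ideal.absNorm A ≤ X) :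
    (S.card : ℝ) ≤ X * (1 + Real.log X) ^ (Module.finrank ℚ K) := by
  classical
  obtain ⟨e, he⟩ := exists_prime_index K
  let p : Ideal (𝓞 K) → ℕ := fun P => Ideal.absNorm (P.under ℤ)
  have hp : ∀ P : Ideal (𝓞 K), P.IsPrime → P ≠ ⊥ → (p P).Prime := by
    intro P h1 h2
    have : NeZero P := ⟨h2⟩
    exact Nat.absNorm_under_prime P
  let d : Ideal (𝓞 K) → Fin (Module.finrank ℚ K) → ℕ := fun A i =>
    (((normalizedFactors A).filter (fun P => e P = i)).map p).prod
  have hfac : ∀ A : Ideal (𝓞 K), A ≠ ⊥ → ∀ P ∈ normalizedFactors A, P.IsPrime ∧ P ≠ ⊥ := by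
    intro A hA P hP
    have := prime_of_normalized_factor P hP
    exact ⟨Ideal.isPrime_of_prime this, this.ne_zero⟩
  have hfacp : ∀ A : Ideal (𝓞 K), A ≠ ⊥ → ∀ i, ∀ x ∈ ((normalizedFactors A).filter
      (fun P => e P = i)).map p, x.Prime := by
    intro A hA i x hx
    obtain ⟨P, hP, rfl⟩ := Multiset.mem_map.mp hx
    have := hfac A hA P (Multiset.mem_filter.mp hP).1
    exact hp P this.1 this.2
  have hcount : ∀ A : Ideal (𝓞 K), A ≠ ⊥ → ∀ P : Ideal (𝓞 K), P.IsPrime → P ≠ ⊥ →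
      (d A (e P)).factorization (p P) = (normalizedFactors A).count P := by
    intro A hA P hP hP0
    have h1 : normalizedFactors (d A (e P)) = ((normalizedFactors A).filter
      (fun Q => e Q = e P)).map p := by
      rw [Nat.factors_multiset_prod_of_irreducible]
      intro x hx
      exact (hfacp A hA _ x hx).prime.irreducible
    rw [← Nat.primeFactorsList_count_eq]
    have h2 : List.count (p P) (d A (e P)).primeFactorsList =
      (normalizedFactors (d A (e P))).count (p P) := by
      rw [Nat.factors_eq, Multiset.coe_count]
    rw [h2, h1, Multiset.count_map, Multiset.filter_filter, Multiset.count_eq_card_filter_eq]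
    congr 1
    apply Multiset.filter_congr
    intro Q hQ
    obtain ⟨hQ1, hQ0⟩ := hfac A hA Q hQ
    constructor
    · rintro ⟨h3, h4⟩
      refine he P Q hP hP0 hQ1 hQ0 ?_ h4.symm
      have := congrArg (fun n : ℕ => Ideal.span {(n : ℤ)}) h3
      simpa only [p, Int.ideal_span_absNorm_eq_self] using this
    · rintro rfl; exact ⟨rfl, rfl⟩
  have hinj : Set.InjOn d S := by
    intro A hA B hB hAB
    have hA0 := (hS A hA).1
    have hB0 := (hS B hB).1
    have : normalizedFactors A = normalizedFactors B := by
      ext P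
      by_cases hP : P.IsPrime ∧ P ≠ ⊥
      · rw [← hcount A hA0 P hP.1 hP.2, ← hcount B hB0 P hP.1 hP.2, hAB]
      · rw [Multiset.count_eq_zero_of_notMem (fun h => hP (hfac A hA0 P h)),
          Multiset.count_eq_zero_of_notMem (fun h => hP (hfac B hB0 P h))]
    rw [← Ideal.prod_normalizedFactors_eq_self hA0, this, Ideal.prod_normalizedFactors_eq_self hB0]
  rw [← Finset.card_image_of_injOn hinj]
  apply tuple_count _ X hX
  intro f hf
  obtain ⟨A, hA, rfl⟩ := Finset.mem_image.mp hf
  obtain ⟨hA0, hAX⟩ := hS A hA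
  refine ⟨fun i => ?_, le_trans ?_ hAX⟩
  · rw [Nat.one_le_iff_ne_zero]
    intro h0
    have := Multiset.prod_eq_zero_iff.mp h0
    exact (hfacp A hA0 i 0 this).ne_zero rfl
  · have h1 : ∏ i, d A i = ((normalizedFactors A).map p).prod := by
      have : ∀ s : Multiset (Ideal (𝓞 K)), ∏ i, ((s.filter (fun P => e P = i)).map p).prod =
          (s.map p).prod := by
        intro s
        induction s using Multiset.induction with
        | empty => simp
        | cons a s ih =>
          rw [Multiset.map_cons, Multiset.prod_cons, ← ih]
          have : ∀ i, (((a ::ₘ s).filter (fun P => e P = i)).map p).prod =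
            (if e a = i then p a else 1) * ((s.filter (fun P => e P = i)).map p).prod := by
            intro i
            by_cases h : e a = i <;> simp [h]
          simp_rw [this]
          rw [Finset.prod_mul_distrib]
          simp
      exact this _
    have h2 : Ideal.absNorm A = ((normalizedFactors A).map (fun P => Ideal.absNorm P)).prod := by
      conv_lhs => rw [← Ideal.prod_normalizedFactors_eq_self hA0]
      rw [map_multiset_prod]
    rw [h1, h2]
    apply Multiset.prod_map_le_prod_map₀
    · intros; exact Nat.zero_le _
    · intro P hP
      obtain ⟨hP1, hP0⟩ := hfac A hA0 P hP
      apply Nat.le_of_dvd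
      · rw [Nat.pos_iff_ne_zero, Ne, Ideal.absNorm_eq_zero_iff]; exact hP0
      · exact Int.absNorm_under_dvd_absNorm P

end PureTwoTorsion


namespace PureTwoTorsion
open NumberField

lemma irred_pure (n : ℕ) (hn : 1 ≤ n) (q : ℕ) (hq : q.Prime) :
    Irreducible (Polynomial.X ^ n - Polynomial.C (q : ℚ)) := by
  have hqZ : Prime (q : ℤ) := Nat.prime_iff_prime_int.mp hq
  have hmon : (Polynomial.X ^ n - Polynomial.C (q : ℤ)).Monic :=
    Polynomial.monic_X_pow_sub_C _ (by omega)
  have hdeg : (Polynomial.X ^ n - Polynomial.C (q : ℤ)).natDegree = n :=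
    Polynomial.natDegree_X_pow_sub_C
  have h1 : Irreducible (Polynomial.X ^ n - Polynomial.C (q : ℤ)) := by
    apply Polynomial.IsEisensteinAt.irreducible (𝓟 := Ideal.span {(q : ℤ)})
    · refine ⟨?_, ?_, ?_⟩
      · rw [hmon.leadingCoeff, Ideal.mem_span_singleton]
        exact fun h => hqZ.not_isUnit (isUnit_of_dvd_one h)
      · intro m hm
        rw [hdeg] at hm
        rw [Polynomial.coeff_sub, Polynomial.coeff_X_pow, if_neg (by omega), Polynomial.coeff_C]
        split_ifs
        · rw [zero_sub, neg_mem_iff]; exact Ideal.mem_span_singleton_self _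
        · simp
      · rw [Polynomial.coeff_sub, Polynomial.coeff_X_pow, if_neg (by omega), Polynomial.coeff_C,
          if_pos rfl, zero_sub, neg_mem_iff, Ideal.span_singleton_pow, Ideal.mem_span_singleton]
        intro h
        have h2 : (q ^ 2 : ℕ) ∣ q := by exact_mod_cast h
        have := Nat.le_of_dvd hq.pos h2
        nlinarith [hq.two_le]
    · rwa [Ideal.span_singleton_prime hqZ.ne_zero]
    · exact hmon.isPrimitive
    · rw [hdeg]; omega
  have h2 := (Polynomial.Monic.irreducible_iff_irreducible_map_fraction_map (K := ℚ) hmon).mp h1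
  simpa using h2

variable {K : Type} [Field K] [NumberField K]

lemma minpoly_theta {n q : ℕ} (hn : 1 ≤ n) (hq : q.Prime) {θ : K} (hθ : θ ^ n = q) :
    minpoly ℚ θ = Polynomial.X ^ n - Polynomial.C (q : ℚ) := by
  refine (minpoly.eq_of_irreducible_of_monic (irred_pure n hn q hq) ?_
    (Polynomial.monic_X_pow_sub_C _ (by omega))).symm
  simp [hθ]

lemma exists_pb {n q : ℕ} (hn : 1 ≤ n) (hK : Module.finrank ℚ K = n) (hq : q.Prime) {θ : K}
    (hθ : θ ^ n = q) : ∃ b : Module.Basis (Fin n) ℚ K, ∀ i, b i = θ ^ (i : ℕ) := by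
  have hm := minpoly_theta hn hq hθ
  have hdeg : (minpoly ℚ θ).natDegree = n := by
    rw [hm]; exact Polynomial.natDegree_X_pow_sub_C
  have hli := linearIndependent_pow (K := ℚ) θ
  rw [hdeg] at hli
  have : Nonempty (Fin n) := ⟨⟨0, by omega⟩⟩
  exact ⟨basisOfLinearIndependentOfCardEqFinrank hli (by simp [hK]), fun i => by simp⟩

lemma trace_pow_theta {n q : ℕ} (hn : 1 ≤ n) (hK : Module.finrank ℚ K = n) (hq : q.Prime) {θ : K}
    (hθ : θ ^ n = q) {m : ℕ} (hm : 0 < m) (hmn : m < n) : Algebra.trace ℚ K (θ ^ m) = 0 := by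
  obtain ⟨b, hb⟩ := exists_pb hn hK hq hθ
  rw [Algebra.trace_eq_matrix_trace b, Matrix.trace]
  apply Finset.sum_eq_zero
  intro i _
  rw [Matrix.diag_apply, Algebra.leftMulMatrix_eq_repr_mul, hb, ← pow_add]
  by_cases h : m + i < n
  · have : θ ^ (m + (i : ℕ)) = b ⟨m + i, h⟩ := by rw [hb]
    rw [this, Module.Basis.repr_self, Finsupp.single_apply, if_neg]
    intro h'; have := congrArg Fin.val h'; simp at this; omega
  · have : θ ^ (m + (i : ℕ)) = (q : ℚ) • b ⟨m + i - n, by omega⟩ := by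
      have e : m + (i : ℕ) = n + (m + i - n) := by omega
      rw [hb, Algebra.smul_def]
      conv_lhs => rw [e, pow_add, hθ]
      simp
    rw [this, map_smul, Module.Basis.repr_self, Finsupp.smul_apply, Finsupp.single_apply, if_neg,
      smul_zero]
    intro h'; have := congrArg Fin.val h'; simp at this; omega

lemma trace_dvd_of_pow_dvd {q m : ℕ} (hq : q.Prime) {x y : 𝓞 K} (h : x ^ m = q * y) :
    (q : ℤ) ∣ Algebra.trace ℤ (𝓞 K) x := by
  classical
  have : Fact q.Prime := ⟨hq⟩
  let b := RingOfIntegers.basis K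
  let M := (Algebra.leftMulMatrix b x).map (Int.castRingHom (ZMod q))
  have hM : M ^ m = 0 := by
    have h1 : (Algebra.leftMulMatrix b x) ^ m = (q : Matrix _ _ ℤ) * Algebra.leftMulMatrix b y := by
      rw [← map_pow, h, map_mul, map_natCast]
    have h2 : M ^ m = (Int.castRingHom (ZMod q)).mapMatrix ((Algebra.leftMulMatrix b x) ^ m) := by
      rw [map_pow]; rfl
    rw [h2, h1, map_mul, map_natCast]
    have : (q : Matrix (Module.Free.ChooseBasisIndex ℤ (𝓞 K))
      (Module.Free.ChooseBasisIndex ℤ (𝓞 K)) (ZMod q)) = 0 := by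
      ext i j
      by_cases hij : i = j
      · subst hij; simp
      · simp [Matrix.natCast_apply, hij]
    rw [this, zero_mul]
  have h3 := Matrix.isNilpotent_trace_of_isNilpotent (M := M) ⟨m, hM⟩
  have h4 : M.trace = 0 := h3.eq_zero
  rw [← ZMod.intCast_zmod_eq_zero_iff_dvd, Algebra.trace_eq_matrix_trace b, ← h4]
  simp [M, Matrix.trace]

/-- `n • z` has integral coordinates in the basis of powers of `θ`, given by traces. -/
lemma exists_coords {n q : ℕ} (hn : 1 ≤ n) (hK : Module.finrank ℚ K = n) (hq : q.Prime) {θ : 𝓞 K}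
    (hθ : θ ^ n = q) (z : 𝓞 K) : ∃ y : Fin n → ℤ, (n : 𝓞 K) * z = ∑ i, (y i : 𝓞 K) * θ ^ (i : ℕ) ∧
      ∀ i : Fin n, ((y i : ℤ) : ℚ) = Algebra.trace ℚ K ((z : K) * ((θ : K) ^ (i : ℕ))⁻¹) := by
  have hθK : (θ : K) ^ n = q := by
    have := congrArg (algebraMap (𝓞 K) K) hθ
    simpa using this
  have hq0 : (q : K) ≠ 0 := by exact_mod_cast hq.ne_zero
  have hθ0 : (θ : K) ≠ 0 := by
    intro h
    rw [h, zero_pow (by omega)] at hθK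
    exact hq0 hθK.symm
  obtain ⟨b, hb⟩ := exists_pb hn hK hq hθK
  have hinv : ∀ i : ℕ, i ≤ n → ((θ : K) ^ i)⁻¹ = (θ : K) ^ (n - i) * (q : K)⁻¹ := by
    intro i hi
    have : (θ : K) ^ i ≠ 0 := pow_ne_zero _ hθ0
    field_simp
    rw [← pow_add, ← hθK]; congr 1; omega
  have hintg : ∀ i : Fin n, ∃ y : ℤ, ((y : ℤ) : ℚ) =
      Algebra.trace ℚ K ((z : K) * ((θ : K) ^ (i : ℕ))⁻¹) := by
    intro i
    by_cases hi : (i : ℕ) = 0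
    · refine ⟨Algebra.trace ℤ (𝓞 K) z, ?_⟩
      rw [Algebra.coe_trace_int, hi]; simp
    · have h1 : (q : ℤ) ∣ Algebra.trace ℤ (𝓞 K) (z * θ ^ (n - (i : ℕ))) := by
        apply trace_dvd_of_pow_dvd (m := n) hq (y := z ^ n * (q : 𝓞 K) ^ (n - (i : ℕ) - 1))
        rw [mul_pow, ← pow_mul, mul_comm (n - (i : ℕ)) n, pow_mul, hθ]
        have : n - (i : ℕ) = (n - (i : ℕ) - 1) + 1 := by omega
        conv_lhs => rw [this, pow_succ]
        ring
      obtain ⟨c, hc⟩ := h1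
      refine ⟨c, ?_⟩
      rw [hinv i (by omega)]
      have h2 : (z : K) * ((θ : K) ^ (n - (i : ℕ)) * (q : K)⁻¹) =
          (q : ℚ)⁻¹ • ((z * θ ^ (n - (i : ℕ)) : 𝓞 K) : K) := by
        rw [Algebra.smul_def]; simp; ring
      rw [h2, map_smul, ← Algebra.coe_trace_int, hc]
      have : (q : ℚ) ≠ 0 := by exact_mod_cast hq.ne_zero
      simp [this]
  choose y hy using hintg
  refine ⟨y, ?_, hy⟩
  apply RingOfIntegers.ext
  have hcoord : ∀ i, (y i : ℚ) = n * b.repr (z : K) i := by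
    intro i
    rw [hy i]
    have hz : (z : K) = ∑ j, b.repr (z : K) j • (θ : K) ^ (j : ℕ) := by
      conv_lhs => rw [← b.sum_repr (z : K)]
      simp [hb]
    conv_lhs => rw [hz]
    rw [Finset.sum_mul, map_sum, Finset.sum_eq_single i]
    · rw [smul_mul_assoc, mul_inv_cancel₀ (pow_ne_zero _ hθ0), map_smul]
      have : Algebra.trace ℚ K (1 : K) = n := by
        have := Algebra.trace_algebraMap (S := K) (1 : ℚ)
        simpa [hK] using this
      rw [this, smul_eq_mul]; ring
    · intro j _ hj
      rw [smul_mul_assoc, map_smul]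
      have hji : (j : ℕ) ≠ i := fun h => hj (Fin.ext h)
      have : Algebra.trace ℚ K ((θ : K) ^ (j : ℕ) * ((θ : K) ^ (i : ℕ))⁻¹) = 0 := by
        rcases lt_or_gt_of_ne hji with h | h
        · have e : (θ : K) ^ (j : ℕ) * ((θ : K) ^ (i : ℕ))⁻¹ =
              (q : ℚ)⁻¹ • (θ : K) ^ (n - ((i : ℕ) - j)) := by
            rw [hinv i (by omega), ← mul_assoc, ← pow_add, Algebra.smul_def]
            rw [show (j : ℕ) + (n - i) = n - ((i : ℕ) - j) by omega]
            simp [mul_comm]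
          rw [e, map_smul, trace_pow_theta hn hK hq hθK (by omega) (by omega), smul_zero]
        · have e : (θ : K) ^ (j : ℕ) * ((θ : K) ^ (i : ℕ))⁻¹ = (θ : K) ^ ((j : ℕ) - i) := by
            rw [pow_sub₀ _ hθ0 h.le]
          rw [e, trace_pow_theta hn hK hq hθK (by omega) (by omega)]
      rw [this, smul_zero]
    · simp
  have hz : (z : K) = ∑ j, b.repr (z : K) j • (θ : K) ^ (j : ℕ) := by
    conv_lhs => rw [← b.sum_repr (z : K)]
    simp [hb]
  simp only [map_mul, map_sum, map_natCast, map_intCast, map_pow]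
  change (n : K) * (z : K) = ∑ i, (y i : K) * (θ : K) ^ (i : ℕ)
  rw [hz, Finset.mul_sum]
  apply Finset.sum_congr rfl
  intro i _
  have := congrArg (algebraMap ℚ K) (hcoord i)
  simp only [map_intCast, map_mul, map_natCast] at this
  rw [this, Algebra.smul_def]; ring

lemma place_theta {n q : ℕ} (hn : 1 ≤ n) {θ : K}
    (hθ : θ ^ n = q) (w : InfinitePlace K) : w θ = (q : ℝ) ^ ((1 : ℝ) / n) := by
  have h1 : (w θ) ^ n = q := by
    rw [← map_pow, hθ, ← Rat.cast_natCast, ← eq_ratCast (algebraMap ℚ K)]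
    simp
  rw [← h1, one_div, Real.pow_rpow_inv_natCast (apply_nonneg w θ) (by omega)]

lemma abs_trace_le {n : ℕ} (hK : Module.finrank ℚ K = n) (x : K) (B : ℝ)
    (hB : ∀ w : InfinitePlace K, w x ≤ B) : |((Algebra.trace ℚ K x : ℚ) : ℝ)| ≤ n * B := by
  have h1 := trace_eq_sum_embeddings (K := ℚ) (L := K) ℂ (x := x)
  have h2 : |((Algebra.trace ℚ K x : ℚ) : ℝ)| = ‖(algebraMap ℚ ℂ) (Algebra.trace ℚ K x)‖ := by
    rw [eq_ratCast, ← Complex.ofReal_ratCast, Complex.norm_real, Real.norm_eq_abs]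
  rw [h2, h1]
  refine (norm_sum_le _ _).trans ?_
  have h3 : ∀ σ : K →ₐ[ℚ] ℂ, ‖σ x‖ ≤ B := fun σ => by
    have := hB (InfinitePlace.mk (σ : K →+* ℂ))
    rwa [InfinitePlace.apply] at this
  refine (Finset.sum_le_card_nsmul _ _ B (fun σ _ => h3 σ)).trans ?_
  rw [Finset.card_univ, AlgHom.card, hK, nsmul_eq_mul]

lemma coords_bound {n q : ℕ} (hn : 1 ≤ n) (hK : Module.finrank ℚ K = n) (hq : q.Prime) {θ : 𝓞 K}
    (hθ : θ ^ n = q) (z : 𝓞 K) (B : ℝ) (hB : ∀ w : InfinitePlace K, w (z : K) ≤ B) :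
    ∃ y : Fin n → ℤ, (n : 𝓞 K) * z = ∑ i, (y i : 𝓞 K) * θ ^ (i : ℕ) ∧
      ∀ i : Fin n, |(y i : ℝ)| ≤ n * (B * (q : ℝ) ^ (-((i : ℕ) : ℝ) / n)) := by
  obtain ⟨y, hy1, hy2⟩ := exists_coords hn hK hq hθ z
  have hθK : (θ : K) ^ n = q := by
    have := congrArg (algebraMap (𝓞 K) K) hθ
    simpa using this
  refine ⟨y, hy1, fun i => ?_⟩
  have : ((y i : ℤ) : ℝ) = ((((y i : ℤ) : ℚ)) : ℝ) := by simp
  rw [this, hy2]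
  apply abs_trace_le hK
  intro w
  rw [map_mul, map_inv₀, map_pow, place_theta hn hθK, ← Real.rpow_natCast, ← Real.rpow_mul
    (Nat.cast_nonneg q), ← Real.rpow_neg (Nat.cast_nonneg q)]
  have : -(1 / (n : ℝ) * ((i : ℕ) : ℝ)) = -((i : ℕ) : ℝ) / n := by ring
  rw [this]
  gcongr
  exact hB w

lemma natAbs_norm_theta {n q : ℕ} (hn : 1 ≤ n) (hK : Module.finrank ℚ K = n) {θ : K}
    (hθ : θ ^ n = q) : |Algebra.norm ℚ θ| = q := by
  have h1 : (Algebra.norm ℚ θ) ^ n = (q : ℚ) ^ n := by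
    rw [← map_pow, hθ]
    have := Algebra.norm_algebraMap (S := K) (x := (q : ℚ))
    rw [hK] at this
    simpa using this
  have h2 : |Algebra.norm ℚ θ| ^ n = (q : ℚ) ^ n := by rw [← abs_pow, h1, abs_of_nonneg (by positivity)]
  exact (pow_left_inj₀ (abs_nonneg _) (Nat.cast_nonneg q) (by omega)).mp h2

lemma discr_theta {n q : ℕ} (hn : 1 ≤ n) (hK : Module.finrank ℚ K = n) (hq : q.Prime) {θ : K}
    (hθ : θ ^ n = q) :
    |Algebra.discr ℚ (fun i : Fin n => θ ^ (i : ℕ))| = (n : ℚ) ^ n * (q : ℚ) ^ (n - 1) := by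
  obtain ⟨b, hb⟩ := exists_pb hn hK hq hθ
  let pb : PowerBasis ℚ K := ⟨θ, n, b, hb⟩
  have h1 := Algebra.discr_powerBasis_eq_norm ℚ pb
  have h2 : (pb.basis : Fin n → K) = fun i : Fin n => θ ^ (i : ℕ) := by ext i; exact hb i
  have h3 : Algebra.discr ℚ (pb.basis) = Algebra.discr ℚ (fun i : Fin n => θ ^ (i : ℕ)) := by
    rw [← h2]
  rw [← h3, h1, abs_mul, abs_pow, abs_neg, abs_one, one_pow, one_mul]
  change |Algebra.norm ℚ (Polynomial.aeval θ (Polynomial.derivative (minpoly ℚ θ)))| = _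
  rw [minpoly_theta hn hq hθ]
  simp only [Polynomial.derivative_sub, Polynomial.derivative_X_pow, Polynomial.derivative_C,
    sub_zero, map_mul, map_pow, Polynomial.aeval_X, Polynomial.aeval_C, abs_mul, abs_pow]
  rw [natAbs_norm_theta hn hK hθ, Algebra.norm_algebraMap, hK]
  simp

lemma discr_le {n q : ℕ} (hn : 1 ≤ n) (hK : Module.finrank ℚ K = n) (hq : q.Prime) {θ : 𝓞 K}
    (hθ : θ ^ n = q) : |(discr K : ℝ)| ≤ (n : ℝ) ^ n * (q : ℝ) ^ (n - 1) ∧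
      (q : ℝ) ^ (n - 1) ≤ (n : ℝ) ^ n * |(discr K : ℝ)| := by
  classical
  have hθK : (θ : K) ^ n = q := by
    have := congrArg (algebraMap (𝓞 K) K) hθ
    simpa using this
  let b0 := RingOfIntegers.basis K
  have hcard : Fintype.card (Module.Free.ChooseBasisIndex ℤ (𝓞 K)) = n := by
    rw [← Module.finrank_eq_card_chooseBasisIndex, RingOfIntegers.rank, hK]
  let e : Module.Free.ChooseBasisIndex ℤ (𝓞 K) ≃ Fin n := Fintype.equivFinOfCardEq hcard
  let b := b0.reindex e
  have hb : Algebra.discr ℤ b = discr K := discr_eq_discr K b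
  have hcast : ∀ v : Fin n → 𝓞 K, ((Algebra.discr ℤ v : ℤ) : ℚ) =
      Algebra.discr ℚ (fun i => (v i : K)) := by
    intro v
    rw [Algebra.discr_def, Algebra.discr_def]
    have := (Int.castRingHom ℚ).map_det (Algebra.traceMatrix ℤ v)
    simp only [eq_intCast] at this
    rw [this]
    congr 1
    ext i j
    simp only [RingHom.mapMatrix_apply, Matrix.map_apply, Algebra.traceMatrix_apply,
      Algebra.traceForm_apply, eq_intCast]
    rw [Algebra.coe_trace_int]; simp
  let v : Fin n → 𝓞 K := fun i => θ ^ (i : ℕ)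
  have hv : |((Algebra.discr ℤ v : ℤ) : ℚ)| = (n : ℚ) ^ n * (q : ℚ) ^ (n - 1) := by
    rw [hcast, ← discr_theta hn hK hq hθK]; simp [v]
  have hv' : |Algebra.discr ℤ v| = (n : ℤ) ^ n * (q : ℤ) ^ (n - 1) := by exact_mod_cast hv
  have hpos : 0 < (n : ℤ) ^ n * (q : ℤ) ^ (n - 1) := by
    have := hq.pos; positivity
  -- first comparison
  have h1 : v = Matrix.vecMul (b : Fin n → 𝓞 K)
      ((Matrix.of (fun i j => b.repr (v j) i) : Matrix (Fin n) (Fin n) ℤ).map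
        (algebraMap ℤ (𝓞 K))) := by
    ext j
    conv_lhs => rw [← b.sum_repr (v j)]
    simp [Matrix.vecMul, dotProduct, mul_comm]
  have h1' := Algebra.discr_of_matrix_vecMul (b : Fin n → 𝓞 K)
    (Matrix.of (fun i j => b.repr (v j) i) : Matrix (Fin n) (Fin n) ℤ)
  rw [← h1, hb] at h1'
  have hco := fun j => exists_coords hn hK hq hθ (b j)
  choose y hy _ using hco
  have h2 : Matrix.vecMul (b : Fin n → 𝓞 K)
      (((n : ℤ) • (1 : Matrix (Fin n) (Fin n) ℤ)).map (algebraMap ℤ (𝓞 K))) =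
      Matrix.vecMul v ((Matrix.of (fun i j => y j i) : Matrix (Fin n) (Fin n) ℤ).map
        (algebraMap ℤ (𝓞 K))) := by
    ext j
    have := hy j
    simp only [Matrix.vecMul, dotProduct, v, Matrix.map_apply, Matrix.of_apply, Matrix.smul_apply,
      Matrix.one_apply]
    rw [Finset.sum_eq_single j (fun i _ hij => by simp [hij]) (by simp)]
    rw [mul_comm]
    simp only [if_true, smul_eq_mul, mul_one, eq_intCast, Int.cast_natCast]
    rw [this]
    simp [mul_comm]
  have h2' := Algebra.discr_of_matrix_vecMul (b : Fin n → 𝓞 K)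
    ((n : ℤ) • (1 : Matrix (Fin n) (Fin n) ℤ))
  rw [h2, Algebra.discr_of_matrix_vecMul, hb, Matrix.det_smul, Matrix.det_one, Fintype.card_fin,
    mul_one] at h2'
  have hD : discr K ≠ 0 := discr_ne_zero K
  have hn0 : (n : ℤ) ≠ 0 := by exact_mod_cast (by omega : n ≠ 0)
  generalize (Matrix.of (fun i j => b.repr (v j) i) : Matrix (Fin n) (Fin n) ℤ).det = P at h1'
  generalize (Matrix.of (fun i j => y j i) : Matrix (Fin n) (Fin n) ℤ).det = Q at h2'
  have hP0 : P ≠ 0 := by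
    rintro rfl
    rw [h1'] at hv'; rw [← hv'] at hpos; simp at hpos
  have hQ0 : Q ≠ 0 := by
    rintro rfl
    have : ((n : ℤ) ^ n) ^ 2 * discr K = 0 := by rw [← h2']; ring
    exact (mul_ne_zero (by positivity) hD) this
  have hP1 : 1 ≤ P ^ 2 := by have : 0 < P ^ 2 := by positivity
                             omega
  have hQ1 : 1 ≤ Q ^ 2 := by have : 0 < Q ^ 2 := by positivity
                             omega
  have k1 : |discr K| ≤ (n : ℤ) ^ n * (q : ℤ) ^ (n - 1) := by
    rw [← hv', h1', abs_mul, abs_of_nonneg (by positivity : 0 ≤ P ^ 2)]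
    nlinarith [abs_nonneg (discr K)]
  have k2 : (q : ℤ) ^ (n - 1) ≤ (n : ℤ) ^ n * |discr K| := by
    have h3 := congrArg abs h2'
    rw [abs_mul, abs_mul, abs_of_nonneg (by positivity : 0 ≤ Q ^ 2), hv',
      abs_of_nonneg (by positivity : 0 ≤ ((n : ℤ) ^ n) ^ 2)] at h3
    have hnn : 0 < (n : ℤ) ^ n := by positivity
    have h4 : Q ^ 2 * (q : ℤ) ^ (n - 1) = (n : ℤ) ^ n * |discr K| := by
      apply mul_left_cancel₀ hnn.ne'
      linarith [h3]
    rw [← h4]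
    have : 0 ≤ (q : ℤ) ^ (n - 1) := by positivity
    nlinarith
  constructor
  · exact_mod_cast k1
  · exact_mod_cast k2

end PureTwoTorsion


namespace PureTwoTorsion
open NumberField

variable {K : Type} [Field K] [NumberField K]

lemma exists_poly {n q : ℕ} (hn : 1 ≤ n) (hK : Module.finrank ℚ K = n) (hq : q.Prime) {θ : 𝓞 K}
    (hθ : θ ^ n = q) (z : 𝓞 K) : ∃ p : Polynomial ℤ, (n : 𝓞 K) * z = Polynomial.aeval θ p := by
  obtain ⟨y, hy, -⟩ := exists_coords hn hK hq hθ z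
  refine ⟨∑ i, Polynomial.C (y i) * Polynomial.X ^ (i : ℕ), ?_⟩
  rw [hy]
  simp

lemma dvd_of_aeval_eq_zero {n q : ℕ} (hn : 1 ≤ n) (hq : q.Prime) {θ : 𝓞 K}
    (hθ : θ ^ n = q) (p : Polynomial ℤ) (hp : Polynomial.aeval θ p = 0) :
    (Polynomial.X ^ n - Polynomial.C (q : ℤ)) ∣ p := by
  have hθK : (θ : K) ^ n = q := by
    have := congrArg (algebraMap (𝓞 K) K) hθ
    simpa using this
  have hmon : (Polynomial.X ^ n - Polynomial.C (q : ℤ)).Monic :=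
    Polynomial.monic_X_pow_sub_C _ (by omega)
  rw [Polynomial.map_dvd_map (algebraMap ℤ ℚ) (RingHom.injective_int _) hmon |>.symm]
  have h1 : (Polynomial.X ^ n - Polynomial.C (q : ℤ)).map (algebraMap ℤ ℚ) = minpoly ℚ (θ : K) := by
    rw [minpoly_theta hn hq hθK]; simp
  rw [h1]
  apply minpoly.dvd
  rw [Polynomial.aeval_map_algebraMap]
  have := congrArg (algebraMap (𝓞 K) K) hp
  rw [map_zero, ← Polynomial.aeval_algebraMap_apply] at this
  exact this

lemma int_mem_ak {n q : ℕ} (hn : 1 ≤ n) (hK : Module.finrank ℚ K = n) (hq : q.Prime) {θ : 𝓞 K}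
    (hθ : θ ^ n = q) {k : ℕ} {t : ℤ} (hkn : Nat.Coprime k n) (hk : (k : ℤ) ∣ t ^ n - q) {m : ℤ}
    (hm : (m : 𝓞 K) ∈ Ideal.span {(k : 𝓞 K), θ - t}) : (k : ℤ) ∣ m := by
  obtain ⟨a, b, hab⟩ := Ideal.mem_span_pair.mp hm
  obtain ⟨A, hA⟩ := exists_poly hn hK hq hθ a
  obtain ⟨B, hB⟩ := exists_poly hn hK hq hθ b
  let p : Polynomial ℤ := A * Polynomial.C (k : ℤ) + B * (Polynomial.X - Polynomial.C t) -
    Polynomial.C ((n : ℤ) * m)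
  have hp : Polynomial.aeval θ p = 0 := by
    simp only [p, map_sub, map_add, map_mul, Polynomial.aeval_C, Polynomial.aeval_X, ← hA, ← hB]
    simp only [eq_intCast, Int.cast_natCast]
    rw [← hab]; ring
  obtain ⟨C, hC⟩ := dvd_of_aeval_eq_zero hn hq hθ p hp
  have h1 := congrArg (Polynomial.eval t) hC
  simp only [p, Polynomial.eval_sub, Polynomial.eval_add, Polynomial.eval_mul, Polynomial.eval_C,
    Polynomial.eval_X, Polynomial.eval_pow, sub_self, mul_zero, add_zero] at h1
  have h2 : (k : ℤ) ∣ n * m := by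
    have : (n : ℤ) * m = Polynomial.eval t A * k - (t ^ n - q) * Polynomial.eval t C := by linarith
    rw [this]
    exact dvd_sub (Dvd.intro_left _ rfl) (Dvd.dvd.mul_right hk _)
  exact (Nat.isCoprime_iff_coprime.mpr hkn).dvd_of_dvd_mul_left h2

lemma theta_sub_mem_sq {n q : ℕ} {θ : 𝓞 K}
    (hθ : θ ^ n = q) {k : ℕ} {t : ℤ} (hk : (k : ℤ) ^ 2 ∣ t ^ n - q)
    (hco : IsCoprime ((n : ℤ) * t ^ (n - 1)) ((k : ℤ) ^ 2)) :
    θ - t ∈ (Ideal.span {(k : 𝓞 K), θ - t}) ^ 2 := by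
  obtain ⟨u, v, huv⟩ := hco
  obtain ⟨s, hs⟩ := hk
  let g : Polynomial (𝓞 K) := ∑ i ∈ Finset.range n, Polynomial.X ^ i * Polynomial.C ((t : 𝓞 K) ^ (n - 1 - i))
  have hg1 : g.eval θ * (θ - t) = -((k : 𝓞 K) ^ 2 * s) := by
    have h1 : g.eval θ = ∑ i ∈ Finset.range n, θ ^ i * (t : 𝓞 K) ^ (n - 1 - i) := by
      simp [g, Polynomial.eval_finsetSum]
    rw [h1, (Commute.all θ (t : 𝓞 K)).geom_sum₂_mul, hθ]
    have := congrArg (Int.cast : ℤ → 𝓞 K) hs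
    push_cast at this
    rw [← this]; ring
  have hg2 : g.eval (t : 𝓞 K) = n * (t : 𝓞 K) ^ (n - 1) := by
    have : ∀ i ∈ Finset.range n, (t : 𝓞 K) ^ i * (t : 𝓞 K) ^ (n - 1 - i) = (t : 𝓞 K) ^ (n - 1) := by
      intro i hi
      rw [← pow_add]; congr 1
      have := Finset.mem_range.mp hi; omega
    simp only [g, Polynomial.eval_finsetSum, Polynomial.eval_mul, Polynomial.eval_pow,
      Polynomial.eval_X, Polynomial.eval_C]
    rw [Finset.sum_congr rfl this]; simp
  obtain ⟨h, hh⟩ := Polynomial.sub_dvd_eval_sub θ (t : 𝓞 K) g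
  have huv' : (u : 𝓞 K) * ((n : 𝓞 K) * (t : 𝓞 K) ^ (n - 1)) + v * (k : 𝓞 K) ^ 2 = 1 := by
    have := congrArg (Int.cast : ℤ → 𝓞 K) huv
    push_cast at this; exact this
  have hfin : θ - t = (-(u * s) + v * (θ - t)) * ((k : 𝓞 K) * k) + (-(u * h)) * ((θ - t) * (θ - t)) := by
    have e1 : g.eval θ = n * (t : 𝓞 K) ^ (n - 1) + (θ - t) * h := by rw [← hg2, ← hh]; ring
    rw [e1] at hg1
    linear_combination (-(θ - t)) * huv' + (u : 𝓞 K) * hg1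
  have hk1 : (k : 𝓞 K) ∈ Ideal.span {(k : 𝓞 K), θ - t} := Ideal.subset_span (by simp)
  have hk2 : θ - t ∈ Ideal.span {(k : 𝓞 K), θ - t} := Ideal.subset_span (by simp)
  rw [pow_two]
  refine (congrArg (fun r => r ∈ Ideal.span {(k : 𝓞 K), θ - t} * Ideal.span {(k : 𝓞 K), θ - t})
    hfin).mpr ?_
  exact Ideal.add_mem _ (Ideal.mul_mem_left _ _ (Ideal.mul_mem_mul hk1 hk1))
    (Ideal.mul_mem_left _ _ (Ideal.mul_mem_mul hk2 hk2))

lemma coords_unique {n q : ℕ} (hn : 1 ≤ n) (hK : Module.finrank ℚ K = n) (hq : q.Prime) {θ : 𝓞 K}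
    (hθ : θ ^ n = q) (y : ℕ → ℤ) (h : ∑ i ∈ Finset.range n, (y i : 𝓞 K) * θ ^ i = 0) :
    ∀ i < n, y i = 0 := by
  have hθK : (θ : K) ^ n = q := by
    have := congrArg (algebraMap (𝓞 K) K) hθ
    simpa using this
  obtain ⟨b, hb⟩ := exists_pb hn hK hq hθK
  have h1 : ∑ i : Fin n, ((y i : ℤ) : ℚ) • b i = 0 := by
    have := congrArg (algebraMap (𝓞 K) K) h
    rw [Finset.sum_range] at this
    simp only [map_sum, map_mul, map_intCast, map_pow, map_zero] at this
    rw [← this]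
    apply Finset.sum_congr rfl
    intro i _
    rw [hb, Algebra.smul_def]; simp
  have h2 := Fintype.linearIndependent_iff.mp b.linearIndependent _ h1
  intro i hi
  exact_mod_cast h2 ⟨i, hi⟩

lemma coords_rel {n q : ℕ} (hn : 1 ≤ n) (hK : Module.finrank ℚ K = n) (hq : q.Prime) {θ : 𝓞 K}
    (hθ : θ ^ n = q) {k : ℕ} {t : ℤ} {z z' : 𝓞 K} (hz : z * (θ - t) = (k : 𝓞 K) ^ 2 * z')
    (y : Fin n → ℤ) (hy : (n : 𝓞 K) * z = ∑ i, (y i : 𝓞 K) * θ ^ (i : ℕ)) (i : ℕ) (hi : i + 1 < n) :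
    (k : ℤ) ^ 2 ∣ y ⟨i, by omega⟩ - t * y ⟨i + 1, hi⟩ := by
  obtain ⟨x, hx, -⟩ := exists_coords hn hK hq hθ z'
  let Y : ℕ → ℤ := fun i => if h : i < n then y ⟨i, h⟩ else 0
  let X : ℕ → ℤ := fun i => if h : i < n then x ⟨i, h⟩ else 0
  have hY : (n : 𝓞 K) * z = ∑ i ∈ Finset.range n, (Y i : 𝓞 K) * θ ^ i := by
    rw [hy, Finset.sum_range]; simp [Y]
  have hX : (n : 𝓞 K) * z' = ∑ i ∈ Finset.range n, (X i : 𝓞 K) * θ ^ i := by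
    rw [hx, Finset.sum_range]; simp [X]
  let W : ℕ → ℤ := fun i => (if i = 0 then q * Y (n - 1) else Y (i - 1)) - t * Y i - k ^ 2 * X i
  have hW : ∑ i ∈ Finset.range n, (W i : 𝓞 K) * θ ^ i = 0 := by
    have e1 : (n : 𝓞 K) * z * θ = ∑ i ∈ Finset.range n,
        (((if i = 0 then q * Y (n - 1) else Y (i - 1) : ℤ)) : 𝓞 K) * θ ^ i := by
      obtain ⟨m, rfl⟩ : ∃ m, n = m + 1 := ⟨n - 1, by omega⟩
      rw [hY, Finset.sum_range_succ, Finset.sum_range_succ', add_mul, mul_assoc, ← pow_succ, hθ,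
        Finset.sum_mul]
      simp only [Nat.add_eq_zero_iff, one_ne_zero, and_false, if_false, if_true, add_tsub_cancel_right,
        pow_zero, mul_one]
      congr 1
      · apply Finset.sum_congr rfl
        intro i _
        rw [pow_succ]; ring
      · push_cast; ring
    have e2 : (n : 𝓞 K) * z * θ - t * (n * z) - k ^ 2 * (n * z') = 0 := by
      linear_combination (n : 𝓞 K) * hz
    rw [e1, hY, hX, Finset.mul_sum, Finset.mul_sum, ← Finset.sum_sub_distrib,
      ← Finset.sum_sub_distrib] at e2
    rw [← e2]
    apply Finset.sum_congr rfl
    intro i _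
    simp only [W]; push_cast; ring
  have h0 := coords_unique hn hK hq hθ W hW (i + 1) hi
  simp only [W, Nat.add_eq_zero_iff, one_ne_zero, and_false, if_false, add_tsub_cancel_right] at h0
  have hYi : Y i = y ⟨i, by omega⟩ := by simp only [Y]; rw [dif_pos]
  have hYi' : Y (i + 1) = y ⟨i + 1, hi⟩ := by simp only [Y]; rw [dif_pos]
  rw [hYi, hYi'] at h0
  exact ⟨X (i + 1), by linarith⟩

lemma exists_root (n q k : ℕ) (hk : 0 < k) (hqk : Nat.Coprime q k)
    (hco : Nat.Coprime (Nat.totient (k ^ 2)) n) :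
    ∃ t : ℤ, (k : ℤ) ^ 2 ∣ t ^ n - q := by
  have hq2 : Nat.Coprime q (k ^ 2) := Nat.Coprime.pow_right 2 hqk
  have : NeZero (k ^ 2) := ⟨by positivity⟩
  let u : (ZMod (k ^ 2))ˣ := ZMod.unitOfCoprime q hq2
  have hc : Nat.Coprime (Nat.card (ZMod (k ^ 2))ˣ) n := by
    rwa [Nat.card_eq_fintype_card, ZMod.card_units_eq_totient]
  let v := (powCoprime hc).symm u
  have hv : v ^ n = u := by
    have := (powCoprime hc).apply_symm_apply u
    rwa [powCoprime_apply] at this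
  refine ⟨((v : ZMod (k ^ 2)).val : ℤ), ?_⟩
  have h1 : (((((v : ZMod (k ^ 2)).val : ℤ)) ^ n - q : ℤ) : ZMod (k ^ 2)) = 0 := by
    push_cast
    rw [ZMod.natCast_zmod_val, ← Units.val_pow_eq_pow_val, hv]
    simp [u]
  have h2 := (ZMod.intCast_zmod_eq_zero_iff_dvd _ _).mp h1
  push_cast at h2
  exact h2

end PureTwoTorsion


namespace PureTwoTorsion
open NumberField NumberField.InfinitePlace MeasureTheory
open scoped nonZeroDivisors ENNReal NNReal

variable {K : Type} [Field K] [NumberField K]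

lemma exists_small_mem (J : Ideal (𝓞 K)) (hJ : J ≠ ⊥) (g : InfinitePlace K → ℝ)
    (hg : ∀ w, 0 ≤ g w)
    (h : 2 ^ (Module.finrank ℚ K) * (Ideal.absNorm J : ℝ) * Real.sqrt |(discr K : ℝ)| <
      ∏ w, g w ^ w.mult) : ∃ a ∈ J, a ≠ 0 ∧ ∀ w : InfinitePlace K, w (a : K) < g w := by
  classical
  let I : (FractionalIdeal (𝓞 K)⁰ K)ˣ := FractionalIdeal.mk0 K ⟨J, mem_nonZeroDivisors_of_ne_zero hJ⟩
  let f : InfinitePlace K → ℝ≥0 := fun w => ⟨g w, hg w⟩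
  have key : mixedEmbedding.minkowskiBound K I < volume (mixedEmbedding.convexBodyLT K f) := by
    rw [mixedEmbedding.convexBodyLT_volume, mixedEmbedding.minkowskiBound,
      mixedEmbedding.volume_fundamentalDomain_fractionalIdealLatticeBasis,
      mixedEmbedding.volume_fundamentalDomain_latticeBasis, mixedEmbedding.finrank]
    have hI : FractionalIdeal.absNorm I.1 = (Ideal.absNorm J : ℚ) := by
      simp [I, FractionalIdeal.coeIdeal_absNorm]
    rw [hI]
    have h1 : ((2 : ℝ≥0∞)⁻¹) ^ nrComplexPlaces K ≤ 1 := by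
      apply pow_le_one₀ zero_le
      simp
    have h2 : (1 : ℝ≥0∞) ≤ (mixedEmbedding.convexBodyLTFactor K : ℝ≥0∞) := by
      exact_mod_cast mixedEmbedding.one_le_convexBodyLTFactor K
    have h3 : (∏ w, ((f w : ℝ≥0) : ℝ≥0∞) ^ w.mult) = ENNReal.ofReal (∏ w, g w ^ w.mult) := by
      rw [ENNReal.ofReal_prod_of_nonneg (fun w _ => pow_nonneg (hg w) _)]
      apply Finset.prod_congr rfl
      intro w _
      rw [ENNReal.ofReal_pow (hg w)]
      congr 1
      simp only [f, ENNReal.ofReal, Real.toNNReal_of_nonneg (hg w)]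
      rfl
    have h4 : ((NNReal.sqrt ‖discr K‖₊ : ℝ≥0) : ℝ≥0∞) = ENNReal.ofReal (Real.sqrt |(discr K : ℝ)|) := by
      rw [ENNReal.ofReal]
      congr 1
      ext
      rw [Real.coe_toNNReal _ (Real.sqrt_nonneg _), Real.coe_sqrt, coe_nnnorm, Int.norm_eq_abs]
    calc _ ≤ ENNReal.ofReal ((Ideal.absNorm J : ℚ) : ℝ) * (1 * ENNReal.ofReal (Real.sqrt |(discr K : ℝ)|))
          * 2 ^ Module.finrank ℚ K := by
            rw [h4]; gcongr
      _ = ENNReal.ofReal (2 ^ (Module.finrank ℚ K) * (Ideal.absNorm J : ℝ) * Real.sqrt |(discr K : ℝ)|) := by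
            rw [ENNReal.ofReal_mul (by positivity), ENNReal.ofReal_mul (by positivity),
              ENNReal.ofReal_pow (by norm_num)]
            simp
            ring
      _ < ENNReal.ofReal (∏ w, g w ^ w.mult) := by
            rw [ENNReal.ofReal_lt_ofReal_iff]
            · exact h
            · exact lt_of_le_of_lt (by positivity) h
      _ = 1 * ∏ w, ((f w : ℝ≥0) : ℝ≥0∞) ^ w.mult := by rw [h3, one_mul]
      _ ≤ _ := by
            have e : ((∏ w, f w ^ w.mult : ℝ≥0) : ℝ≥0∞) = ∏ w, ((f w : ℝ≥0) : ℝ≥0∞) ^ w.mult := by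
              push_cast; rfl
            rw [e]
            gcongr
  obtain ⟨a, ha, ha0, haw⟩ := mixedEmbedding.exists_ne_zero_mem_ideal_lt K I key
  rw [FractionalIdeal.coe_mk0, FractionalIdeal.mem_coeIdeal] at ha
  obtain ⟨b, hb, rfl⟩ := ha
  exact ⟨b, hb, fun h => ha0 (by simp [h]), haw⟩

lemma abs_norm_int (a : 𝓞 K) : (Ideal.absNorm (Ideal.span {a}) : ℝ) = ∏ w : InfinitePlace K,
    w (a : K) ^ w.mult := by
  rw [InfinitePlace.prod_eq_abs_norm, Ideal.absNorm_span_singleton, ← Algebra.coe_norm_int]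
  rw [Nat.cast_natAbs]
  push_cast
  rfl

lemma exists_inv_ideal (M : Ideal (𝓞 K)) (hM : M ≠ ⊥) : ∃ (J : Ideal (𝓞 K)) (γ : 𝓞 K), J ≠ ⊥ ∧
    γ ≠ 0 ∧ J * M = Ideal.span {γ} := by
  obtain ⟨γ, hγ, hγ0⟩ := Submodule.exists_mem_ne_zero_of_ne_bot hM
  obtain ⟨J, hJ⟩ := Ideal.dvd_iff_le.mpr ((Ideal.span_singleton_le_iff_mem _).mpr hγ)
  refine ⟨J, γ, ?_, hγ0, by rw [hJ, mul_comm]⟩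
  rintro rfl
  rw [Ideal.mul_bot, Ideal.span_singleton_eq_bot] at hJ
  exact hγ0 hJ

lemma minkowski_step (I 𝔞 : Ideal (𝓞 K)) (hI : I ≠ ⊥) (h𝔞 : 𝔞 ≠ ⊥) (α : 𝓞 K)
    (hα : I ^ 2 = Ideal.span {α}) : ∃ (A : Ideal (𝓞 K)) (u v : 𝓞 K), A ≠ ⊥ ∧ u ≠ 0 ∧ v ≠ 0 ∧
      (∃ a γ : 𝓞 K, a ≠ 0 ∧ γ ≠ 0 ∧ Ideal.span {γ} * A = Ideal.span {a} * (I * 𝔞)) ∧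
      Ideal.span {v} * A ^ 2 = Ideal.span {u} * 𝔞 ^ 2 ∧
      (Ideal.absNorm A : ℝ) ≤ 2 ^ (Module.finrank ℚ K + 1) * Real.sqrt |(discr K : ℝ)| ∧
      ∀ w : InfinitePlace K, w ((u : K) / (v : K)) ≤
        (2 ^ (Module.finrank ℚ K + 1)) ^ 2 * |(discr K : ℝ)| := by
  set n := Module.finrank ℚ K with hn
  have hnpos : 0 < n := Module.finrank_pos
  have hα0 : α ≠ 0 := by
    rintro rfl
    rw [Set.singleton_zero, Ideal.span_zero] at hα
    exact hI (pow_eq_zero_iff (by norm_num) |>.mp hα)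
  have hIa : I * 𝔞 ≠ ⊥ := mul_ne_zero hI h𝔞
  -- an inverse ideal
  obtain ⟨J, γ, hJ0, hγ0, hγ'⟩ := exists_inv_ideal (I * 𝔞) hIa
  have hD : (1 : ℝ) ≤ |(discr K : ℝ)| := by
    have := Int.one_le_abs (discr_ne_zero K)
    exact_mod_cast this
  set B : ℝ := 2 ^ (n + 1) * Real.sqrt |(discr K : ℝ)| with hB
  have hsq1 : 1 ≤ Real.sqrt |(discr K : ℝ)| := Real.one_le_sqrt.mpr hD
  have hB1 : 1 ≤ B := by
    have : (1 : ℝ) ≤ 2 ^ (n + 1) := one_le_pow₀ (by norm_num)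
    nlinarith
  have hNa : 0 < (Ideal.absNorm 𝔞 : ℝ) := by
    have : Ideal.absNorm 𝔞 ≠ 0 := by rwa [Ne, Ideal.absNorm_eq_zero_iff]
    exact_mod_cast Nat.pos_of_ne_zero this
  have hNa1 : 1 ≤ (Ideal.absNorm 𝔞 : ℝ) := by
    have : 0 < Ideal.absNorm 𝔞 := by exact_mod_cast hNa
    exact_mod_cast this
  have hNJ : 0 < (Ideal.absNorm J : ℝ) := by
    have : Ideal.absNorm J ≠ 0 := by rwa [Ne, Ideal.absNorm_eq_zero_iff]
    exact_mod_cast Nat.pos_of_ne_zero this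
  have hNI : 0 < (Ideal.absNorm I : ℝ) := by
    have : Ideal.absNorm I ≠ 0 := by rwa [Ne, Ideal.absNorm_eq_zero_iff]
    exact_mod_cast Nat.pos_of_ne_zero this
  set κ : ℝ := (B / Ideal.absNorm 𝔞) ^ ((n : ℝ)⁻¹) with hκ
  have hκpos : 0 < κ := by positivity
  have hκn : κ ^ n = B / Ideal.absNorm 𝔞 :=
    Real.rpow_inv_natCast_pow (by positivity) (by omega)
  have hκB : κ ≤ B := by
    by_cases h1 : κ ≤ 1
    · linarith
    · push Not at h1
      calc κ ≤ κ ^ n := le_self_pow₀ h1.le (by omega)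
        _ = B / Ideal.absNorm 𝔞 := hκn
        _ ≤ B := div_le_self (by linarith) hNa1
  have hαw : ∀ w : InfinitePlace K, 0 < w (α : K) := fun w =>
    w.pos_iff.mpr (RingOfIntegers.coe_ne_zero_iff.mpr hα0)
  have hγw : ∀ w : InfinitePlace K, 0 < w (γ : K) := fun w =>
    w.pos_iff.mpr (RingOfIntegers.coe_ne_zero_iff.mpr hγ0)
  let g : InfinitePlace K → ℝ := fun w => κ * (w (γ : K) / Real.sqrt (w (α : K)))
  have hgprod : ∏ w, g w ^ w.mult = B * Ideal.absNorm J := by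
    have e1 : ∏ w, g w ^ w.mult = κ ^ n * ((∏ w : InfinitePlace K, w (γ : K) ^ w.mult) /
        (∏ w : InfinitePlace K, (Real.sqrt (w (α : K))) ^ w.mult)) := by
      simp only [g, mul_pow, div_pow, Finset.prod_mul_distrib, Finset.prod_div_distrib]
      rw [Finset.prod_pow_eq_pow_sum, InfinitePlace.sum_mult_eq]
    have e2 : (∏ w : InfinitePlace K, (Real.sqrt (w (α : K))) ^ w.mult) = Ideal.absNorm I := by
      have : (∏ w : InfinitePlace K, (Real.sqrt (w (α : K))) ^ w.mult) ^ 2 =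
          (Ideal.absNorm I : ℝ) ^ 2 := by
        rw [← Finset.prod_pow]
        have h5 := abs_norm_int α
        rw [← hα, map_pow] at h5
        push_cast at h5
        rw [h5]
        apply Finset.prod_congr rfl
        intro w _
        rw [← pow_mul, mul_comm, pow_mul, Real.sq_sqrt (hαw w).le]
      exact (pow_left_inj₀ (Finset.prod_nonneg fun w _ => by positivity) hNI.le (by norm_num)).mp this
    rw [e1, e2, ← abs_norm_int, ← hγ', map_mul, map_mul, hκn]
    push_cast
    field_simp
  have hgpos : ∀ w, 0 < g w := fun w => by
    have := hαw w; have := hγw w; positivity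
  obtain ⟨a, haJ, ha0, haw⟩ := exists_small_mem J hJ0 g (fun w => (hgpos w).le) (by
    rw [hgprod, hB, ← hn, pow_succ]
    have : 0 < 2 ^ n * (Ideal.absNorm J : ℝ) * Real.sqrt |(discr K : ℝ)| := by positivity
    nlinarith)
  obtain ⟨A, hA⟩ := Ideal.dvd_iff_le.mpr ((Ideal.span_singleton_le_iff_mem _).mpr haJ)
  have haspan : Ideal.span {a} ≠ (⊥ : Ideal (𝓞 K)) := by rwa [Ne, Ideal.span_singleton_eq_bot]
  have hA0 : A ≠ ⊥ := by
    rintro rfl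
    exact haspan (by rw [hA, Ideal.mul_bot])
  have hrel : Ideal.span {γ} * A = Ideal.span {a} * (I * 𝔞) := by
    rw [← hγ', hA]; ring
  refine ⟨A, a ^ 2 * α, γ ^ 2, hA0, mul_ne_zero (pow_ne_zero _ ha0) hα0, pow_ne_zero _ hγ0,
    ⟨a, γ, ha0, hγ0, hrel⟩, ?_, ?_, ?_⟩
  · rw [← Ideal.span_singleton_pow, ← Ideal.span_singleton_mul_span_singleton,
      ← Ideal.span_singleton_pow, ← mul_pow, hrel, ← hα]
    ring
  · have h1 : (Ideal.absNorm J : ℝ) * Ideal.absNorm A ≤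
        B * Ideal.absNorm J := by
      rw [← hgprod, ← Nat.cast_mul, ← map_mul, ← hA, abs_norm_int]
      apply Finset.prod_le_prod
      · intro w _; positivity
      · intro w _
        exact pow_le_pow_left₀ (apply_nonneg w _) (haw w).le _
    rw [mul_comm] at h1
    exact le_of_mul_le_mul_right h1 hNJ
  · intro w
    have h1 : w (((a ^ 2 * α : 𝓞 K) : K) / ((γ ^ 2 : 𝓞 K) : K)) =
        (w (a : K) * Real.sqrt (w (α : K)) / w (γ : K)) ^ 2 := by
      simp only [map_mul, map_pow, map_div₀]
      rw [div_pow, mul_pow, Real.sq_sqrt (hαw w).le]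
    rw [h1]
    have h2 : w (a : K) * Real.sqrt (w (α : K)) / w (γ : K) ≤ κ := by
      have := (haw w).le
      have hs : 0 < Real.sqrt (w (α : K)) := Real.sqrt_pos.mpr (hαw w)
      simp only [g] at this
      rw [div_le_iff₀ (hγw w)]
      calc w (a : K) * Real.sqrt (w (α : K)) ≤ κ * (w (γ : K) / Real.sqrt (w (α : K))) *
            Real.sqrt (w (α : K)) := by gcongr
        _ = κ * w (γ : K) := by field_simp
    calc _ ≤ κ ^ 2 := by gcongr
      _ ≤ B ^ 2 := by gcongr
      _ = _ := by rw [hB, mul_pow, Real.sq_sqrt (by positivity)]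

end PureTwoTorsion

namespace PureTwoTorsion
open Finset

lemma polylog (a b : ℝ) (ha : 0 ≤ a) (hb : 0 ≤ b) (N : ℕ) (ε : ℝ) (hε : 0 < ε) :
    ∃ C : ℝ, 1 ≤ C ∧ ∀ x : ℝ, 1 ≤ x → (a + b * Real.log x) ^ N ≤ C * x ^ ε := by
  set e : ℝ := ε / (N + 1) with he
  have he0 : 0 < e := by positivity
  refine ⟨(1 + a + b / e) ^ N, one_le_pow₀ (by have : 0 ≤ b / e := by positivity
                                               linarith), fun x hx => ?_⟩
  have h1 : Real.log x ≤ x ^ e / e := Real.log_le_rpow_div (by linarith) he0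
  have h0 : 0 ≤ Real.log x := Real.log_nonneg hx
  have h2 : 1 ≤ x ^ e := Real.one_le_rpow hx he0.le
  have h3 : a + b * Real.log x ≤ (1 + a + b / e) * x ^ e := by
    have : b * Real.log x ≤ b * (x ^ e / e) := by gcongr
    have e2 : (1 + a + b / e) * x ^ e = x ^ e + a * x ^ e + b * (x ^ e / e) := by ring
    nlinarith
  calc (a + b * Real.log x) ^ N ≤ ((1 + a + b / e) * x ^ e) ^ N := by gcongr
    _ = (1 + a + b / e) ^ N * (x ^ e) ^ N := mul_pow _ _ _
    _ ≤ (1 + a + b / e) ^ N * x ^ ε := by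
      gcongr
      rw [← Real.rpow_natCast, ← Real.rpow_mul (by linarith)]
      apply Real.rpow_le_rpow_of_exponent_le hx
      rw [he, div_mul_eq_mul_div, div_le_iff₀ (by positivity)]
      nlinarith

lemma cs_fibre {ι τ : Type*} [DecidableEq τ] (S : Finset ι) (T : Finset τ) (φ : ι → τ)
    (hφ : ∀ s ∈ S, φ s ∈ T) (M : ι → ℝ)
    (h : ∀ s ∈ S, (((S.filter (fun s' => φ s' = φ s)).card : ℕ) : ℝ) ≤ M s) :
    (S.card : ℝ) ^ 2 ≤ T.card * ∑ s ∈ S, M s := by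
  have e1 : (S.card : ℝ) = ∑ t ∈ T, ((S.filter (fun s' => φ s' = t)).card : ℝ) := by
    rw [Finset.card_eq_sum_card_fiberwise (f := φ) (t := T) hφ]; push_cast; rfl
  rw [e1]
  refine sq_sum_le_card_mul_sum_sq.trans ?_
  gcongr
  rw [← Finset.sum_fiberwise_of_maps_to hφ]
  apply Finset.sum_le_sum
  intro t ht
  rw [sq, ← nsmul_eq_mul, ← Finset.sum_const]
  apply Finset.sum_le_sum
  intro s hs
  have := h s (mem_of_mem_filter s hs)
  rw [(mem_filter.1 hs).2] at this
  exact this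

lemma family (n : ℕ) (hn : Odd n) (ε : ℝ) (hε : 0 < ε) (hε1 : ε ≤ 1) :
    ∃ (r0 : ℕ) (c Y0 : ℝ), 0 < c ∧ 1 ≤ Y0 ∧ ∀ Y : ℝ, Y0 ≤ Y → ∀ q : ℕ,
      ∃ (r : ℕ) (P : Finset ℕ), r ≤ r0 ∧ (∀ p ∈ P, p.Prime ∧ p ≠ q ∧ (p : ZMod n) = 2) ∧
        (∀ s ∈ P.powersetCard r, ((∏ p ∈ s, p : ℕ) : ℝ) ≤ Y ∧
            c * Y ^ (1 - ε) ≤ ((∏ p ∈ s, p : ℕ) : ℝ)) ∧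
        c * Y ^ (1 - ε) ≤ ((P.powersetCard r).card : ℝ) ∧
        ((P.powersetCard r).card : ℝ) ≤ Y := by
  have hn0 : n ≠ 0 := by rintro rfl; simp at hn
  have h2u : IsUnit (2 : ZMod n) := by
    have := (ZMod.isUnit_iff_coprime 2 n).2 (Nat.coprime_two_left.2 hn)
    simpa using this
  obtain ⟨δ, hδ, hδ1, W0, hW0, H⟩ := primes_AP n hn0 2 h2u (ε / 4) (by positivity)
  set d : ℝ := δ * (ε / 4) with hd
  have hd0 : 0 < d := by positivity
  set r0 : ℕ := ⌈1 / d⌉₊ with hr0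
  refine ⟨r0, 1 / (2 ^ (2 * r0 + 1) * r0.factorial),
    max (max 2 (W0 ^ (4 / ε))) ((2 * (2 * r0 + 2) ^ 2 : ℝ) ^ (1 / d)), by positivity, ?_, ?_⟩
  · exact le_trans (by norm_num) ((le_max_left (2 : ℝ) _).trans (le_max_left _ _))
  intro Y hY q
  have hY2 : 2 ≤ Y := ((le_max_left (2 : ℝ) _).trans (le_max_left _ _)).trans hY
  have hY1 : 1 ≤ Y := by linarith
  have hYp : 0 < Y := by linarith
  have hW : W0 ≤ Y ^ (ε / 4) := by
    have h1 : W0 ^ (4 / ε) ≤ Y := ((le_max_right (2 : ℝ) _).trans (le_max_left _ _)).trans hY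
    have h2 := Real.rpow_le_rpow (by positivity) h1 (by positivity : 0 ≤ ε / 4)
    rwa [← Real.rpow_mul (by linarith), div_mul_div_cancel₀ (by positivity), div_self (by norm_num), Real.rpow_one] at h2
  have hYbig : (2 * (2 * r0 + 2) ^ 2 : ℝ) ≤ Y ^ d := by
    have h1 : (2 * (2 * r0 + 2) ^ 2 : ℝ) ^ (1 / d) ≤ Y := (le_max_right _ _).trans hY
    have h2 := Real.rpow_le_rpow (by positivity) h1 hd0.le
    rwa [← Real.rpow_mul (by positivity), div_mul_cancel₀ _ hd0.ne', Real.rpow_one] at h2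
  obtain ⟨j, hj1, hj2, hj3⟩ := H _ hW
  rw [← Real.rpow_mul hYp.le, show ε / 4 * δ = d by rw [hd]; ring] at hj1
  obtain ⟨r, hr1, hr2⟩ := exists_nat_pow_near hY1 (show (1 : ℝ) < 2 ^ (j + 1) from one_lt_pow₀ (by norm_num) (by lia))
  have hr : r ≤ r0 := by
    have h1 : (Y ^ d) ^ r ≤ Y := le_trans (by gcongr) hr1
    rw [← Real.rpow_natCast, ← Real.rpow_mul hYp.le] at h1
    have h2 : d * r ≤ 1 := by
      by_contra! hlt
      have := Real.rpow_lt_rpow_of_exponent_lt (by linarith : 1 < Y) hlt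
      rw [Real.rpow_one] at this; linarith
    have h3 : (r : ℝ) ≤ 1 / d := by rw [le_div_iff₀ hd0]; linarith
    exact_mod_cast h3.trans (Nat.le_ceil _)
  set P0 := (Finset.Ico (2^j) (2^(j+1))).filter (fun k:ℕ => k.Prime ∧ (k:ZMod n)=2) with hP0
  have hPj : ∀ p ∈ P0.erase q, 2 ^ j ≤ p ∧ p ≤ 2 ^ (j+1) := by
    intro p hp
    have := (mem_filter.1 (mem_of_mem_erase hp)).1
    rw [mem_Ico] at this
    exact ⟨this.1, this.2.le⟩
  have hcardP : (P0.erase q).card ≤ 2 ^ j := by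
    refine (card_le_card (erase_subset _ _)).trans ((card_filter_le _ _).trans ?_)
    rw [Nat.card_Ico, pow_succ]; lia
  -- lower bound for `(2^j)^r`
  have hlow : Y ^ (1 - ε / 4) / 2 ^ (r0 + 1) ≤ ((2 : ℝ) ^ j) ^ r := by
    rw [div_le_iff₀ (by positivity)]
    have h1 : Y ^ (1 - ε / 4) * Y ^ (ε / 4) ≤ ((2 : ℝ) ^ j) ^ r * 2 ^ (r0 + 1) * Y ^ (ε / 4) := by
      rw [← Real.rpow_add hYp, sub_add_cancel, Real.rpow_one]
      calc Y ≤ ((2 : ℝ) ^ (j + 1)) ^ (r + 1) := hr2.le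
        _ = ((2 : ℝ) ^ j) ^ r * 2 ^ (r + 1) * 2 ^ j := by ring
        _ ≤ _ := by gcongr; norm_num
    exact le_of_mul_le_mul_right h1 (by positivity)
  have hfac : (1 : ℝ) ≤ r0.factorial := by exact_mod_cast Nat.one_le_iff_ne_zero.2 (Nat.factorial_ne_zero _)
  refine ⟨r, P0.erase q, hr, ?_, ?_, ?_, ?_⟩
  · intro p hp
    have h1 := (mem_filter.1 (mem_of_mem_erase hp)).2
    exact ⟨h1.1, ne_of_mem_erase hp, h1.2⟩
  · intro s hs
    rw [mem_powersetCard] at hs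
    constructor
    · refine le_trans ?_ hr1
      have := Finset.prod_le_pow_card s (fun p => p) (2 ^ (j+1)) (fun p hp => (hPj p (hs.1 hp)).2)
      rw [hs.2] at this
      exact_mod_cast this
    · have h2 : ((2 : ℝ) ^ j) ^ r ≤ ((∏ p ∈ s, p : ℕ) : ℝ) := by
        have := Finset.pow_card_le_prod s (fun p => p) (2 ^ j) (fun p hp => (hPj p (hs.1 hp)).1)
        rw [hs.2] at this
        exact_mod_cast this
      refine le_trans ?_ (hlow.trans h2)
      rw [div_mul_eq_mul_div, one_mul]
      gcongr ?_ / ?_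
      · apply Real.rpow_le_rpow_of_exponent_le hY1; linarith
      · calc (2 : ℝ) ^ (r0 + 1) ≤ 2 ^ (2 * r0 + 1) * 1 := by
              rw [mul_one]; gcongr; norm_num; lia
          _ ≤ _ := by gcongr
  · rw [card_powersetCard]
    have hPlow : ((2:ℝ)^j)^(1-ε/4) - 1 ≤ ((P0.erase q).card : ℝ) := by
      have := pred_card_le_card_erase (s := P0) (a := q)
      have h2 : P0.card ≤ (P0.erase q).card + 1 := by lia
      have h3 : (P0.card : ℝ) ≤ (P0.erase q).card + 1 := by exact_mod_cast h2
      linarith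
    have hbig : (2 * r0 + 2 : ℝ) ≤ ((2:ℝ)^j)^(1-ε/4) := by
      have h1 : (2 * r0 + 2 : ℝ) ^ 2 ≤ 2 ^ j := by
        have : (2 * (2 * r0 + 2) ^ 2 : ℝ) ≤ 2 ^ (j + 1) := hYbig.trans hj1
        rw [pow_succ (2:ℝ) j] at this; linarith
      have h2 := Real.rpow_le_rpow (by positivity) h1 (by norm_num : (0:ℝ) ≤ 1 / 2)
      rw [← Real.sqrt_eq_rpow, Real.sqrt_sq (by positivity)] at h2
      refine h2.trans (Real.rpow_le_rpow_of_exponent_le (one_le_pow₀ (by norm_num)) (by linarith))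
    set B : ℝ := ((2:ℝ)^j)^(1-ε/4) with hB
    have hrr : (r : ℝ) ≤ r0 := by exact_mod_cast hr
    have h1 : B / 2 ≤ (((P0.erase q).card + 1 - r : ℕ) : ℝ) := by
      have : ((P0.erase q).card : ℝ) + 1 - r ≤ (((P0.erase q).card + 1 - r : ℕ) : ℝ) := by
        have h := Nat.le_sub_of_add_le (le_refl ((P0.erase q).card + 1 - r + r))
        have h' : (P0.erase q).card + 1 ≤ ((P0.erase q).card + 1 - r) + r := by lia
        have h'' : ((P0.erase q).card : ℝ) + 1 ≤ (((P0.erase q).card + 1 - r : ℕ) : ℝ) + r := by exact_mod_cast h'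
        linarith
      linarith
    refine le_trans ?_ (Nat.pow_le_choose (α := ℝ) r (P0.erase q).card)
    have hB0 : 0 ≤ B := by linarith [hbig, (Nat.cast_nonneg r0 : (0:ℝ) ≤ r0)]
    have h4 : (Y ^ (1 - ε) / 2 ^ (r0 + 1)) ≤ B ^ r := by
      have e : B ^ r = (((2 : ℝ) ^ j) ^ r) ^ (1 - ε / 4) := by
        rw [hB, ← Real.rpow_natCast, ← Real.rpow_natCast (((2:ℝ)^j)), ← Real.rpow_mul (by positivity), ← Real.rpow_mul (by positivity), mul_comm]
      rw [e]
      refine le_trans ?_ (Real.rpow_le_rpow (by positivity) hlow (by linarith))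
      rw [Real.div_rpow (by positivity) (by positivity), ← Real.rpow_mul hYp.le]
      gcongr ?_ / ?_
      · apply Real.rpow_le_rpow_of_exponent_le hY1; nlinarith
      · conv_rhs => rw [← Real.rpow_one ((2:ℝ)^(r0+1))]
        apply Real.rpow_le_rpow_of_exponent_le (one_le_pow₀ (by norm_num)); linarith
    calc 1 / (2 ^ (2 * r0 + 1) * (r0.factorial : ℝ)) * Y ^ (1 - ε)
        = (Y ^ (1 - ε) / 2 ^ (r0 + 1)) / 2 ^ r0 / r0.factorial := by
          field_simp; ring
      _ ≤ B ^ r / 2 ^ r / r.factorial := by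
          gcongr
          norm_num
      _ = (B / 2) ^ r / r.factorial := by rw [div_pow]
      _ ≤ _ := by gcongr
  · rw [card_powersetCard]
    refine le_trans ?_ hr1
    have : (P0.erase q).card.choose r ≤ (2 ^ (j+1)) ^ r := by
      refine (Nat.choose_le_pow _ _).trans ?_
      gcongr
      exact hcardP.trans (Nat.pow_le_pow_right (by norm_num) (by lia))
    exact_mod_cast this

end PureTwoTorsion

namespace PureTwoTorsion
open NumberField Finset

variable {K : Type} [Field K] [NumberField K]

lemma collision (𝔞 𝔠 𝔞' A : Ideal (𝓞 K)) (κ u v u' v' : 𝓞 K) (h𝔠 : 𝔞 * 𝔠 = Ideal.span {κ})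
    (hA : A ≠ ⊥) (hu : u ≠ 0) (hv : v ≠ 0) (hu' : u' ≠ 0)
    (h : Ideal.span {v} * A ^ 2 = Ideal.span {u} * 𝔞 ^ 2)
    (h' : Ideal.span {v'} * A ^ 2 = Ideal.span {u'} * 𝔞' ^ 2) :
    ∃ z : 𝓞 K, κ ^ 2 * u * v' = v * u' * z ∧ Ideal.span {z} = 𝔠 ^ 2 * 𝔞' ^ 2 := by
  have hA2 : A ^ 2 ≠ 0 := pow_ne_zero _ hA
  have key : Ideal.span {κ ^ 2 * u * v'} = Ideal.span {v * u'} * (𝔠 ^ 2 * 𝔞' ^ 2) := by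
    apply mul_right_cancel₀ hA2
    rw [← Ideal.span_singleton_mul_span_singleton, ← Ideal.span_singleton_mul_span_singleton,
      ← Ideal.span_singleton_mul_span_singleton, ← Ideal.span_singleton_pow, ← h𝔠]
    calc (𝔞 * 𝔠) ^ 2 * Ideal.span {u} * Ideal.span {v'} * A ^ 2
        = 𝔠 ^ 2 * (Ideal.span {u} * 𝔞 ^ 2) * (Ideal.span {v'} * A ^ 2) := by ring
      _ = 𝔠 ^ 2 * (Ideal.span {v} * A ^ 2) * (Ideal.span {u'} * 𝔞' ^ 2) := by rw [← h, h']
      _ = _ := by ring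
  have hm : Ideal.span {κ ^ 2 * u * v'} ≤ Ideal.span {v * u'} := by
    rw [key]; exact Ideal.mul_le_left (I := Ideal.span {v * u'}) (J := 𝔠 ^ 2 * 𝔞' ^ 2)
  obtain ⟨z, hz⟩ := Ideal.span_singleton_le_span_singleton.1 hm
  refine ⟨z, hz, ?_⟩
  have hne : Ideal.span {v * u'} ≠ (0 : Ideal (𝓞 K)) := by
    simp [hv, hu']
  apply mul_left_cancel₀ hne
  rw [← key, hz, Ideal.span_singleton_mul_span_singleton]

lemma same_class (I I' : nonZeroDivisors (Ideal (𝓞 K))) (𝔞 A : Ideal (𝓞 K)) (h𝔞 : 𝔞 ≠ ⊥)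
    (h : ∃ a γ : 𝓞 K, a ≠ 0 ∧ γ ≠ 0 ∧ Ideal.span {γ} * A = Ideal.span {a} * ((I : Ideal (𝓞 K)) * 𝔞))
    (h' : ∃ a γ : 𝓞 K, a ≠ 0 ∧ γ ≠ 0 ∧ Ideal.span {γ} * A = Ideal.span {a} * ((I' : Ideal (𝓞 K)) * 𝔞)) :
    ClassGroup.mk0 I = ClassGroup.mk0 I' := by
  obtain ⟨a, γ, ha, hγ, e⟩ := h
  obtain ⟨a', γ', ha', hγ', e'⟩ := h'
  rw [ClassGroup.mk0_eq_mk0_iff]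
  refine ⟨γ' * a, γ * a', mul_ne_zero hγ' ha, mul_ne_zero hγ ha', ?_⟩
  have h𝔞0 : 𝔞 ≠ 0 := h𝔞
  apply mul_right_cancel₀ h𝔞0
  rw [← Ideal.span_singleton_mul_span_singleton, ← Ideal.span_singleton_mul_span_singleton]
  calc Ideal.span {γ'} * Ideal.span {a} * (I : Ideal (𝓞 K)) * 𝔞
      = Ideal.span {γ'} * (Ideal.span {a} * ((I : Ideal (𝓞 K)) * 𝔞)) := by ring
    _ = Ideal.span {γ} * (Ideal.span {γ'} * A) := by rw [← e]; ring
    _ = _ := by rw [e']; ring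

lemma one_le_abs_discr : (1 : ℝ) ≤ |(discr K : ℝ)| := by
  have := Int.one_le_abs (discr_ne_zero K)
  exact_mod_cast this

/-- A bound for the logarithmic embedding of `u / v`. -/
lemma log_place_bound {n k : ℕ} (hn : 1 ≤ n) (hK : Module.finrank ℚ K = n) (hk : 0 < k) (U : ℝ) (hU : 1 ≤ U)
    (𝔞 A : Ideal (𝓞 K)) (u v : 𝓞 K) (hk𝔞 : (k : 𝓞 K) ∈ 𝔞) (hA : A ≠ ⊥) (hu : u ≠ 0) (hv : v ≠ 0)
    (h : Ideal.span {v} * A ^ 2 = Ideal.span {u} * 𝔞 ^ 2)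
    (hw : ∀ w : InfinitePlace K, w ((u : K) / (v : K)) ≤ U) (w : InfinitePlace K) :
    |Real.log (w ((u : K) / (v : K)))| ≤ n * Real.log U + 2 * n * Real.log k := by
  have hu0 : (u : K) ≠ 0 := by simpa using hu
  have hv0 : (v : K) ≠ 0 := by simpa using hv
  have hx0 : (u : K) / v ≠ 0 := div_ne_zero hu0 hv0
  have hpos : ∀ w : InfinitePlace K, 0 < w ((u : K) / (v : K)) := fun w => w.pos_iff.2 hx0
  have hℓ : 0 ≤ Real.log U := Real.log_nonneg hU
  have hlk : 0 ≤ Real.log k := Real.log_natCast_nonneg k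
  have hn' : (1 : ℝ) ≤ n := by exact_mod_cast hn
  have hle : ∀ w : InfinitePlace K, Real.log (w ((u : K) / (v : K))) ≤ Real.log U :=
    fun w => Real.log_le_log (hpos w) (hw w)
  have hprod : 1 ≤ (∏ w : InfinitePlace K, w ((u : K) / (v : K)) ^ w.mult) * ((k : ℝ) ^ n) ^ 2 := by
    have e1 : (Ideal.absNorm (Ideal.span {v}) : ℝ) * (Ideal.absNorm A : ℝ) ^ 2 =
        (Ideal.absNorm (Ideal.span {u}) : ℝ) * (Ideal.absNorm 𝔞 : ℝ) ^ 2 := by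
      have := congrArg Ideal.absNorm h
      rw [map_mul, map_mul, map_pow, map_pow] at this
      exact_mod_cast this
    have e2 : (∏ w : InfinitePlace K, w ((u : K) / (v : K)) ^ w.mult) =
        (Ideal.absNorm (Ideal.span {u}) : ℝ) / (Ideal.absNorm (Ideal.span {v}) : ℝ) := by
      rw [abs_norm_int, abs_norm_int, ← Finset.prod_div_distrib]
      apply Finset.prod_congr rfl
      intro w _
      rw [map_div₀, div_pow]
    have e3 : (Ideal.absNorm 𝔞 : ℝ) ≤ (k : ℝ) ^ n := by
      have h1 : Ideal.absNorm 𝔞 ∣ Ideal.absNorm (Ideal.span {(k : 𝓞 K)}) :=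
        Ideal.absNorm_dvd_absNorm_of_le ((Ideal.span_singleton_le_iff_mem _).2 hk𝔞)
      rw [Ideal.absNorm_span_singleton] at h1
      have h2 : Algebra.norm ℤ (k : 𝓞 K) = (k : ℤ) ^ n := by
        have := Algebra.norm_algebraMap (S := 𝓞 K) (k : ℤ)
        rw [RingOfIntegers.rank, hK] at this
        simpa using this
      rw [h2, Int.natAbs_pow, Int.natAbs_natCast] at h1
      exact_mod_cast Nat.le_of_dvd (by positivity) h1
    have e4 : (1 : ℝ) ≤ Ideal.absNorm A := by
      have : Ideal.absNorm A ≠ 0 := by rwa [Ne, Ideal.absNorm_eq_zero_iff]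
      exact_mod_cast Nat.one_le_iff_ne_zero.2 this
    have e5 : (0 : ℝ) < Ideal.absNorm (Ideal.span {v}) := by
      have : Ideal.absNorm (Ideal.span {v}) ≠ 0 := by
        rw [Ne, Ideal.absNorm_eq_zero_iff]; simpa using hv
      exact_mod_cast Nat.pos_of_ne_zero this
    rw [e2, div_mul_eq_mul_div, le_div_iff₀ e5, one_mul]
    calc (Ideal.absNorm (Ideal.span {v}) : ℝ) ≤ (Ideal.absNorm (Ideal.span {v}) : ℝ) * (Ideal.absNorm A : ℝ) ^ 2 :=
          le_mul_of_one_le_right e5.le (one_le_pow₀ e4)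
      _ = _ := e1
      _ ≤ _ := by gcongr
  have hP : 0 < ∏ w : InfinitePlace K, w ((u : K) / (v : K)) ^ w.mult :=
    Finset.prod_pos fun w _ => pow_pos (hpos w) _
  have hkR : (0 : ℝ) < k := by exact_mod_cast hk
  have hlog := Real.log_nonneg hprod
  rw [Real.log_mul hP.ne' (by positivity), Real.log_prod (fun w _ => (pow_pos (hpos w) _).ne'),
    Real.log_pow, Real.log_pow] at hlog
  simp only [Real.log_pow] at hlog
  have hsum : ∑ w : InfinitePlace K, (w.mult : ℝ) * (Real.log U - Real.log (w ((u : K) / (v : K)))) ≤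
      n * Real.log U + 2 * n * Real.log k := by
    have : ∑ w : InfinitePlace K, (w.mult : ℝ) = n := by
      rw [← hK, ← InfinitePlace.sum_mult_eq]; push_cast; rfl
    simp only [mul_sub, Finset.sum_sub_distrib, ← Finset.sum_mul]
    rw [this]
    push_cast at hlog
    linarith
  have hone : Real.log U - Real.log (w ((u : K) / (v : K))) ≤ n * Real.log U + 2 * n * Real.log k := by
    refine le_trans ?_ ((Finset.single_le_sum (f := fun w : InfinitePlace K =>
      (w.mult : ℝ) * (Real.log U - Real.log (w ((u : K) / (v : K))))) (fun w _ => ?_) (Finset.mem_univ w)).trans hsum)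
    · have : (1 : ℝ) ≤ w.mult := by exact_mod_cast InfinitePlace.mult_pos
      exact le_mul_of_one_le_left (by linarith [hle w]) this
    · exact mul_nonneg (by positivity) (by linarith [hle w])
  rw [abs_le]
  constructor
  · linarith
  · refine (hle w).trans ?_
    nlinarith [mul_nonneg (by linarith : (0:ℝ) ≤ 2 * n) hlk]

/-- The finite set of integer vectors with weighted size conditions. -/
noncomputable def ybox (n q : ℕ) (B : ℝ) : Finset (Fin n → ℤ) :=
  Fintype.piFinset (fun i : Fin n =>
    Finset.Icc (-⌊(n : ℝ) * (B * (q : ℝ) ^ (-((i : ℕ) : ℝ) / n))⌋) ⌊(n : ℝ) * (B * (q : ℝ) ^ (-((i : ℕ) : ℝ) / n))⌋)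

open Classical in
/-- Vectors in the box subject to congruences. -/
noncomputable def yset (n q : ℕ) (B : ℝ) (k : ℕ) (t : ℤ) : Finset (Fin n → ℤ) :=
  (ybox n q B).filter (fun y => ∀ (i : ℕ) (hi : i + 1 < n),
    (k : ℤ) ^ 2 ∣ y ⟨i, by lia⟩ - t * y ⟨i + 1, hi⟩)

lemma mem_ybox {n q : ℕ} {B : ℝ} {y : Fin n → ℤ} :
    y ∈ ybox n q B ↔ ∀ i, |(y i : ℝ)| ≤ n * (B * (q : ℝ) ^ (-((i : ℕ) : ℝ) / n)) := by
  unfold ybox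
  rw [Fintype.mem_piFinset]
  refine forall_congr' fun i => ?_
  rw [Finset.mem_Icc, ← abs_le, Int.le_floor]
  push_cast
  rfl

lemma card_places_le {n : ℕ} (hK : Module.finrank ℚ K = n) : Fintype.card (InfinitePlace K) ≤ n := by
  rw [InfinitePlace.card_eq_nrRealPlaces_add_nrComplexPlaces, ← hK, ← InfinitePlace.card_add_two_mul_card_eq_rank]
  lia

lemma exists_two_torsion_rep (c : ClassGroup (𝓞 K)) (hc : c ^ 2 = 1) :
    ∃ (I : nonZeroDivisors (Ideal (𝓞 K))) (α : 𝓞 K), ClassGroup.mk0 I = c ∧ (I : Ideal (𝓞 K)) ^ 2 = Ideal.span {α} ∧ α ≠ 0 := by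
  obtain ⟨I, rfl⟩ := ClassGroup.mk0_surjective c
  have h : ClassGroup.mk0 (I ^ 2) = 1 := by rw [map_pow]; exact hc
  have h2 : Submodule.IsPrincipal ((I ^ 2 : nonZeroDivisors (Ideal (𝓞 K))) : Ideal (𝓞 K)) :=
    (ClassGroup.mk0_eq_one_iff (I ^ 2).2).1 h
  obtain ⟨α, hα⟩ := h2.principal
  have hα' : (I : Ideal (𝓞 K)) ^ 2 = Ideal.span {α} := by
    rw [← SubmonoidClass.coe_pow, hα]
  refine ⟨I, α, rfl, hα', ?_⟩
  rintro rfl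
  have : (I : Ideal (𝓞 K)) ^ 2 ≠ 0 := pow_ne_zero _ (nonZeroDivisors.coe_ne_zero I)
  apply this
  rw [hα']; simp

end PureTwoTorsion

namespace PureTwoTorsion
open NumberField Finset

variable {K : Type} [Field K] [NumberField K]

/-- The finite set of nonzero ideals of norm at most `X`. -/
noncomputable def idealsLE (K : Type) [Field K] [NumberField K] (X : ℕ) : Finset (Ideal (𝓞 K)) :=
  (Set.Finite.subset (Ideal.finite_setOfPred_absNorm_le (S := 𝓞 K) X)
    (t := {I | I ≠ ⊥ ∧ Ideal.absNorm I ≤ X}) (fun _ h => h.2)).toFinset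

lemma mem_idealsLE {X : ℕ} {A : Ideal (𝓞 K)} : A ∈ idealsLE K X ↔ A ≠ ⊥ ∧ Ideal.absNorm A ≤ X := by
  simp [idealsLE]

lemma card_idealsLE {n : ℕ} (hK : Module.finrank ℚ K = n) (X : ℝ) (hX : 1 ≤ X) :
    ((idealsLE K ⌊X⌋₊).card : ℝ) ≤ X * (1 + Real.log X) ^ n := by
  have h1 : 1 ≤ ⌊X⌋₊ := (Nat.one_le_floor_iff X).2 hX
  have h1' : (1 : ℝ) ≤ ⌊X⌋₊ := by exact_mod_cast h1
  have h2 : (⌊X⌋₊ : ℝ) ≤ X := Nat.floor_le (by linarith)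
  have := ideal_count K ⌊X⌋₊ h1 (idealsLE K ⌊X⌋₊) (fun A hA => mem_idealsLE.1 hA)
  rw [hK] at this
  refine this.trans ?_
  have h3 : 0 ≤ Real.log (⌊X⌋₊ : ℝ) := Real.log_nonneg h1'
  have h4 : Real.log (⌊X⌋₊ : ℝ) ≤ Real.log X := Real.log_le_log (by linarith) h2
  gcongr

/-- Trivial bound for the class number. -/
lemma card_class_le {n : ℕ} (hK : Module.finrank ℚ K = n) (X : ℝ)
    (hX : X = 2 ^ (n + 1) * Real.sqrt |(discr K : ℝ)|) :
    (Nat.card (ClassGroup (𝓞 K)) : ℝ) ≤ X * (1 + Real.log X) ^ n := by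
  classical
  have hX1 : 1 ≤ X := by
    rw [hX]
    have h1 : (1 : ℝ) ≤ Real.sqrt |(discr K : ℝ)| := Real.one_le_sqrt.2 one_le_abs_discr
    have h2 : (1 : ℝ) ≤ 2 ^ (n + 1) := one_le_pow₀ (by norm_num)
    nlinarith
  have key : ∀ c : ClassGroup (𝓞 K), ∃ A ∈ idealsLE K ⌊X⌋₊,
      ∃ I : nonZeroDivisors (Ideal (𝓞 K)), ClassGroup.mk0 I = c ∧ (I : Ideal (𝓞 K)) = A := by
    intro c
    obtain ⟨J, hJ⟩ := ClassGroup.mk0_surjective c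
    obtain ⟨A, u, v, hA, hu, hv, ⟨a, γ, ha, hγ, e⟩, -, hN, -⟩ :=
      minkowski_step (⊤ : Ideal (𝓞 K)) (J : Ideal (𝓞 K)) (by simp) (nonZeroDivisors.coe_ne_zero J) 1 (by simp)
    refine ⟨A, mem_idealsLE.2 ⟨hA, ?_⟩, ⟨A, mem_nonZeroDivisors_iff_ne_zero.2 hA⟩, ?_, rfl⟩
    · apply Nat.le_floor
      rw [hX, ← hK]; exact hN
    · rw [← hJ, ClassGroup.mk0_eq_mk0_iff]
      refine ⟨γ, a, hγ, ha, ?_⟩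
      rw [Ideal.top_mul] at e
      exact e
  refine le_trans ?_ (card_idealsLE hK X hX1)
  rw [Nat.card_eq_fintype_card, ← Finset.card_univ]
  have := Finset.card_le_card_of_forall_subsingleton (s := (univ : Finset (ClassGroup (𝓞 K)))) (t := idealsLE K ⌊X⌋₊)
    (fun c A => ∃ I : nonZeroDivisors (Ideal (𝓞 K)), ClassGroup.mk0 I = c ∧ (I : Ideal (𝓞 K)) = A)
    (fun c _ => key c) ?_
  · exact_mod_cast this
  · intro A hA c hc c' hc'
    obtain ⟨I, h1, h2⟩ := hc.2
    obtain ⟨I', h1', h2'⟩ := hc'.2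
    rw [← h1, ← h1']
    congr 1
    exact Subtype.ext (h2.trans h2'.symm)

lemma exists_data {n : ℕ} {θ : 𝓞 K} (hK : Module.finrank ℚ K = n) (I : Ideal (𝓞 K)) (hI : I ≠ ⊥) (α : 𝓞 K)
    (hα : I ^ 2 = Ideal.span {α}) (k : ℕ) (hk : 0 < k) (t : ℤ) :
    ∃ (A : Ideal (𝓞 K)) (u v : 𝓞 K), A ∈ idealsLE K ⌊2 ^ (n + 1) * Real.sqrt |(discr K : ℝ)|⌋₊ ∧ u ≠ 0 ∧ v ≠ 0 ∧
      (∃ a γ : 𝓞 K, a ≠ 0 ∧ γ ≠ 0 ∧ Ideal.span {γ} * A = Ideal.span {a} * (I * Ideal.span {(k : 𝓞 K), θ - t})) ∧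
      Ideal.span {v} * A ^ 2 = Ideal.span {u} * (Ideal.span {(k : 𝓞 K), θ - t}) ^ 2 ∧
      ∀ w : InfinitePlace K, w ((u : K) / (v : K)) ≤ (2 ^ (n + 1)) ^ 2 * |(discr K : ℝ)| := by
  have h𝔞 : Ideal.span {(k : 𝓞 K), θ - t} ≠ ⊥ := by
    intro h
    have : (k : 𝓞 K) ∈ Ideal.span {(k : 𝓞 K), θ - t} := Ideal.subset_span (by simp)
    rw [h, Ideal.mem_bot] at this
    exact hk.ne' (by exact_mod_cast this)
  obtain ⟨A, u, v, hA, hu, hv, h1, h2, hN, h3⟩ := minkowski_step I _ hI h𝔞 α hα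
  rw [hK] at hN h3
  exact ⟨A, u, v, mem_idealsLE.2 ⟨hA, Nat.le_floor hN⟩, hu, hv, h1, h2, h3⟩

/-- The relation attached to a collision: existence of the vector `y`. -/
lemma collision_y {n q : ℕ} (hn : 1 ≤ n) (hK : Module.finrank ℚ K = n) (hq : q.Prime) {θ : 𝓞 K}
    (hθ : θ ^ n = q) (k k' : ℕ) (t t' : ℤ) (hk : 0 < k) (Y : ℝ) (hkY : (k : ℝ) ≤ Y)
    (hdvd : (k : ℤ) ^ 2 ∣ t ^ n - q)
    (hco : IsCoprime ((n : ℤ) * t ^ (n - 1)) ((k : ℤ) ^ 2))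
    (𝔠 A : Ideal (𝓞 K)) (u v u' v' : 𝓞 K) (hA : A ≠ ⊥)
    (h𝔠 : Ideal.span {(k : 𝓞 K), θ - t} * 𝔠 = Ideal.span {(k : 𝓞 K)})
    (hu : u ≠ 0) (hv : v ≠ 0) (hu' : u' ≠ 0) (hv' : v' ≠ 0)
    (h : Ideal.span {v} * A ^ 2 = Ideal.span {u} * (Ideal.span {(k : 𝓞 K), θ - t}) ^ 2)
    (h' : Ideal.span {v'} * A ^ 2 = Ideal.span {u'} * (Ideal.span {(k' : 𝓞 K), θ - t'}) ^ 2)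
    (hcell : ∀ w : InfinitePlace K, ⌊Real.log (w ((u : K) / (v : K)))⌋ = ⌊Real.log (w ((u' : K) / (v' : K)))⌋) :
    ∃ y ∈ yset n q (3 * Y ^ 2) k t, ∃ z : 𝓞 K, (n : 𝓞 K) * z = ∑ i, (y i : 𝓞 K) * θ ^ (i : ℕ) ∧
      Ideal.span {z} = 𝔠 ^ 2 * (Ideal.span {(k' : 𝓞 K), θ - t'}) ^ 2 := by
  obtain ⟨z, hz1, hz2⟩ := collision _ 𝔠 _ A (k : 𝓞 K) u v u' v' h𝔠 hA hu hv hu' h h'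
  have hu0 : (u : K) ≠ 0 := by simpa using hu
  have hv0 : (v : K) ≠ 0 := by simpa using hv
  have hu0' : (u' : K) ≠ 0 := by simpa using hu'
  have hv0' : (v' : K) ≠ 0 := by simpa using hv'
  have hzK : (z : K) = (k : K) ^ 2 * ((u : K) / v) / ((u' : K) / v') := by
    have := congrArg (algebraMap (𝓞 K) K) hz1
    simp only [map_mul, map_pow, map_natCast] at this
    field_simp
    linear_combination -this
  have hw : ∀ w : InfinitePlace K, w (z : K) ≤ 3 * Y ^ 2 := by
    intro w
    have hx : 0 < w ((u : K) / v) := w.pos_iff.2 (div_ne_zero hu0 hv0)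
    have hx' : 0 < w ((u' : K) / v') := w.pos_iff.2 (div_ne_zero hu0' hv0')
    rw [hzK, map_div₀ w, map_mul w, map_pow w, div_le_iff₀ hx']
    have h3 : w ((u : K) / v) ≤ 3 * w ((u' : K) / v') := by
      have h1 := Int.abs_sub_lt_one_of_floor_eq_floor (hcell w)
      have h2 := (abs_lt.1 h1).2
      have h4 : Real.log (w ((u : K) / v)) ≤ Real.log (Real.exp 1 * w ((u' : K) / v')) := by
        rw [Real.log_mul (Real.exp_pos _).ne' hx'.ne', Real.log_exp]; linarith
      have h5 := (Real.log_le_log_iff hx (by positivity)).1 h4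
      refine h5.trans ?_
      gcongr
      linarith [Real.exp_one_lt_d9]
    have hwk : w (k : K) = k := by
      rw [← InfinitePlace.norm_embedding_eq, map_natCast, Complex.norm_natCast]
    rw [hwk]
    calc (k : ℝ) ^ 2 * w ((u : K) / v) ≤ Y ^ 2 * (3 * w ((u' : K) / v')) := by gcongr
      _ = _ := by ring
  obtain ⟨y, hy1, hy2⟩ := coords_bound hn hK hq hθ z _ hw
  have hmem : z * (θ - t) ∈ Ideal.span {(k : 𝓞 K) ^ 2} := by
    have e1 : z ∈ 𝔠 ^ 2 := by
      have : Ideal.span {z} ≤ 𝔠 ^ 2 := by rw [hz2]; exact Ideal.mul_le_left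
      exact (Ideal.span_singleton_le_iff_mem _).1 this
    have e2 := theta_sub_mem_sq hθ hdvd hco
    have e3 := Ideal.mul_mem_mul e1 e2
    have e4 : 𝔠 ^ 2 * Ideal.span {(k : 𝓞 K), θ - t} ^ 2 = Ideal.span {(k : 𝓞 K) ^ 2} := by
      rw [← Ideal.span_singleton_pow, ← h𝔠, mul_pow, mul_comm]
    rwa [e4] at e3
  obtain ⟨z', hz'⟩ := Ideal.mem_span_singleton.1 hmem
  refine ⟨y, ?_, z, hy1, hz2⟩
  classical
  unfold yset
  refine Finset.mem_filter.2 ?_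
  exact ⟨mem_ybox.2 hy2, fun i hi => coords_rel hn hK hq hθ hz' y hy1 i hi⟩

lemma fin_alg {h s T T' M : ℝ} (hh : 0 < h) (hM : 0 ≤ M) (hcs : (h * s) ^ 2 ≤ T * (h * M)) (hT : T ≤ T') :
    h * s ^ 2 ≤ T' * M := by
  have hfin : h * (h * s ^ 2) ≤ h * (T * M) := by nlinarith
  refine (le_of_mul_le_mul_left hfin hh).trans ?_
  gcongr

set_option maxHeartbeats 400000 in
lemma h2_main {n q : ℕ} (hn : 1 ≤ n) (hK : Module.finrank ℚ K = n) (hq : q.Prime) {θ : 𝓞 K}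
    (hθ : θ ^ n = q) (𝒮 : Finset ℕ) (t : ℕ → ℤ) (Y : ℝ) (hY : 1 ≤ Y)
    (h𝒮 : ∀ k ∈ 𝒮, 0 < k ∧ Nat.Coprime k n ∧ (k : ℤ) ^ 2 ∣ t k ^ n - q ∧
      IsCoprime ((n : ℤ) * t k ^ (n - 1)) ((k : ℤ) ^ 2) ∧ (k : ℝ) ≤ Y)
    (X L : ℝ) (hX : X = 2 ^ (n + 1) * Real.sqrt |(discr K : ℝ)|)
    (hL : L = n * Real.log ((2 ^ (n + 1)) ^ 2 * |(discr K : ℝ)|) + 2 * n * Real.log Y) :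
    (Nat.card {c : ClassGroup (𝓞 K) // c ^ 2 = 1} : ℝ) * (𝒮.card : ℝ) ^ 2 ≤
      (X * (1 + Real.log X) ^ n) * (2 * L + 3) ^ n * ∑ k ∈ 𝒮, ((yset n q (3 * Y ^ 2) k (t k)).card : ℝ) := by
  classical
  have hD : (1 : ℝ) ≤ |(discr K : ℝ)| := one_le_abs_discr
  have h2n : (1 : ℝ) ≤ 2 ^ (n + 1) := one_le_pow₀ (by norm_num)
  have hX1 : 1 ≤ X := by
    rw [hX]
    have h1 : (1 : ℝ) ≤ Real.sqrt |(discr K : ℝ)| := Real.one_le_sqrt.2 hD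
    nlinarith
  have hU : (1 : ℝ) ≤ (2 ^ (n + 1)) ^ 2 * |(discr K : ℝ)| := by
    have : (1 : ℝ) ≤ (2 ^ (n + 1)) ^ 2 := one_le_pow₀ h2n
    nlinarith
  have hL0 : 0 ≤ L := by
    rw [hL]
    have := Real.log_nonneg hU
    have := Real.log_nonneg hY
    positivity
  set 𝔞 : ℕ → Ideal (𝓞 K) := fun k => Ideal.span {(k : 𝓞 K), θ - t k} with h𝔞
  have hk𝔞 : ∀ k, (k : 𝓞 K) ∈ 𝔞 k := fun k => Ideal.subset_span (by simp)
  have h𝔞0 : ∀ k, 0 < k → 𝔞 k ≠ ⊥ := by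
    intro k hk h
    have := hk𝔞 k
    rw [h, Ideal.mem_bot] at this
    exact hk.ne' (by exact_mod_cast this)
  choose I α hI hα hα0 using fun c : {c : ClassGroup (𝓞 K) // c ^ 2 = 1} => exists_two_torsion_rep c.1 c.2
  have hdata : ∀ (s : {c : ClassGroup (𝓞 K) // c ^ 2 = 1} × ℕ), ∃ (A : Ideal (𝓞 K)) (u v : 𝓞 K), 0 < s.2 →
      (A ∈ idealsLE K ⌊2 ^ (n + 1) * Real.sqrt |(discr K : ℝ)|⌋₊ ∧ u ≠ 0 ∧ v ≠ 0 ∧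
      (∃ a γ : 𝓞 K, a ≠ 0 ∧ γ ≠ 0 ∧ Ideal.span {γ} * A = Ideal.span {a} * ((I s.1 : Ideal (𝓞 K)) * 𝔞 s.2)) ∧
      Ideal.span {v} * A ^ 2 = Ideal.span {u} * (𝔞 s.2) ^ 2 ∧
      ∀ w : InfinitePlace K, w ((u : K) / (v : K)) ≤ (2 ^ (n + 1)) ^ 2 * |(discr K : ℝ)|) := by
    intro s
    by_cases hs : 0 < s.2
    · obtain ⟨A, u, v, h⟩ := exists_data (θ := θ) hK (I s.1 : Ideal (𝓞 K)) (nonZeroDivisors.coe_ne_zero _) (α s.1) (hα s.1) s.2 hs (t s.2)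
      exact ⟨A, u, v, fun _ => h⟩
    · exact ⟨⊥, 0, 0, fun h => absurd h hs⟩
  choose A u v hAuv using hdata
  set S : Finset ({c : ClassGroup (𝓞 K) // c ^ 2 = 1} × ℕ) := univ ×ˢ 𝒮 with hS
  have hSpos : ∀ s ∈ S, 0 < s.2 := fun s hs => (h𝒮 s.2 (mem_product.1 hs).2).1
  set T : Finset (Ideal (𝓞 K) × (InfinitePlace K → ℤ)) :=
    idealsLE K ⌊X⌋₊ ×ˢ Fintype.piFinset (fun _ : InfinitePlace K => Finset.Icc (-⌈L⌉) ⌈L⌉) with hT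
  set φ : {c : ClassGroup (𝓞 K) // c ^ 2 = 1} × ℕ → Ideal (𝓞 K) × (InfinitePlace K → ℤ) :=
    fun s => (A s, fun w => ⌊Real.log (w ((u s : K) / (v s : K)))⌋) with hφ
  have hmaps : ∀ s ∈ S, φ s ∈ T := by
    intro s hs
    obtain ⟨h1, h2, h3, h4, h5, h6⟩ := hAuv s (hSpos s hs)
    rw [hT, mem_product]
    refine ⟨by rw [hX]; exact h1, ?_⟩
    rw [Fintype.mem_piFinset]
    intro w
    have hb := log_place_bound hn hK (hSpos s hs) _ hU (𝔞 s.2) (A s) (u s) (v s) (hk𝔞 _)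
      (mem_idealsLE.1 h1).1 h2 h3 h5 h6 w
    have hkY : Real.log (s.2 : ℝ) ≤ Real.log Y :=
      Real.log_le_log (by exact_mod_cast hSpos s hs) (h𝒮 s.2 (mem_product.1 hs).2).2.2.2.2
    have hb' : |Real.log (w ((u s : K) / (v s : K)))| ≤ L := by
      rw [hL]
      refine hb.trans ?_
      gcongr
    rw [abs_le] at hb'
    rw [Finset.mem_Icc]
    constructor
    · rw [Int.le_floor]
      push_cast
      linarith [Int.le_ceil L, hb'.1]
    · exact_mod_cast (Int.floor_le _).trans (hb'.2.trans (Int.le_ceil L))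
  have hfib : ∀ s ∈ S, (((S.filter (fun s' => φ s' = φ s)).card : ℕ) : ℝ) ≤
      ((yset n q (3 * Y ^ 2) s.2 (t s.2)).card : ℝ) := by
    intro s hs
    obtain ⟨hk0, hkn, hkd, hkc, hkY⟩ := h𝒮 s.2 (mem_product.1 hs).2
    obtain ⟨h1, h2, h3, h4, h5, h6⟩ := hAuv s hk0
    obtain ⟨𝔠, h𝔠⟩ : 𝔞 s.2 ∣ Ideal.span {(s.2 : 𝓞 K)} := Ideal.dvd_span_singleton.2 (hk𝔞 _)
    have h𝔠0 : 𝔠 ≠ 0 := by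
      rintro rfl
      rw [mul_zero] at h𝔠
      have : (s.2 : 𝓞 K) = 0 := by simpa using h𝔠
      exact hk0.ne' (by exact_mod_cast this)
    have := Finset.card_le_card_of_forall_subsingleton (s := S.filter (fun s' => φ s' = φ s))
      (t := yset n q (3 * Y ^ 2) s.2 (t s.2))
      (fun s' (y : Fin n → ℤ) => ∃ z : 𝓞 K, (n : 𝓞 K) * z = ∑ i : Fin n, (y i : 𝓞 K) * θ ^ (i : ℕ) ∧
        Ideal.span {z} = 𝔠 ^ 2 * (𝔞 s'.2) ^ 2) ?_ ?_
    · exact_mod_cast this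
    · intro s' hs'
      obtain ⟨hs'S, heq⟩ := mem_filter.1 hs'
      obtain ⟨h1', h2', h3', h4', h5', h6'⟩ := hAuv s' (hSpos s' hs'S)
      have hAA : A s' = A s := congrArg Prod.fst heq
      rw [hAA] at h5'
      obtain ⟨y, hy, z, hz⟩ := collision_y hn hK hq hθ s.2 s'.2 (t s.2) (t s'.2) hk0 Y hkY hkd hkc 𝔠 (A s)
        (u s) (v s) (u s') (v s') (mem_idealsLE.1 h1).1 h𝔠.symm h2 h3 h2' h3' h5 h5'
        (fun w => (congrFun (congrArg Prod.snd heq) w).symm)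
      exact ⟨y, hy, z, hz⟩
    · rintro y hy s1 ⟨hs1, z1, hz1, hz1'⟩ s2 ⟨hs2, z2, hz2, hz2'⟩
      obtain ⟨hs1S, heq1⟩ := mem_filter.1 hs1
      obtain ⟨hs2S, heq2⟩ := mem_filter.1 hs2
      have hn0 : (n : 𝓞 K) ≠ 0 := by
        have : n ≠ 0 := by lia
        exact_mod_cast this
      have hzz : z1 = z2 := mul_left_cancel₀ hn0 (hz1.trans hz2.symm)
      rw [← hzz, hz1'] at hz2'
      have e1 : 𝔞 s1.2 ^ 2 = 𝔞 s2.2 ^ 2 := mul_left_cancel₀ (pow_ne_zero 2 h𝔠0) hz2'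
      have e2 : 𝔞 s1.2 = 𝔞 s2.2 := (pow_left_inj two_ne_zero).1 e1
      obtain ⟨k1, n1, d1, c1, -⟩ := h𝒮 s1.2 (mem_product.1 hs1S).2
      obtain ⟨k2, n2, d2, c2, -⟩ := h𝒮 s2.2 (mem_product.1 hs2S).2
      have e3 : s1.2 = s2.2 := by
        apply Nat.dvd_antisymm
        · have : (((s2.2 : ℕ) : ℤ) : 𝓞 K) ∈ 𝔞 s1.2 := by rw [e2]; exact_mod_cast hk𝔞 s2.2
          exact_mod_cast int_mem_ak hn hK hq hθ n1 ((dvd_pow_self _ two_ne_zero).trans d1) this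
        · have : (((s1.2 : ℕ) : ℤ) : 𝓞 K) ∈ 𝔞 s2.2 := by rw [← e2]; exact_mod_cast hk𝔞 s1.2
          exact_mod_cast int_mem_ak hn hK hq hθ n2 ((dvd_pow_self _ two_ne_zero).trans d2) this
      obtain ⟨-, -, -, g1, -⟩ := hAuv s1 k1
      obtain ⟨-, -, -, g2, -⟩ := hAuv s2 k2
      have hAA : A s1 = A s2 := (congrArg Prod.fst heq1).trans (congrArg Prod.fst heq2).symm
      rw [hAA, e2] at g1
      have := same_class (I s1.1) (I s2.1) (𝔞 s2.2) (A s2) (h𝔞0 _ k2) g1 g2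
      rw [hI, hI] at this
      exact Prod.ext (Subtype.ext this) e3
  have hcs := cs_fibre S T φ hmaps _ hfib
  have hTc : (T.card : ℝ) ≤ (X * (1 + Real.log X) ^ n) * (2 * L + 3) ^ n := by
    rw [hT, card_product, Fintype.card_piFinset, Finset.prod_const, Finset.card_univ, Int.card_Icc]
    push_cast
    have e1 : (((⌈L⌉ + 1 - -⌈L⌉).toNat : ℕ) : ℝ) ≤ 2 * L + 3 := by
      have hc0 : 0 ≤ ⌈L⌉ := Int.ceil_nonneg hL0
      have : (((⌈L⌉ + 1 - -⌈L⌉).toNat : ℕ) : ℤ) = 2 * ⌈L⌉ + 1 := by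
        rw [Int.toNat_of_nonneg (by lia)]; ring
      have h' : (((⌈L⌉ + 1 - -⌈L⌉).toNat : ℕ) : ℝ) = 2 * ⌈L⌉ + 1 := by exact_mod_cast this
      rw [h']
      linarith [Int.ceil_lt_add_one L]
    have e2 : (((⌈L⌉ + 1 - -⌈L⌉).toNat : ℕ) : ℝ) ^ Fintype.card (InfinitePlace K) ≤ (2 * L + 3) ^ n := by
      calc _ ≤ (2 * L + 3) ^ Fintype.card (InfinitePlace K) := by gcongr
        _ ≤ _ := pow_le_pow_right₀ (by linarith) (card_places_le hK)
    have e3 := card_idealsLE hK X hX1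
    have : 0 ≤ Real.log X := Real.log_nonneg hX1
    gcongr
  have hsumS : ∑ s ∈ S, ((yset n q (3 * Y ^ 2) s.2 (t s.2)).card : ℝ) =
      (Nat.card {c : ClassGroup (𝓞 K) // c ^ 2 = 1} : ℝ) * ∑ k ∈ 𝒮, ((yset n q (3 * Y ^ 2) k (t k)).card : ℝ) := by
    rw [hS, Finset.sum_product]
    simp only [Finset.sum_const, Finset.card_univ, nsmul_eq_mul, Nat.card_eq_fintype_card]
  have hSc : (S.card : ℝ) = (Nat.card {c : ClassGroup (𝓞 K) // c ^ 2 = 1} : ℝ) * 𝒮.card := by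
    rw [hS, card_product, Finset.card_univ, Nat.card_eq_fintype_card]; push_cast; rfl
  rw [hsumS, hSc] at hcs
  have hh : (0 : ℝ) < Nat.card {c : ClassGroup (𝓞 K) // c ^ 2 = 1} := by
    have : Nonempty {c : ClassGroup (𝓞 K) // c ^ 2 = 1} := ⟨⟨1, one_pow 2⟩⟩
    exact_mod_cast Nat.card_pos
  exact fin_alg hh (Finset.sum_nonneg fun _ _ => Nat.cast_nonneg _) hcs hTc

end PureTwoTorsion

namespace PureTwoTorsion
open Finset

lemma pow_ne_mul_pow {n q : ℕ} (hn : 2 ≤ n) (hq : q.Prime) (μ l : ℤ) (hl : l ≠ 0) :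
    μ ^ n - q * l ^ n ≠ 0 := by
  intro h
  have : Fact q.Prime := ⟨hq⟩
  have e : (μ : ℚ) ^ n = q * (l : ℚ) ^ n := by exact_mod_cast sub_eq_zero.1 h
  have hl' : (l : ℚ) ≠ 0 := by exact_mod_cast hl
  have hq0 : (q : ℚ) ≠ 0 := by exact_mod_cast hq.ne_zero
  have hμ : (μ : ℚ) ≠ 0 := by
    intro h0
    rw [h0, zero_pow (by lia)] at e
    exact mul_ne_zero hq0 (pow_ne_zero _ hl') e.symm
  have v := congrArg (padicValRat q) e
  rw [padicValRat.pow, padicValRat.mul hq0 (pow_ne_zero _ hl'), padicValRat.pow,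
    padicValRat.self hq.one_lt] at v
  have : (n : ℤ) ∣ 1 := ⟨padicValRat q μ - padicValRat q l, by linear_combination -v⟩
  have := Int.le_of_dvd (by norm_num) this
  lia

lemma card_primeFactors_le (N : ℕ) (hN : N ≠ 0) : (N.primeFactors.card : ℝ) ≤ 2 * Real.log N := by
  have h1 : 2 ^ N.primeFactors.card ≤ N := by
    refine le_trans ?_ (Nat.le_of_dvd (Nat.pos_of_ne_zero hN) (Nat.prod_primeFactors_dvd N))
    exact Finset.pow_card_le_prod _ _ _ (fun p hp => (Nat.prime_of_mem_primeFactors hp).two_le)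
  have h2 : (2 : ℝ) ^ N.primeFactors.card ≤ N := by exact_mod_cast h1
  have h3 := Real.log_le_log (by positivity) h2
  rw [Real.log_pow] at h3
  have := Real.log_two_gt_d9
  nlinarith [(Nat.cast_nonneg N.primeFactors.card : (0:ℝ) ≤ _)]

lemma card_dividing (𝒮 : Finset ℕ) (r : ℕ) (h𝒮 : ∀ k ∈ 𝒮, Squarefree k ∧ k.primeFactors.card = r)
    (N : ℕ) (hN : N ≠ 0) : ((𝒮.filter (fun k => k ∣ N)).card : ℝ) ≤ (2 * Real.log N) ^ r := by
  have h1 : (𝒮.filter (fun k => k ∣ N)).card ≤ (N.primeFactors.powersetCard r).card := by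
    apply Finset.card_le_card_of_injOn (fun k => k.primeFactors)
    · intro k hk
      have hk := mem_filter.1 hk
      exact mem_powersetCard.2 ⟨Nat.primeFactors_mono hk.2 hN, (h𝒮 k hk.1).2⟩
    · intro k hk k' hk' h
      have hk := mem_filter.1 hk
      have hk' := mem_filter.1 hk'
      have h : k.primeFactors = k'.primeFactors := h
      rw [← Nat.prod_primeFactors_of_squarefree (h𝒮 k hk.1).1, h,
        Nat.prod_primeFactors_of_squarefree (h𝒮 k' hk'.1).1]
  rw [card_powersetCard] at h1
  have h2 : ((𝒮.filter (fun k => k ∣ N)).card : ℝ) ≤ (N.primeFactors.card : ℝ) ^ r := by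
    exact_mod_cast h1.trans (Nat.choose_le_pow _ _)
  refine h2.trans ?_
  gcongr
  exact card_primeFactors_le N hN

/-- The pairs of top coordinates. -/
noncomputable def pairBox (b c : ℝ) : Finset (ℤ × ℤ) :=
  (Finset.Icc (-⌊b⌋) ⌊b⌋ ×ˢ Finset.Icc (-⌊c⌋) ⌊c⌋).filter (fun p => p.1 ≠ 0)

lemma card_Icc_floor (b : ℝ) (hb : 0 ≤ b) : ((Finset.Icc (-⌊b⌋) ⌊b⌋).card : ℝ) ≤ 2 * b + 1 := by
  rw [Int.card_Icc]
  have h0 : 0 ≤ ⌊b⌋ := Int.floor_nonneg.2 hb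
  have : (((⌊b⌋ + 1 - -⌊b⌋).toNat : ℕ) : ℤ) = 2 * ⌊b⌋ + 1 := by
    rw [Int.toNat_of_nonneg (by lia)]; ring
  have h' : (((⌊b⌋ + 1 - -⌊b⌋).toNat : ℕ) : ℝ) = 2 * ⌊b⌋ + 1 := by exact_mod_cast this
  rw [h']
  linarith [Int.floor_le b]

lemma card_pairBox (b c : ℝ) (hb : 0 ≤ b) (hc : 0 ≤ c) :
    ((pairBox b c).card : ℝ) ≤ (2 * b + 1) * (2 * c + 1) := by
  have h : (pairBox b c).card ≤ (Finset.Icc (-⌊b⌋) ⌊b⌋).card * (Finset.Icc (-⌊c⌋) ⌊c⌋).card := by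
    rw [← card_product]; exact card_filter_le _ _
  calc ((pairBox b c).card : ℝ) ≤ (Finset.Icc (-⌊b⌋) ⌊b⌋).card * (Finset.Icc (-⌊c⌋) ⌊c⌋).card := by exact_mod_cast h
    _ ≤ _ := by
      have := card_Icc_floor b hb
      have := card_Icc_floor c hc
      gcongr

lemma mem_pairBox {b c : ℝ} {p : ℤ × ℤ} :
    p ∈ pairBox b c ↔ |(p.1 : ℝ)| ≤ b ∧ |(p.2 : ℝ)| ≤ c ∧ p.1 ≠ 0 := by
  unfold pairBox
  rw [mem_filter, mem_product, Finset.mem_Icc, Finset.mem_Icc, ← abs_le, ← abs_le, Int.le_floor, Int.le_floor]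
  push_cast
  tauto

/-- Counting the vectors by their top two coordinates. -/
lemma card_yset (n q : ℕ) (hn : 2 ≤ n) (hq : 1 ≤ q) (B : ℝ) (hB : 0 ≤ B) (k : ℕ) (hk : 0 < k) (t : ℤ) (b c : ℝ)
    (hb : b = n * (B * (q : ℝ) ^ (-((n - 1 : ℕ) : ℝ) / n)))
    (hc : c = n * (B * (q : ℝ) ^ (-((n - 2 : ℕ) : ℝ) / n))) :
    ((yset n q B k t).card : ℝ) ≤
      (((pairBox b c).filter (fun p => (k : ℤ) ^ 2 ∣ p.2 - t * p.1)).card + 1) * (2 * (n * B / k ^ 2) + 3) ^ n := by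
  classical
  set m : ℤ := (k : ℤ) ^ 2 with hm
  have hm0 : 0 < m := by positivity
  set P := (pairBox b c).filter (fun p => m ∣ p.2 - t * p.1) with hP
  set Z : ℝ := n * B / k ^ 2 with hZ
  have hZ0 : 0 ≤ Z := by positivity
  set E : Finset (Fin n → ℤ) := Fintype.piFinset (fun _ : Fin n => Finset.Icc (-⌊Z + 1⌋) ⌊Z + 1⌋) with hE
  have hi1 : n - 1 < n := by lia
  have hi2 : n - 2 < n := by lia
  set f : (Fin n → ℤ) → (ℤ × ℤ) × (Fin n → ℤ) := fun y =>
    ((if y ⟨n - 1, hi1⟩ = 0 then (0, 0) else (y ⟨n - 1, hi1⟩, y ⟨n - 2, hi2⟩)),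
      fun i => if h : (i : ℕ) + 1 < n then (y i - (t * y ⟨i + 1, h⟩) % m) / m else 0) with hf
  have hmem : ∀ y ∈ yset n q B k t, (∀ i, |(y i : ℝ)| ≤ n * (B * (q : ℝ) ^ (-((i : ℕ) : ℝ) / n))) ∧
      ∀ (i : ℕ) (hi : i + 1 < n), m ∣ y ⟨i, by lia⟩ - t * y ⟨i + 1, hi⟩ := by
    intro y hy
    have := mem_filter.1 hy
    exact ⟨mem_ybox.1 this.1, this.2⟩
  have hdv : ∀ y ∈ yset n q B k t, ∀ (i : ℕ) (hi : i + 1 < n),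
      m * ((y ⟨i, by lia⟩ - (t * y ⟨i + 1, hi⟩) % m) / m) = y ⟨i, by lia⟩ - (t * y ⟨i + 1, hi⟩) % m := by
    intro y hy i hi
    apply Int.mul_ediv_cancel'
    have h1 := (hmem y hy).2 i hi
    have h2 : y ⟨i, by lia⟩ - (t * y ⟨i + 1, hi⟩) % m =
      (y ⟨i, by lia⟩ - t * y ⟨i + 1, hi⟩) + m * ((t * y ⟨i + 1, hi⟩) / m) := by
      have := Int.emod_add_mul_ediv (t * y ⟨i + 1, hi⟩) m
      linarith
    rw [h2]
    exact dvd_add h1 (dvd_mul_right _ _)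
  have hcard : (yset n q B k t).card ≤ ((insert (0, 0) P) ×ˢ E).card := by
    apply Finset.card_le_card_of_injOn f
    · intro y hy
      have hy : y ∈ yset n q B k t := hy
      refine mem_coe.2 (mem_product.2 ⟨?_, ?_⟩)
      · simp only [hf]
        split_ifs with h0
        · exact mem_insert_self _ _
        · apply mem_insert_of_mem
          rw [hP, mem_filter, mem_pairBox]
          refine ⟨⟨?_, ?_, h0⟩, ?_⟩
          · rw [hb]; exact (hmem y hy).1 ⟨n - 1, hi1⟩
          · rw [hc]; exact (hmem y hy).1 ⟨n - 2, hi2⟩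
          · have := (hmem y hy).2 (n - 2) (by lia)
            have e : (⟨n - 2 + 1, by lia⟩ : Fin n) = ⟨n - 1, hi1⟩ := by
              ext; simp; lia
            rw [e] at this
            exact this
      · rw [hE, Fintype.mem_piFinset]
        intro i
        rw [Finset.mem_Icc, ← abs_le, Int.le_floor]
        simp only [hf]
        split_ifs with hi
        · have h1 := hdv y hy i hi
          set e := (y ⟨i, by lia⟩ - (t * y ⟨i + 1, hi⟩) % m) / m with he
          have hr0 := Int.emod_nonneg (t * y ⟨i + 1, hi⟩) hm0.ne'
          have hr1 := Int.emod_lt_of_pos (t * y ⟨i + 1, hi⟩) hm0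
          set ρ := (t * y ⟨i + 1, hi⟩) % m with hρ
          have hyb : |(y ⟨i, by lia⟩ : ℝ)| ≤ n * B := by
            refine ((hmem y hy).1 ⟨i, by lia⟩).trans ?_
            gcongr
            have : (q : ℝ) ^ (-((i : ℕ) : ℝ) / n) ≤ 1 := by
              apply Real.rpow_le_one_of_one_le_of_nonpos
              · exact_mod_cast hq
              · apply div_nonpos_of_nonpos_of_nonneg
                · simp
                · positivity
            exact mul_le_of_le_one_right hB this
          have hmR : (0 : ℝ) < m := by exact_mod_cast hm0
          have hmk : (m : ℝ) = (k : ℝ) ^ 2 := by rw [hm]; push_cast; rfl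
          have h2 : (m : ℝ) * e = y ⟨i, by lia⟩ - ρ := by exact_mod_cast h1
          have h3 : (m : ℝ) * |(e : ℝ)| ≤ n * B + m := by
            rw [← abs_of_pos hmR, ← abs_mul, h2, abs_of_pos hmR]
            refine (abs_sub _ _).trans ?_
            have : |(ρ : ℝ)| ≤ m := by
              rw [abs_of_nonneg (by exact_mod_cast hr0)]
              exact_mod_cast hr1.le
            linarith
          push_cast
          have h4 : |(e : ℝ)| ≤ (n * B + m) / m := by
            rw [le_div_iff₀ hmR]; linarith
          refine h4.trans ?_
          rw [add_div, div_self hmR.ne', hZ, hmk]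
        · simp; linarith
    · intro y hy y' hy' h
      have hy : y ∈ yset n q B k t := hy
      have hy' : y' ∈ yset n q B k t := hy'
      have hA := congrArg Prod.fst h
      have hBe := congrArg Prod.snd h
      have htop : y ⟨n - 1, hi1⟩ = y' ⟨n - 1, hi1⟩ := by
        simp only [hf] at hA
        have hA1 := congrArg Prod.fst hA
        split_ifs at hA1 with h0 h1 h1
        · rw [h0, h1]
        · rw [h0]; exact hA1
        · rw [h1]; exact hA1
        · exact hA1
      have key : ∀ d : ℕ, ∀ i (hi : i < n), n - 1 - i = d → y ⟨i, hi⟩ = y' ⟨i, hi⟩ := by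
        intro d
        induction d with
        | zero =>
          intro i hi hd
          have : i = n - 1 := by lia
          subst this; exact htop
        | succ d ih =>
          intro i hi hd
          have hi' : i + 1 < n := by lia
          have e1 := ih (i + 1) hi' (by lia)
          have e2 := congrFun hBe ⟨i, hi⟩
          simp only [hf, hi', dif_pos] at e2
          have e3 := hdv y hy i hi'
          have e4 := hdv y' hy' i hi'
          rw [e2] at e3
          rw [e1] at e3
          linarith
      ext i
      exact key _ i.1 i.2 rfl
  have hEc : (E.card : ℝ) ≤ (2 * Z + 3) ^ n := by
    rw [hE, Fintype.card_piFinset, Finset.prod_const, Finset.card_univ, Fintype.card_fin]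
    push_cast
    have := card_Icc_floor (Z + 1) (by linarith)
    gcongr
    linarith
  have hins : (((insert (0, 0) P).card : ℕ) : ℝ) ≤ P.card + 1 := by exact_mod_cast card_insert_le _ _
  calc ((yset n q B k t).card : ℝ) ≤ (((insert (0, 0) P) ×ˢ E).card : ℝ) := by exact_mod_cast hcard
    _ = ((insert (0, 0) P).card : ℝ) * E.card := by rw [card_product]; push_cast; rfl
    _ ≤ _ := by gcongr

set_option maxHeartbeats 1000000 in
lemma count_main (n q : ℕ) (hn : 3 ≤ n) (hq : q.Prime) (𝒮 : Finset ℕ) (t : ℕ → ℤ) (r : ℕ) (Y κ : ℝ)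
    (hY : Y = (q : ℝ) ^ ((2 : ℝ) / 3 - 1 / n)) (hκ : 0 < κ)
    (h𝒮 : ∀ k ∈ 𝒮, κ ≤ k ∧ Squarefree k ∧ k.primeFactors.card = r ∧ (k : ℤ) ^ 2 ∣ t k ^ n - q) :
    ∑ k ∈ 𝒮, ((yset n q (3 * Y ^ 2) k (t k)).card : ℝ) ≤
      (𝒮.card + 81 * n ^ 2 * Y * (2 * Real.log ((3 * n * Y ^ 2) ^ n * (2 * q))) ^ r) *
        (2 * (n * (3 * Y ^ 2) / κ ^ 2) + 3) ^ n := by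
  classical
  have hq1 : (1 : ℝ) ≤ q := by exact_mod_cast hq.one_lt.le
  have hq0 : (0 : ℝ) < q := by linarith
  have hnR : (3 : ℝ) ≤ n := by exact_mod_cast hn
  have hinv : (1 : ℝ) / n ≤ 1 / 3 := one_div_le_one_div_of_le (by norm_num) hnR
  have hY1 : 1 ≤ Y := by rw [hY]; exact Real.one_le_rpow hq1 (by linarith)
  set b : ℝ := n * ((3 * Y ^ 2) * (q : ℝ) ^ (-((n - 1 : ℕ) : ℝ) / n)) with hb
  set c : ℝ := n * ((3 * Y ^ 2) * (q : ℝ) ^ (-((n - 2 : ℕ) : ℝ) / n)) with hc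
  have hbv : b = 3 * n * (q : ℝ) ^ ((1 : ℝ) / 3 - 1 / n) := by
    rw [hb, hY, ← Real.rpow_natCast, ← Real.rpow_mul hq0.le, Nat.cast_sub (by lia)]
    have : (q : ℝ) ^ ((1 : ℝ) / 3 - 1 / n) = (q : ℝ) ^ (((2 : ℝ) / 3 - 1 / n) * (2 : ℕ)) * (q : ℝ) ^ (-((n : ℝ) - (1 : ℕ)) / n) := by
      rw [← Real.rpow_add hq0]
      congr 1
      push_cast; field_simp; ring
    rw [this]; ring
  have hcv : c = 3 * n * (q : ℝ) ^ ((1 : ℝ) / 3) := by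
    rw [hc, hY, ← Real.rpow_natCast, ← Real.rpow_mul hq0.le, Nat.cast_sub (by lia)]
    have : (q : ℝ) ^ ((1 : ℝ) / 3) = (q : ℝ) ^ (((2 : ℝ) / 3 - 1 / n) * (2 : ℕ)) * (q : ℝ) ^ (-((n : ℝ) - (2 : ℕ)) / n) := by
      rw [← Real.rpow_add hq0]
      congr 1
      push_cast; field_simp; ring
    rw [this]; ring
  have hb1 : 1 ≤ b := by
    rw [hbv]
    have : (1 : ℝ) ≤ (q : ℝ) ^ ((1 : ℝ) / 3 - 1 / n) := Real.one_le_rpow hq1 (by linarith)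
    nlinarith
  have hc1 : 1 ≤ c := by
    rw [hcv]
    have : (1 : ℝ) ≤ (q : ℝ) ^ ((1 : ℝ) / 3) := Real.one_le_rpow hq1 (by norm_num)
    nlinarith
  have hbox : ((pairBox b c).card : ℝ) ≤ 81 * n ^ 2 * Y := by
    refine (card_pairBox b c (by linarith) (by linarith)).trans ?_
    calc (2 * b + 1) * (2 * c + 1) ≤ (3 * b) * (3 * c) := by gcongr <;> linarith
      _ = 81 * n ^ 2 * Y := by
        rw [hbv, hcv, hY]
        have : (q : ℝ) ^ ((2 : ℝ) / 3 - 1 / n) = (q : ℝ) ^ ((1 : ℝ) / 3 - 1 / n) * (q : ℝ) ^ ((1 : ℝ) / 3) := by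
          rw [← Real.rpow_add hq0]; congr 1; ring
        rw [this]; ring
  set Λ : ℝ := (2 * Real.log ((3 * n * Y ^ 2) ^ n * (2 * q))) ^ r with hΛ
  set R : ℝ := (2 * (n * (3 * Y ^ 2) / κ ^ 2) + 3) ^ n with hR
  have hR0 : 0 ≤ R := by positivity
  have hstep : ∀ k ∈ 𝒮, ((yset n q (3 * Y ^ 2) k (t k)).card : ℝ) ≤
      (((pairBox b c).filter (fun p => (k : ℤ) ^ 2 ∣ p.2 - t k * p.1)).card + 1) * R := by
    intro k hk
    have hkκ := (h𝒮 k hk).1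
    have hk0 : 0 < k := by
      have : (0 : ℝ) < k := by linarith
      exact_mod_cast this
    refine (card_yset n q (by lia) hq.one_lt.le (3 * Y ^ 2) (by positivity) k hk0 (t k) b c hb hc).trans ?_
    rw [hR]
    gcongr
  refine (Finset.sum_le_sum hstep).trans ?_
  rw [← Finset.sum_mul]
  apply mul_le_mul_of_nonneg_right _ hR0
  rw [Finset.sum_add_distrib, Finset.sum_const, nsmul_eq_mul, mul_one, add_comm]
  gcongr
  have hdouble : ∑ k ∈ 𝒮, (((pairBox b c).filter (fun p => (k : ℤ) ^ 2 ∣ p.2 - t k * p.1)).card : ℝ) =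
      ∑ p ∈ pairBox b c, ((𝒮.filter (fun k : ℕ => (k : ℤ) ^ 2 ∣ p.2 - t k * p.1)).card : ℝ) := by
    simp only [Finset.card_filter, Nat.cast_sum]
    rw [Finset.sum_comm]
  rw [hdouble]
  have hpt : ∀ p ∈ pairBox b c, ((𝒮.filter (fun k : ℕ => (k : ℤ) ^ 2 ∣ p.2 - t k * p.1)).card : ℝ) ≤ Λ := by
    intro p hp
    obtain ⟨hp1, hp2, hp0⟩ := mem_pairBox.1 hp
    have hN := pow_ne_mul_pow (by lia : 2 ≤ n) hq p.2 p.1 hp0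
    set N : ℤ := p.2 ^ n - q * p.1 ^ n with hNdef
    have hN' : N.natAbs ≠ 0 := Int.natAbs_ne_zero.2 hN
    have hsub : 𝒮.filter (fun k : ℕ => (k : ℤ) ^ 2 ∣ p.2 - t k * p.1) ⊆ 𝒮.filter (fun k => k ∣ N.natAbs) := by
      intro k hk
      obtain ⟨hk1, hk2⟩ := mem_filter.1 hk
      refine mem_filter.2 ⟨hk1, ?_⟩
      rw [← Int.natCast_dvd]
      have h1 : (k : ℤ) ∣ p.2 - t k * p.1 := (dvd_pow_self _ two_ne_zero).trans hk2
      have h2 : (k : ℤ) ∣ t k ^ n - q := (dvd_pow_self _ two_ne_zero).trans (h𝒮 k hk1).2.2.2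
      have h3 : (k : ℤ) ∣ p.2 ^ n - (t k * p.1) ^ n := h1.trans (sub_dvd_pow_sub_pow _ _ _)
      have : N = (p.2 ^ n - (t k * p.1) ^ n) + (t k ^ n - q) * p.1 ^ n := by rw [hNdef]; ring
      rw [this]
      exact dvd_add h3 (h2.mul_right _)
    have h1 := card_dividing 𝒮 r (fun k hk => ⟨(h𝒮 k hk).2.1, (h𝒮 k hk).2.2.1⟩) N.natAbs hN'
    refine le_trans (by exact_mod_cast card_le_card hsub) (h1.trans ?_)
    rw [hΛ]
    have hNpos : (0 : ℝ) < N.natAbs := by exact_mod_cast Nat.pos_of_ne_zero hN'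
    have hNle : (N.natAbs : ℝ) ≤ (3 * n * Y ^ 2) ^ n * (2 * q) := by
      have e : (N.natAbs : ℝ) = |(p.2 : ℝ) ^ n - q * (p.1 : ℝ) ^ n| := by
        rw [Nat.cast_natAbs, hNdef]; push_cast; rfl
      rw [e]
      have hle : ∀ j : ℕ, (q : ℝ) ^ (-(j : ℝ) / n) ≤ 1 := fun j =>
        Real.rpow_le_one_of_one_le_of_nonpos hq1
          (div_nonpos_of_nonpos_of_nonneg (by simp) (by positivity))
      have hbb : b ≤ 3 * n * Y ^ 2 := by
        rw [hb]
        have := hle (n - 1)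
        have h3 : (3 * Y ^ 2) * (q : ℝ) ^ (-((n - 1 : ℕ) : ℝ) / n) ≤ 3 * Y ^ 2 := mul_le_of_le_one_right (by positivity) this
        nlinarith
      have hcc : c ≤ 3 * n * Y ^ 2 := by
        rw [hc]
        have := hle (n - 2)
        have h3 : (3 * Y ^ 2) * (q : ℝ) ^ (-((n - 2 : ℕ) : ℝ) / n) ≤ 3 * Y ^ 2 := mul_le_of_le_one_right (by positivity) this
        nlinarith
      refine (abs_sub _ _).trans ?_
      rw [abs_mul, abs_pow, abs_pow, abs_of_pos hq0]
      have g1 : |(p.2 : ℝ)| ^ n ≤ (3 * n * Y ^ 2) ^ n := by gcongr; linarith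
      have g2 : |(p.1 : ℝ)| ^ n ≤ (3 * n * Y ^ 2) ^ n := by gcongr; linarith
      have g3 : (q : ℝ) * |(p.1 : ℝ)| ^ n ≤ q * (3 * n * Y ^ 2) ^ n := by gcongr
      have g4 : (0 : ℝ) ≤ (3 * n * Y ^ 2) ^ n := by positivity
      nlinarith
    have hlog0 : 0 ≤ Real.log (N.natAbs : ℝ) := Real.log_natCast_nonneg _
    have := Real.log_le_log hNpos hNle
    gcongr
  have hΛ0 : 0 ≤ Λ := by
    rw [hΛ]
    apply pow_nonneg
    have : (1 : ℝ) ≤ (3 * n * Y ^ 2) ^ n * (2 * q) := by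
      have h1 : (1 : ℝ) ≤ (3 * n * Y ^ 2) ^ n := one_le_pow₀ (by nlinarith)
      exact one_le_mul_of_one_le_of_one_le h1 (by linarith)
    have := Real.log_nonneg this
    linarith
  calc _ ≤ ∑ p ∈ pairBox b c, Λ := Finset.sum_le_sum hpt
    _ = (pairBox b c).card * Λ := by rw [Finset.sum_const, nsmul_eq_mul]
    _ ≤ _ := by gcongr

end PureTwoTorsion


namespace PureTwoTorsion
open NumberField

lemma Xlog (n : ℕ) (hn : 1 ≤ n) (ε : ℝ) (hε : 0 < ε) : ∃ C : ℝ, 1 ≤ C ∧ ∀ q : ℕ, q.Prime →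
    ∀ D X : ℝ, 1 ≤ D → D ≤ (n : ℝ) ^ n * (q : ℝ) ^ (n - 1) → X = 2 ^ (n + 1) * Real.sqrt D →
      1 ≤ X ∧ X * (1 + Real.log X) ^ n ≤ C * (q : ℝ) ^ (((n : ℝ) - 1) / 2 + ε) := by
  have hnR : (1 : ℝ) ≤ n := by exact_mod_cast hn
  set A : ℝ := 2 ^ (n + 1) * Real.sqrt ((n : ℝ) ^ n) with hA
  have hA1 : 1 ≤ A := by
    have h1 : (1 : ℝ) ≤ 2 ^ (n + 1) := one_le_pow₀ (by norm_num)
    have h2 : (1 : ℝ) ≤ Real.sqrt ((n : ℝ) ^ n) := Real.one_le_sqrt.2 (one_le_pow₀ hnR)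
    exact one_le_mul_of_one_le_of_one_le h1 h2
  obtain ⟨C, hC1, hC⟩ := polylog (1 + Real.log A) n (by linarith [Real.log_nonneg hA1]) (by positivity) n ε hε
  refine ⟨A * C, one_le_mul_of_one_le_of_one_le hA1 hC1, ?_⟩
  intro q hq D X hD1 hD hX
  have hq1 : (1 : ℝ) ≤ q := by exact_mod_cast hq.one_lt.le
  have hq0 : (0 : ℝ) < q := by linarith
  have hX1 : 1 ≤ X := by
    rw [hX]
    exact one_le_mul_of_one_le_of_one_le (one_le_pow₀ (by norm_num)) (Real.one_le_sqrt.2 hD1)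
  refine ⟨hX1, ?_⟩
  have hXle : X ≤ A * (q : ℝ) ^ (((n : ℝ) - 1) / 2) := by
    have h1 : Real.sqrt D ≤ Real.sqrt ((n : ℝ) ^ n) * (q : ℝ) ^ (((n : ℝ) - 1) / 2) := by
      refine (Real.sqrt_le_sqrt hD).trans ?_
      rw [Real.sqrt_mul (by positivity)]
      have : Real.sqrt ((q : ℝ) ^ (n - 1)) = (q : ℝ) ^ (((n : ℝ) - 1) / 2) := by
        rw [Real.sqrt_eq_rpow, ← Real.rpow_natCast, ← Real.rpow_mul hq0.le, Nat.cast_sub hn]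
        congr 1; push_cast; ring
      rw [this]
    rw [hX, hA, mul_assoc]
    gcongr
  have hX0 : 0 < X := by linarith
  have hlog : Real.log X ≤ Real.log A + n * Real.log q := by
    refine (Real.log_le_log hX0 hXle).trans ?_
    rw [Real.log_mul (by linarith) (by positivity), Real.log_rpow hq0]
    have := Real.log_nonneg hq1
    nlinarith
  have hlog0 := Real.log_nonneg hX1
  calc X * (1 + Real.log X) ^ n ≤ (A * (q : ℝ) ^ (((n : ℝ) - 1) / 2)) * ((1 + Real.log A) + n * Real.log q) ^ n := by
        exact mul_le_mul hXle (pow_le_pow_left₀ (by linarith) (by linarith) _) (by positivity) (by positivity)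
    _ ≤ (A * (q : ℝ) ^ (((n : ℝ) - 1) / 2)) * (C * (q : ℝ) ^ ε) := by
        gcongr
        exact hC q hq1
    _ = _ := by rw [Real.rpow_add hq0]; ring

/-- The statement that the two-torsion is bounded by `q ^ (e + ε)` for all pure fields of degree `n`. -/
def TorBd (n : ℕ) (e : ℝ) : Prop := ∀ ε : ℝ, 0 < ε → ∃ C : ℝ, 1 ≤ C ∧ ∀ q : ℕ, q.Prime →
    ∀ (K : Type) [Field K] [NumberField K], Module.finrank ℚ K = n → ∀ θ : 𝓞 K, θ ^ n = (q : 𝓞 K) →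
      (Nat.card {c : ClassGroup (𝓞 K) // c ^ 2 = 1} : ℝ) ≤ C * (q : ℝ) ^ (e + ε)

lemma card_tor_le (K : Type) [Field K] [NumberField K] :
    (Nat.card {c : ClassGroup (𝓞 K) // c ^ 2 = 1} : ℝ) ≤ Nat.card (ClassGroup (𝓞 K)) := by
  exact_mod_cast Nat.card_le_card_of_injective _ Subtype.val_injective

lemma class_bd (n : ℕ) (hn : 1 ≤ n) (ε : ℝ) (hε : 0 < ε) : ∃ C : ℝ, 1 ≤ C ∧ ∀ q : ℕ, q.Prime →
    ∀ (K : Type) [Field K] [NumberField K], Module.finrank ℚ K = n → ∀ θ : 𝓞 K, θ ^ n = (q : 𝓞 K) →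
      (Nat.card (ClassGroup (𝓞 K)) : ℝ) ≤ C * (q : ℝ) ^ (((n : ℝ) - 1) / 2 + ε) := by
  obtain ⟨C, hC1, hC⟩ := Xlog n hn ε hε
  refine ⟨C, hC1, fun q hq K _ _ hK θ hθ => ?_⟩
  exact (card_class_le hK _ rfl).trans (hC q hq _ _ (one_le_abs_discr) (discr_le hn hK hq hθ).1 rfl).2

lemma torBd_triv (n : ℕ) (hn : 1 ≤ n) : TorBd n (((n : ℝ) - 1) / 2) := by
  intro ε hε
  obtain ⟨C, hC1, hC⟩ := class_bd n hn ε hε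
  exact ⟨C, hC1, fun q hq K _ _ hK θ hθ => (card_tor_le K).trans (hC q hq K hK θ hθ)⟩

lemma torBd_mono {n : ℕ} {e e' : ℝ} (h : e ≤ e') (hT : TorBd n e) : TorBd n e' := by
  intro ε hε
  obtain ⟨C, hC1, hC⟩ := hT ε hε
  refine ⟨C, hC1, fun q hq K _ _ hK θ hθ => (hC q hq K hK θ hθ).trans ?_⟩
  have hq1 : (1 : ℝ) ≤ q := by exact_mod_cast hq.one_lt.le
  gcongr

end PureTwoTorsion


namespace PureTwoTorsion
open NumberField Finset

lemma primeFactors_prod_primes (s : Finset ℕ) (hs : ∀ p ∈ s, p.Prime) :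
    Squarefree (∏ p ∈ s, p) ∧ (∏ p ∈ s, p).primeFactors = s := by
  refine ⟨?_, Nat.primeFactors_prod hs⟩
  refine (Finset.squarefree_prod_of_pairwise_isCoprime ?_ (fun p hp => (hs p hp).squarefree))
  intro a ha b hb hab
  exact (Nat.coprime_iff_isRelPrime).1 ((Nat.coprime_primes (hs a ha) (hs b hb)).2 hab)

lemma totient_sq_coprime (n : ℕ) (hn : Odd n) (s : Finset ℕ) (hs : ∀ p ∈ s, p.Prime ∧ (p : ZMod n) = 2) :
    Nat.Coprime (∏ p ∈ s, p) n ∧ Nat.Coprime (Nat.totient ((∏ p ∈ s, p) ^ 2)) n := by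
  have hp2 : ∀ p ∈ s, Nat.Coprime p n := by
    intro p hp
    rw [← ZMod.isUnit_iff_coprime, (hs p hp).2]
    have := (ZMod.isUnit_iff_coprime 2 n).2 (Nat.coprime_two_left.2 hn)
    exact_mod_cast this
  have hp1 : ∀ p ∈ s, Nat.Coprime (p - 1) n := by
    intro p hp
    rw [← ZMod.isUnit_iff_coprime, Nat.cast_sub (hs p hp).1.one_lt.le, (hs p hp).2]
    have : (2 : ZMod n) - ((1 : ℕ) : ZMod n) = 1 := by push_cast; ring
    rw [this]; exact isUnit_one
  have hk : Nat.Coprime (∏ p ∈ s, p) n := Nat.Coprime.prod_left hp2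
  refine ⟨hk, ?_⟩
  clear hk
  induction s using Finset.induction_on with
  | empty => simp
  | insert p s hps ih =>
    have ihs := ih (fun x hx => hs x (mem_insert_of_mem hx)) (fun x hx => hp2 x (mem_insert_of_mem hx))
      (fun x hx => hp1 x (mem_insert_of_mem hx))
    rw [prod_insert hps, mul_pow, Nat.totient_mul]
    · refine Nat.Coprime.mul_left ?_ ihs
      rw [Nat.totient_prime_pow_succ (hs p (mem_insert_self _ _)).1, pow_one]
      exact Nat.Coprime.mul_left (hp2 p (mem_insert_self _ _)) (hp1 p (mem_insert_self _ _))
    · apply Nat.Coprime.pow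
      refine Nat.Coprime.prod_right (fun x hx => ?_)
      refine (Nat.coprime_primes (hs p (mem_insert_self _ _)).1 (hs x (mem_insert_of_mem hx)).1).2 ?_
      rintro rfl; exact hps hx

lemma odd_family (n q : ℕ) (hn : Odd n) (hq : q.Prime) (P : Finset ℕ) (r : ℕ)
    (hP : ∀ p ∈ P, p.Prime ∧ p ≠ q ∧ (p : ZMod n) = 2) :
    ∃ (𝒮 : Finset ℕ) (t : ℕ → ℤ), 𝒮.card = (P.powersetCard r).card ∧
      (∀ k ∈ 𝒮, ∃ s ∈ P.powersetCard r, k = ∏ p ∈ s, p) ∧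
      ∀ k ∈ 𝒮, 0 < k ∧ Nat.Coprime k n ∧ (k : ℤ) ^ 2 ∣ t k ^ n - q ∧
        IsCoprime ((n : ℤ) * t k ^ (n - 1)) ((k : ℤ) ^ 2) ∧ Squarefree k ∧ k.primeFactors.card = r := by
  classical
  have hPs : ∀ s ∈ P.powersetCard r, ∀ p ∈ s, p.Prime ∧ p ≠ q ∧ (p : ZMod n) = 2 :=
    fun s hs p hp => hP p ((mem_powersetCard.1 hs).1 hp)
  have hqk : ∀ s ∈ P.powersetCard r, Nat.Coprime q (∏ p ∈ s, p) := fun s hs =>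
    Nat.Coprime.prod_right (fun p hp => (Nat.coprime_primes hq (hPs s hs p hp).1).2 (hPs s hs p hp).2.1.symm)
  have hpos : ∀ s ∈ P.powersetCard r, 0 < ∏ p ∈ s, p := fun s hs =>
    Finset.prod_pos (fun p hp => (hPs s hs p hp).1.pos)
  have hroot : ∀ k : ℕ, ∃ t : ℤ, (∃ s ∈ P.powersetCard r, k = ∏ p ∈ s, p) → (k : ℤ) ^ 2 ∣ t ^ n - q := by
    intro k
    by_cases h : ∃ s ∈ P.powersetCard r, k = ∏ p ∈ s, p
    · obtain ⟨s, hs, rfl⟩ := h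
      obtain ⟨t, ht⟩ := exists_root n q _ (hpos s hs) (hqk s hs)
        (totient_sq_coprime n hn s (fun p hp => ⟨(hPs s hs p hp).1, (hPs s hs p hp).2.2⟩)).2
      exact ⟨t, fun _ => ht⟩
    · exact ⟨0, fun h' => absurd h' h⟩
  choose t ht using hroot
  refine ⟨(P.powersetCard r).image (fun s => ∏ p ∈ s, p), t, ?_, ?_, ?_⟩
  · refine card_image_of_injOn (fun s hs s' hs' h => ?_)
    have h1 := (primeFactors_prod_primes s (fun p hp => (hPs s hs p hp).1)).2
    have h2 := (primeFactors_prod_primes s' (fun p hp => (hPs s' hs' p hp).1)).2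
    rw [← h1, ← h2, h]
  · intro k hk
    obtain ⟨s, hs, rfl⟩ := mem_image.1 hk
    exact ⟨s, hs, rfl⟩
  · intro k hk
    obtain ⟨s, hs, hsk⟩ := mem_image.1 hk
    have hdiv := ht k ⟨s, hs, hsk.symm⟩
    obtain ⟨hsq, hpf⟩ := primeFactors_prod_primes s (fun p hp => (hPs s hs p hp).1)
    have hkn := (totient_sq_coprime n hn s (fun p hp => ⟨(hPs s hs p hp).1, (hPs s hs p hp).2.2⟩)).1
    have hqk' := hqk s hs
    have hpos' := hpos s hs
    rw [hsk] at hsq hpf hkn hqk' hpos'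
    refine ⟨hpos', hkn, hdiv, ?_, hsq, by rw [hpf]; exact (mem_powersetCard.1 hs).2⟩
    apply IsCoprime.pow_right
    apply IsCoprime.mul_left (Nat.isCoprime_iff_coprime.2 hkn.symm)
    apply IsCoprime.pow_left
    have hn0 : 0 < n := hn.pos
    have h1 : IsCoprime (t k ^ n) (k : ℤ) := by
      obtain ⟨d, hd⟩ := (dvd_pow_self (k : ℤ) two_ne_zero).trans hdiv
      have : t k ^ n = (q : ℤ) + k * d := by linarith
      rw [this]
      exact (Nat.isCoprime_iff_coprime.2 hqk').add_mul_left_left d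
    exact (IsCoprime.pow_left_iff hn0).1 h1

end PureTwoTorsion


namespace PureTwoTorsion
open NumberField Finset

lemma odd_real (n : ℕ) (q Y δ η c κ s h a C1 C2 C3 T1 T2 Λ : ℝ) (hq : 1 ≤ q) (hδ : 0 ≤ δ) (hδ1 : δ ≤ 1)
    (hη : 0 < η) (hY : Y = q ^ δ) (hc : 0 < c) (hκ : κ = c * Y ^ (1 - η)) (hκs : κ ≤ s) (hsY : s ≤ Y)
    (hh : 0 ≤ h) (hT1 : T1 ≤ C1 * q ^ (a + η)) (hT2 : T2 ≤ C2 * q ^ η) (hΛ : Λ ≤ C3 * q ^ η)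
    (hT1' : 0 ≤ T1) (hT2' : 0 ≤ T2) (hΛ0 : 0 ≤ Λ) (hC1 : 0 ≤ C1) (hC2 : 0 ≤ C2) (hC3 : 0 ≤ C3)
    (H : h * s ^ 2 ≤ T1 * T2 * ((s + 81 * n ^ 2 * Y * Λ) * (2 * (n * (3 * Y ^ 2) / κ ^ 2) + 3) ^ n)) :
    h ≤ (C1 * C2 * (1 + 81 * n ^ 2 * C3) * (6 * n / c ^ 2 + 3) ^ n / c ^ 2) * q ^ (a - δ + (5 + 2 * n) * η) := by
  have hq0 : 0 < q := by linarith
  have hY1 : 1 ≤ Y := by rw [hY]; exact Real.one_le_rpow hq hδ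
  have hY0 : 0 < Y := by linarith
  have hYq : Y ≤ q := by
    rw [hY]; exact (Real.rpow_le_rpow_of_exponent_le hq hδ1).trans (by rw [Real.rpow_one])
  have hκ0 : 0 < κ := by rw [hκ]; positivity
  have hs0 : 0 < s := by linarith
  set Z : ℝ := Y ^ (2 * η) with hZ
  have hZ1 : 1 ≤ Z := Real.one_le_rpow hY1 (by linarith)
  have hZq : Z ≤ q ^ (2 * η) := Real.rpow_le_rpow hY0.le hYq (by linarith)
  have hκ2 : κ ^ 2 * Z = c ^ 2 * Y ^ 2 := by
    rw [hκ, mul_pow, hZ, ← Real.rpow_natCast (Y ^ (1 - η)), ← Real.rpow_mul hY0.le, mul_assoc, ← Real.rpow_add hY0,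
      ← Real.rpow_natCast Y]
    congr 2; push_cast; ring
  have hqη : 1 ≤ q ^ η := Real.one_le_rpow hq hη.le
  have hR : (2 * (n * (3 * Y ^ 2) / κ ^ 2) + 3) ^ n ≤ (6 * n / c ^ 2 + 3) ^ n * q ^ (2 * n * η) := by
    have e1 : Y ^ 2 / κ ^ 2 = Z / c ^ 2 := by
      rw [div_eq_div_iff (by positivity) (by positivity)]; linarith
    have e2 : 2 * (n * (3 * Y ^ 2) / κ ^ 2) + 3 ≤ (6 * n / c ^ 2 + 3) * q ^ (2 * η) := by
      calc 2 * (n * (3 * Y ^ 2) / κ ^ 2) + 3 = 6 * n * (Y ^ 2 / κ ^ 2) + 3 := by ring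
        _ = 6 * n / c ^ 2 * Z + 3 := by rw [e1]; ring
        _ ≤ 6 * n / c ^ 2 * Z + 3 * Z := by linarith
        _ = (6 * n / c ^ 2 + 3) * Z := by ring
        _ ≤ _ := by gcongr
    refine (pow_le_pow_left₀ (by positivity) e2 n).trans ?_
    rw [mul_pow, ← Real.rpow_natCast (q ^ (2 * η)), ← Real.rpow_mul hq0.le]
    apply le_of_eq; congr 2; ring
  have hS : s + 81 * n ^ 2 * Y * Λ ≤ Y * (1 + 81 * n ^ 2 * C3) * q ^ η := by
    calc s + 81 * n ^ 2 * Y * Λ ≤ Y * q ^ η + 81 * n ^ 2 * Y * (C3 * q ^ η) := by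
          gcongr
          nlinarith
      _ = _ := by ring
  set A := C1 * C2 * (1 + 81 * n ^ 2 * C3) * (6 * n / c ^ 2 + 3) ^ n with hA
  have hA0 : 0 ≤ A := by positivity
  have H2 : h * κ ^ 2 ≤ A * Y * q ^ (a + (3 + 2 * n) * η) := by
    calc h * κ ^ 2 ≤ h * s ^ 2 := by gcongr
      _ ≤ _ := H
      _ ≤ (C1 * q ^ (a + η)) * (C2 * q ^ η) * ((Y * (1 + 81 * n ^ 2 * C3) * q ^ η) *
          ((6 * n / c ^ 2 + 3) ^ n * q ^ (2 * n * η))) := by gcongr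
      _ = A * Y * (q ^ (a + η) * q ^ η * q ^ η * q ^ (2 * n * η)) := by rw [hA]; ring
      _ = _ := by
        rw [← Real.rpow_add hq0, ← Real.rpow_add hq0, ← Real.rpow_add hq0]
        congr 2; ring
  have H3 : h * (c ^ 2 * Y ^ 2) ≤ A * Y * q ^ (a + (5 + 2 * n) * η) := by
    rw [← hκ2]
    calc h * (κ ^ 2 * Z) = (h * κ ^ 2) * Z := by ring
      _ ≤ (A * Y * q ^ (a + (3 + 2 * n) * η)) * q ^ (2 * η) := by gcongr
      _ = _ := by rw [mul_assoc, ← Real.rpow_add hq0]; congr 2; ring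
  have e : q ^ (a - δ + (5 + 2 * n) * η) = q ^ (a + (5 + 2 * n) * η) / Y := by
    rw [hY, ← Real.rpow_sub hq0]; congr 1; ring
  rw [e]
  have : A / c ^ 2 * (q ^ (a + (5 + 2 * n) * η) / Y) = A * Y * q ^ (a + (5 + 2 * n) * η) / (c ^ 2 * Y ^ 2) := by
    field_simp
  rw [this, le_div_iff₀ (by positivity)]
  exact H3

/-- Polylogarithmic bound for the number of log-places. -/
lemma Llog (n : ℕ) (hn : 1 ≤ n) (η : ℝ) (hη : 0 < η) : ∃ C : ℝ, 1 ≤ C ∧ ∀ q : ℕ, q.Prime →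
    ∀ D Y L : ℝ, 1 ≤ D → D ≤ (n : ℝ) ^ n * (q : ℝ) ^ (n - 1) → 1 ≤ Y → Y ≤ q →
      L = n * Real.log ((2 ^ (n + 1)) ^ 2 * D) + 2 * n * Real.log Y →
      0 ≤ 2 * L + 3 ∧ (2 * L + 3) ^ n ≤ C * (q : ℝ) ^ η := by
  have hnR : (1 : ℝ) ≤ n := by exact_mod_cast hn
  set A : ℝ := (2 ^ (n + 1)) ^ 2 * (n : ℝ) ^ n with hA
  have hA1 : 1 ≤ A := one_le_mul_of_one_le_of_one_le (one_le_pow₀ (one_le_pow₀ (by norm_num))) (one_le_pow₀ hnR)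
  have hlA := Real.log_nonneg hA1
  obtain ⟨C, hC1, hC⟩ := polylog (2 * n * Real.log A + 3) (2 * n * (n + 2)) (by positivity) (by positivity) n η hη
  refine ⟨C, hC1, ?_⟩
  intro q hq D Y L hD1 hD hY1 hYq hL
  have hq1 : (1 : ℝ) ≤ q := by exact_mod_cast hq.one_lt.le
  have hq0 : (0 : ℝ) < q := by linarith
  have hlq := Real.log_nonneg hq1
  have hDD : (1 : ℝ) ≤ (2 ^ (n + 1)) ^ 2 * D :=
    one_le_mul_of_one_le_of_one_le (one_le_pow₀ (one_le_pow₀ (by norm_num))) hD1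
  have h1 := Real.log_nonneg hDD
  have h2 := Real.log_nonneg hY1
  have h3 : Real.log ((2 ^ (n + 1)) ^ 2 * D) ≤ Real.log A + n * Real.log q := by
    calc Real.log ((2 ^ (n + 1)) ^ 2 * D) ≤ Real.log (A * (q : ℝ) ^ n) := by
          apply Real.log_le_log (by linarith)
          rw [hA, mul_assoc]
          gcongr
          refine hD.trans ?_
          gcongr
          exact Nat.sub_le _ _
      _ = _ := by rw [Real.log_mul (by linarith) (by positivity), Real.log_pow]
  have h4 : Real.log Y ≤ Real.log q := Real.log_le_log (by linarith) hYq
  have hL0 : 0 ≤ 2 * L + 3 := by rw [hL]; positivity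
  refine ⟨hL0, ?_⟩
  refine (pow_le_pow_left₀ hL0 ?_ n).trans (hC q hq1)
  rw [hL]
  have g1 : (n : ℝ) * Real.log ((2 ^ (n + 1)) ^ 2 * D) ≤ n * (Real.log A + n * Real.log q) := by gcongr
  have g2 : (n : ℝ) * Real.log Y ≤ n * Real.log q := by gcongr
  linarith

lemma Λlog (n : ℕ) (hn : 1 ≤ n) (r0 : ℕ) (η : ℝ) (hη : 0 < η) : ∃ C : ℝ, 1 ≤ C ∧ ∀ q : ℕ, q.Prime →
    ∀ Y : ℝ, 1 ≤ Y → Y ≤ q → ∀ r ≤ r0, 0 ≤ (2 * Real.log ((3 * n * Y ^ 2) ^ n * (2 * q))) ^ r ∧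
      (2 * Real.log ((3 * n * Y ^ 2) ^ n * (2 * q))) ^ r ≤ C * (q : ℝ) ^ η := by
  have hnR : (1 : ℝ) ≤ n := by exact_mod_cast hn
  set A : ℝ := (3 * n) ^ n * 2 with hA
  have hA1 : 1 ≤ A := one_le_mul_of_one_le_of_one_le (one_le_pow₀ (by linarith)) (by norm_num)
  have hlA := Real.log_nonneg hA1
  obtain ⟨C, hC1, hC⟩ := polylog (2 * Real.log A + 1) (2 * (2 * n + 1)) (by positivity) (by positivity) r0 η hη
  refine ⟨C, hC1, ?_⟩
  intro q hq Y hY1 hYq r hr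
  have hq1 : (1 : ℝ) ≤ q := by exact_mod_cast hq.one_lt.le
  have hq0 : (0 : ℝ) < q := by linarith
  have hlq := Real.log_nonneg hq1
  have hB1 : (1 : ℝ) ≤ (3 * n * Y ^ 2) ^ n * (2 * q) := by
    refine one_le_mul_of_one_le_of_one_le (one_le_pow₀ ?_) (by linarith)
    exact one_le_mul_of_one_le_of_one_le (by linarith) (one_le_pow₀ hY1)
  have h1 := Real.log_nonneg hB1
  have h2 : Real.log ((3 * n * Y ^ 2) ^ n * (2 * q)) ≤ Real.log A + (2 * n + 1) * Real.log q := by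
    calc Real.log ((3 * n * Y ^ 2) ^ n * (2 * q)) ≤ Real.log (A * (q : ℝ) ^ (2 * n + 1)) := by
          apply Real.log_le_log (by linarith)
          calc (3 * n * Y ^ 2) ^ n * (2 * q) ≤ (3 * n * (q : ℝ) ^ 2) ^ n * (2 * q) := by gcongr
            _ = _ := by rw [hA, mul_pow]; ring
      _ = _ := by rw [Real.log_mul (by linarith) (by positivity), Real.log_pow]; push_cast; ring
  refine ⟨by positivity, ?_⟩
  refine le_trans ?_ (hC q hq1)
  have hge : 1 ≤ 2 * Real.log A + 1 + 2 * (2 * n + 1) * Real.log q := by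
    have : 0 ≤ 2 * (2 * n + 1) * Real.log q := by positivity
    linarith
  exact (pow_le_pow_left₀ (by positivity) (by linarith) r).trans (pow_le_pow_right₀ hge hr)

lemma torBd_odd (n : ℕ) (hn3 : 3 ≤ n) (hodd : Odd n) : TorBd n ((n : ℝ) / 2 - 7 / 6 + 1 / n) := by
  intro ε hε
  have hnR : (3 : ℝ) ≤ n := by exact_mod_cast hn3
  have hinv : (1 : ℝ) / n ≤ 1 / 3 := one_div_le_one_div_of_le (by norm_num) hnR
  have hinv0 : (0 : ℝ) < 1 / n := by positivity
  have hn1 : 1 ≤ n := by lia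
  set η : ℝ := min 1 (ε / (5 + 2 * n)) with hη
  have hη0 : 0 < η := lt_min one_pos (by positivity)
  have hη1 : η ≤ 1 := min_le_left _ _
  have hηε : (5 + 2 * n) * η ≤ ε := by
    have : η ≤ ε / (5 + 2 * n) := min_le_right _ _
    rw [le_div_iff₀ (by positivity)] at this
    linarith
  obtain ⟨r0, c, Y0, hc, hY0, hfam⟩ := family n hodd η hη0 hη1
  obtain ⟨C1, hC1, hX⟩ := Xlog n hn1 η hη0
  obtain ⟨C2, hC2, hL⟩ := Llog n hn1 η hη0
  obtain ⟨C3, hC3, hΛ⟩ := Λlog n hn1 r0 η hη0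
  obtain ⟨C0, hC0, htriv⟩ := torBd_triv n hn1 1 one_pos
  set B1 : ℝ := C1 * C2 * (1 + 81 * n ^ 2 * C3) * (6 * n / c ^ 2 + 3) ^ n / c ^ 2 with hB1
  set B2 : ℝ := C0 * (Y0 ^ 3) ^ (((n : ℝ) - 1) / 2 + 1) with hB2
  have hB10 : 0 ≤ B1 := by positivity
  have hB20 : 0 ≤ B2 := by positivity
  refine ⟨1 + B1 + B2, by linarith, ?_⟩
  intro q hq K _ _ hK θ hθ
  have hq1 : (1 : ℝ) ≤ q := by exact_mod_cast hq.one_lt.le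
  have hq0 : (0 : ℝ) < q := by linarith
  set δ : ℝ := (2 : ℝ) / 3 - 1 / n with hδ
  obtain ⟨Y, hY⟩ : ∃ Y : ℝ, Y = (q : ℝ) ^ δ := ⟨_, rfl⟩
  have hY1 : 1 ≤ Y := by rw [hY]; exact Real.one_le_rpow hq1 (by linarith)
  have hYq : Y ≤ q := by
    have := Real.rpow_le_rpow_of_exponent_le hq1 (by linarith : δ ≤ 1)
    rwa [Real.rpow_one, ← hY] at this
  by_cases hYY : Y0 ≤ Y
  · obtain ⟨r, P, hr, hP, hprod, hlow, hup⟩ := hfam Y hYY q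
    obtain ⟨𝒮, t, hcard, himg, hall⟩ := odd_family n q hodd hq P r hP
    have hD1 := one_le_abs_discr (K := K)
    have hDle := (discr_le hn1 hK hq hθ).1
    have hmain := h2_main hn1 hK hq hθ 𝒮 t Y hY1 (fun k hk => by
      obtain ⟨h1, h2, h3, h4, _, _⟩ := hall k hk
      obtain ⟨s, hs, rfl⟩ := himg k hk
      exact ⟨h1, h2, h3, h4, (hprod s hs).1⟩) _ _ rfl rfl
    have hκ0 : 0 < c * Y ^ (1 - η) := by positivity
    have hcount := count_main n q hn3 hq 𝒮 t r Y (c * Y ^ (1 - η)) hY hκ0 (fun k hk => by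
      obtain ⟨h1, h2, h3, h4, h5, h6⟩ := hall k hk
      obtain ⟨s, hs, rfl⟩ := himg k hk
      exact ⟨(hprod s hs).2, h5, h6, h3⟩)
    obtain ⟨hX1, hX2⟩ := hX q hq _ _ hD1 hDle rfl
    obtain ⟨hL1, hL2⟩ := hL q hq _ Y _ hD1 hDle hY1 hYq rfl
    obtain ⟨hΛ1, hΛ2⟩ := hΛ q hq Y hY1 hYq r hr
    have hXpos : 0 ≤ (2 ^ (n + 1) * Real.sqrt |(discr K : ℝ)|) *
        (1 + Real.log (2 ^ (n + 1) * Real.sqrt |(discr K : ℝ)|)) ^ n := by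
      have := Real.log_nonneg hX1
      positivity
    have hLpos := pow_nonneg hL1 n
    rw [← hcard] at hlow hup
    have hfinal := odd_real n q Y δ η c (c * Y ^ (1 - η)) 𝒮.card _ (((n : ℝ) - 1) / 2) C1 C2 C3 _ _ _
      hq1 (by linarith) (by linarith) hη0 hY hc rfl hlow hup (Nat.cast_nonneg _) hX2 hL2 hΛ2 hXpos hLpos hΛ1
      (by linarith) (by linarith) (by linarith)
      (hmain.trans (mul_le_mul_of_nonneg_left hcount (mul_nonneg hXpos hLpos)))
    refine hfinal.trans ?_
    have hexp : (q : ℝ) ^ (((n : ℝ) - 1) / 2 - δ + (5 + 2 * n) * η) ≤ (q : ℝ) ^ ((n : ℝ) / 2 - 7 / 6 + 1 / n + ε) := by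
      apply Real.rpow_le_rpow_of_exponent_le hq1
      rw [hδ]; linarith
    calc B1 * (q : ℝ) ^ (((n : ℝ) - 1) / 2 - δ + (5 + 2 * n) * η) ≤ B1 * (q : ℝ) ^ ((n : ℝ) / 2 - 7 / 6 + 1 / n + ε) := by
          gcongr
      _ ≤ _ := by
          gcongr
          linarith
  · push Not at hYY
    have hqY : (q : ℝ) ≤ Y0 ^ 3 := by
      have h1 : (q : ℝ) ^ ((1 : ℝ) / 3) ≤ Y0 := by
        refine le_trans ?_ hYY.le
        rw [hY]
        exact Real.rpow_le_rpow_of_exponent_le hq1 (by linarith)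
      calc (q : ℝ) = ((q : ℝ) ^ ((1 : ℝ) / 3)) ^ 3 := by
            rw [← Real.rpow_natCast, ← Real.rpow_mul hq0.le]; norm_num
        _ ≤ _ := by gcongr
    have h1 := htriv q hq K hK θ hθ
    refine h1.trans ?_
    have h2 : C0 * (q : ℝ) ^ (((n : ℝ) - 1) / 2 + 1) ≤ B2 := by
      rw [hB2]
      have : 0 ≤ ((n : ℝ) - 1) / 2 + 1 := by linarith
      gcongr
    have h3 : (1 : ℝ) ≤ (q : ℝ) ^ ((n : ℝ) / 2 - 7 / 6 + 1 / n + ε) := Real.one_le_rpow hq1 (by linarith)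
    have h4 : 1 + B1 + B2 ≤ (1 + B1 + B2) * (q : ℝ) ^ ((n : ℝ) / 2 - 7 / 6 + 1 / n + ε) :=
      le_mul_of_one_le_right (by linarith) h3
    linarith

end PureTwoTorsion


namespace PureTwoTorsion
open Finset nonZeroDivisors

section Abstract

variable {R S : Type} [CommRing R] [IsDedekindDomain R]
  [CommRing S] [IsDedekindDomain S] [Algebra R S]

lemma ideal_sq_inj {A B : Ideal S} (h : A ^ 2 = B ^ 2) : A = B :=
  (pow_left_inj two_ne_zero).1 h

/-- A class that can be written as `[J]` with `J ^ 2` generated by an element of the base, and descent data. -/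
def Good (R : Type) {S : Type} [CommRing R] [IsDedekindDomain R]
    [CommRing S] [IsDedekindDomain S] [Algebra R S] (z : R) (c : ClassGroup S) : Prop :=
  ∃ (J : (Ideal S)⁰) (g : R) (b r : (Ideal R)⁰), ClassGroup.mk0 J = c ∧ g ≠ 0 ∧
    (J : Ideal S) ^ 2 = Ideal.span {algebraMap R S g} ∧
    (b : Ideal R) ^ 2 = Ideal.span {g} * r ∧ (r : Ideal R) ∣ Ideal.span {z}

lemma card_sq_fibre (G : Type) [CommGroup G] [Finite G] (e : G) (s : Finset G) (hs : ∀ d ∈ s, d ^ 2 = e) :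
    s.card ≤ Nat.card {d : G // d ^ 2 = 1} := by
  classical
  rcases s.eq_empty_or_nonempty with rfl | ⟨d0, hd0⟩
  · simp
  · rw [← Nat.card_eq_finsetCard]
    refine Nat.card_le_card_of_injective
      (fun d : s => (⟨d.1 * d0⁻¹, by rw [mul_pow, hs _ d.2, inv_pow, hs _ hd0, mul_inv_cancel]⟩ : {d : G // d ^ 2 = 1})) ?_
    intro a b hab
    simp only [Subtype.mk.injEq, mul_left_inj] at hab
    exact Subtype.ext hab

lemma good_card [Finite (ClassGroup R)] (hinj : Function.Injective (algebraMap R S)) (z : R)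
    (D : Finset (Ideal R)) (hD : ∀ r : Ideal R, r ∣ Ideal.span {z} → r ∈ D)
    (s : Finset (ClassGroup S)) (hs : ∀ c ∈ s, Good R z c) :
    s.card ≤ Nat.card {d : ClassGroup R // d ^ 2 = 1} * D.card := by
  classical
  have hs' : ∀ c : ClassGroup S, ∃ (J : (Ideal S)⁰) (g : R) (b r : (Ideal R)⁰), c ∈ s → (ClassGroup.mk0 J = c ∧ g ≠ 0 ∧
    (J : Ideal S) ^ 2 = Ideal.span {algebraMap R S g} ∧
    (b : Ideal R) ^ 2 = Ideal.span {g} * r ∧ (r : Ideal R) ∣ Ideal.span {z}) := by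
    intro c
    by_cases h : c ∈ s
    · obtain ⟨J, g, b, r, h⟩ := hs c h
      exact ⟨J, g, b, r, fun _ => h⟩
    · exact ⟨1, 0, 1, 1, fun h' => absurd h' h⟩
  choose J g b r h using hs'
  refine card_le_mul_card_image_of_maps_to (f := fun c => (r c : Ideal R)) (t := D) (fun c hc => hD _ (h c hc).2.2.2.2) _ ?_
  intro r0 hr0
  rcases (s.filter (fun c => (r c : Ideal R) = r0)).eq_empty_or_nonempty with he | ⟨c0, hc0⟩
  · rw [he]; simp
  have hinjOn : Set.InjOn (fun c => ClassGroup.mk0 (b c)) (s.filter (fun c => (r c : Ideal R) = r0) : Finset (ClassGroup S)) := by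
    intro c hc c' hc' hbb
    obtain ⟨hcs, hcr⟩ := mem_filter.1 hc
    obtain ⟨hcs', hcr'⟩ := mem_filter.1 hc'
    obtain ⟨h1, h2, h3, h4, h5⟩ := h c hcs
    obtain ⟨h1', h2', h3', h4', h5'⟩ := h c' hcs'
    obtain ⟨x, y, hx, hy, hxy⟩ := ClassGroup.mk0_eq_mk0_iff.1 hbb
    have e1 : Ideal.map (algebraMap R S) (b c) * J c' = Ideal.map (algebraMap R S) (b c') * J c := by
      apply ideal_sq_inj
      rw [mul_pow, mul_pow, ← Ideal.map_pow, ← Ideal.map_pow, h4, h4', h3, h3', Ideal.map_mul, Ideal.map_mul,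
        Ideal.map_span, Ideal.map_span, Set.image_singleton, Set.image_singleton, hcr, hcr']
      ring
    have e2 := congrArg (Ideal.map (algebraMap R S)) hxy
    rw [Ideal.map_mul, Ideal.map_mul, Ideal.map_span, Ideal.map_span, Set.image_singleton, Set.image_singleton] at e2
    have hb0 : Ideal.map (algebraMap R S) (b c') ≠ 0 := by
      rw [Ne, Ideal.zero_eq_bot, Ideal.map_eq_bot_iff_of_injective hinj]
      exact nonZeroDivisors.coe_ne_zero (b c')
    rw [← h1, ← h1']
    refine ClassGroup.mk0_eq_mk0_iff.2 ⟨algebraMap R S x, algebraMap R S y,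
      (map_ne_zero_iff _ hinj).2 hx, (map_ne_zero_iff _ hinj).2 hy, ?_⟩
    apply mul_left_cancel₀ hb0
    calc Ideal.map (algebraMap R S) (b c') * (Ideal.span {algebraMap R S x} * J c)
        = Ideal.span {algebraMap R S x} * (Ideal.map (algebraMap R S) (b c') * J c) := by ring
      _ = Ideal.span {algebraMap R S x} * (Ideal.map (algebraMap R S) (b c)) * J c' := by rw [← e1]; ring
      _ = _ := by rw [e2]; ring
  rw [← card_image_of_injOn hinjOn]
  refine card_sq_fibre _ (ClassGroup.mk0 (r c0)) _ ?_
  intro d hd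
  obtain ⟨c, hc, rfl⟩ := mem_image.1 hd
  obtain ⟨hcs, hcr⟩ := mem_filter.1 hc
  obtain ⟨_, hcr0⟩ := mem_filter.1 hc0
  obtain ⟨h1, h2, h3, h4, h5⟩ := h c hcs
  rw [← map_pow]
  refine ClassGroup.mk0_eq_mk0_iff.2 ⟨1, g c, one_ne_zero, h2, ?_⟩
  rw [Ideal.span_singleton_one, Ideal.top_mul, hcr0, ← hcr, ← h4]
  rfl

lemma good_of_sq (ν : Ideal S →* Ideal R)
    (hνmap : ∀ I : Ideal R, ν (Ideal.map (algebraMap R S) I) = I ^ 2)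
    (σ : S →+* S) (hσR : ∀ x : R, σ (algebraMap R S x) = algebraMap R S x)
    (T : S → R) (hT : ∀ x, algebraMap R S (T x) = x + σ x)
    (θ : S) (φ : R) (hθ : θ ^ 2 = algebraMap R S φ) (hσθ : σ θ = -θ)
    (hinj : Function.Injective (algebraMap R S))
    (J : (Ideal S)⁰) (g : R) (hg : g ≠ 0) (hJ : (J : Ideal S) ^ 2 = Ideal.span {algebraMap R S g}) :
    Good R (4 * φ) (ClassGroup.mk0 J) := by
  classical
  obtain ⟨b, hbdef⟩ : ∃ b : Ideal R, b = Ideal.comap (algebraMap R S) (J : Ideal S) := ⟨_, rfl⟩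
  have hcancel : ∀ A B : Ideal R, Ideal.map (algebraMap R S) A ∣ Ideal.map (algebraMap R S) B → A ∣ B := by
    intro A B h
    have := map_dvd ν h
    rw [hνmap, hνmap] at this
    exact (UniqueFactorizationMonoid.pow_dvd_pow_iff_dvd two_ne_zero).1 this
  have hinv : Ideal.map σ (J : Ideal S) = J := by
    apply ideal_sq_inj
    rw [← Ideal.map_pow, hJ, Ideal.map_span, Set.image_singleton, hσR]
  have hσJ : ∀ z ∈ (J : Ideal S), σ z ∈ (J : Ideal S) := fun z hz => by
    have := Ideal.mem_map_of_mem σ hz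
    rwa [hinv] at this
  have hTJ : ∀ z ∈ (J : Ideal S), T z ∈ b := fun z hz => by
    rw [hbdef, Ideal.mem_comap, hT]
    exact add_mem hz (hσJ z hz)
  have hmb : Ideal.map (algebraMap R S) b ≤ J := by
    rw [hbdef]; exact Ideal.map_comap_le
  have hle : Ideal.span {2 * θ} * (J : Ideal S) ≤ Ideal.map (algebraMap R S) b := by
    rw [Ideal.span_singleton_mul_le_iff]
    intro z hz
    have e : 2 * θ * z = algebraMap R S (T z) * θ + algebraMap R S (T (z * θ)) := by
      rw [hT, hT, map_mul, hσθ]; ring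
    rw [e]
    exact add_mem (Ideal.mul_mem_right _ _ (Ideal.mem_map_of_mem _ (hTJ z hz)))
      (Ideal.mem_map_of_mem _ (hTJ _ (Ideal.mul_mem_right _ _ hz)))
  have hgb : Ideal.span {g} ∣ b ^ 2 := by
    apply hcancel
    rw [Ideal.map_span, Set.image_singleton, ← hJ, Ideal.map_pow]
    exact pow_dvd_pow_of_dvd (Ideal.dvd_iff_le.2 hmb) 2
  have hbg : b ^ 2 ∣ Ideal.span {g} * Ideal.span {4 * φ} := by
    apply hcancel
    have h1 := pow_dvd_pow_of_dvd (Ideal.dvd_iff_le.2 hle) 2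
    rw [mul_pow, hJ, Ideal.span_singleton_pow] at h1
    rw [Ideal.map_mul, Ideal.map_span, Ideal.map_span, Set.image_singleton, Set.image_singleton, Ideal.map_pow]
    have e : algebraMap R S (4 * φ) = (2 * θ) ^ 2 := by
      rw [map_mul, ← hθ, map_ofNat]; ring
    rw [e, mul_comm (Ideal.span {algebraMap R S g})]
    exact h1
  have hspan : Ideal.span {g} ≠ 0 := by
    rw [Ne, Ideal.zero_eq_bot, Ideal.span_singleton_eq_bot]; exact hg
  have hb0 : b ≠ 0 := by
    intro h0
    have : g ∈ b := by
      rw [hbdef, Ideal.mem_comap]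
      have h1 : algebraMap R S g ∈ (J : Ideal S) ^ 2 := by
        rw [hJ]; exact Ideal.mem_span_singleton_self _
      exact Ideal.pow_le_self two_ne_zero h1
    rw [h0] at this
    exact hg (by simpa using this)
  obtain ⟨r, hr⟩ := hgb
  have hr0 : r ≠ 0 := by
    rintro rfl
    rw [mul_zero] at hr
    exact hb0 (pow_eq_zero_iff two_ne_zero |>.1 hr)
  refine ⟨J, g, ⟨b, mem_nonZeroDivisors_of_ne_zero hb0⟩, ⟨r, mem_nonZeroDivisors_of_ne_zero hr0⟩, rfl, hg, hJ, hr, ?_⟩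
  rw [hr] at hbg
  exact (mul_dvd_mul_iff_left hspan).1 hbg

lemma good_of_norm (ν : Ideal S →* Ideal R)
    (hνmap : ∀ I : Ideal R, ν (Ideal.map (algebraMap R S) I) = I ^ 2)
    (σ : S →+* S) (hσR : ∀ x : R, σ (algebraMap R S x) = algebraMap R S x)
    (T : S → R) (hT : ∀ x, algebraMap R S (T x) = x + σ x)
    (θ : S) (φ : R) (hθ : θ ^ 2 = algebraMap R S φ) (hσθ : σ θ = -θ)
    (hinj : Function.Injective (algebraMap R S))
    (J : (Ideal S)⁰) (α : S) (hα : α ≠ 0) (hJ : (J : Ideal S) ^ 2 = Ideal.span {α})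
    (b : R) (hb : algebraMap R S b ^ 2 = α * σ α) :
    Good R (4 * φ) (ClassGroup.mk0 J) := by
  classical
  by_cases hab : α + algebraMap R S b = 0
  · have h1 : α = algebraMap R S (-b) := by rw [map_neg]; exact eq_neg_of_add_eq_zero_left hab
    refine good_of_sq ν hνmap σ hσR T hT θ φ hθ hσθ hinj J (-b) ?_ (by rw [hJ, h1])
    intro h0
    rw [h0, map_zero] at h1
    exact hα h1
  · obtain ⟨β, hβ⟩ : ∃ β, β = α + algebraMap R S b := ⟨_, rfl⟩
    rw [← hβ] at hab
    obtain ⟨g, hgdef⟩ : ∃ g : R, g = T α + 2 * b := ⟨_, rfl⟩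
    have hg : algebraMap R S g * α = β ^ 2 := by
      rw [hgdef, hβ, map_add, hT, map_mul, map_ofNat, add_sq, hb]; ring
    have hg0 : g ≠ 0 := by
      rintro rfl
      rw [map_zero, zero_mul] at hg
      exact hab (pow_eq_zero_iff two_ne_zero |>.1 hg.symm)
    have hdvd : (J : Ideal S) ∣ Ideal.span {β} := by
      apply (UniqueFactorizationMonoid.pow_dvd_pow_iff_dvd two_ne_zero).1
      rw [hJ, Ideal.span_singleton_pow, ← hg]
      exact ⟨Ideal.span {algebraMap R S g}, by rw [Ideal.span_singleton_mul_span_singleton, mul_comm]⟩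
    obtain ⟨J', hJ'⟩ := hdvd
    have hβ0 : Ideal.span {β} ≠ 0 := by
      rw [Ne, Ideal.zero_eq_bot, Ideal.span_singleton_eq_bot]; exact hab
    have hJ0 : J' ≠ 0 := by
      rintro rfl
      rw [mul_zero] at hJ'
      exact hβ0 hJ'
    have hα0 : Ideal.span {α} ≠ 0 := by
      rw [Ne, Ideal.zero_eq_bot, Ideal.span_singleton_eq_bot]; exact hα
    have hJ2 : J' ^ 2 = Ideal.span {algebraMap R S g} := by
      apply mul_left_cancel₀ hα0
      rw [← hJ, ← mul_pow, ← hJ', hJ, Ideal.span_singleton_pow, ← hg, Ideal.span_singleton_mul_span_singleton, mul_comm]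
    have hcl : ClassGroup.mk0 J = ClassGroup.mk0 ⟨J', mem_nonZeroDivisors_of_ne_zero hJ0⟩ := by
      refine ClassGroup.mk0_eq_mk0_iff.2 ⟨β, α, hab, hα, ?_⟩
      rw [← hJ, hJ']
      simp only
      ring
    rw [hcl]
    exact good_of_sq ν hνmap σ hσR T hT θ φ hθ hσθ hinj _ g hg0 hJ2

end Abstract

end PureTwoTorsion


namespace PureTwoTorsion
open Finset nonZeroDivisors

section Abstract

variable {R S : Type} [CommRing R] [IsDedekindDomain R]
  [CommRing S] [IsDedekindDomain S] [Algebra R S]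

lemma two_torsion_rep (c : ClassGroup S) (hc : c ^ 2 = 1) :
    ∃ (I : (Ideal S)⁰) (α : S), ClassGroup.mk0 I = c ∧ (I : Ideal S) ^ 2 = Ideal.span {α} ∧ α ≠ 0 := by
  obtain ⟨I, rfl⟩ := ClassGroup.mk0_surjective c
  rw [← map_pow, ClassGroup.mk0_eq_one_iff] at hc
  obtain ⟨α, hα⟩ := hc.principal
  have h2 : (I : Ideal S) ^ 2 = Ideal.span {α} := hα
  refine ⟨I, α, rfl, h2, ?_⟩
  rintro rfl
  rw [Ideal.span_singleton_zero] at h2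
  exact nonZeroDivisors.coe_ne_zero I (pow_eq_zero_iff two_ne_zero |>.1 h2)

lemma sq_of_mul_sq {A s t : R} (hs : s ≠ 0) (h : A * s ^ 2 = t ^ 2) : ∃ b, A = b ^ 2 := by
  have hd : s ∣ t := (IsIntegrallyClosed.pow_dvd_pow_iff two_ne_zero).1 ⟨A, by rw [← h, mul_comm]⟩
  obtain ⟨b, rfl⟩ := hd
  refine ⟨b, mul_right_cancel₀ (pow_ne_zero 2 hs) ?_⟩
  rw [h]; ring

theorem abstract_count [Finite (ClassGroup R)] [Finite (ClassGroup S)] (ν : Ideal S →* Ideal R)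
    (hνmap : ∀ I : Ideal R, ν (Ideal.map (algebraMap R S) I) = I ^ 2)
    (σ : S →+* S) (hσR : ∀ x : R, σ (algebraMap R S x) = algebraMap R S x)
    (T : S → R) (hT : ∀ x, algebraMap R S (T x) = x + σ x)
    (N : S → R) (hN : ∀ x, algebraMap R S (N x) = x * σ x)
    (hνN : ∀ x, ν (Ideal.span {x}) = Ideal.span {N x})
    (θ : S) (φ : R) (hθ : θ ^ 2 = algebraMap R S φ) (hσθ : σ θ = -θ)
    (hinj : Function.Injective (algebraMap R S)) (hσinj : Function.Injective σ)
    (ι : Type) [Fintype ι] (κ : Rˣ → ι) (hκ : ∀ u v, κ u = κ v → ∃ w, u * v = w ^ 2)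
    (D : Finset (Ideal R)) (hD : ∀ r : Ideal R, r ∣ Ideal.span {4 * φ} → r ∈ D) :
    Nat.card {c : ClassGroup S // c ^ 2 = 1} ≤
      Nat.card {d : ClassGroup R // d ^ 2 = 1} * D.card * Fintype.card ι * Nat.card {d : ClassGroup R // d ^ 2 = 1} := by
  classical
  have := Fintype.ofFinite (ClassGroup R)
  have := Fintype.ofFinite (ClassGroup S)
  have hNmul : ∀ x y, N (x * y) = N x * N y := by
    intro x y
    apply hinj
    rw [map_mul, hN, hN, hN, map_mul]; ring
  have hN0 : ∀ x, x ≠ 0 → N x ≠ 0 := by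
    intro x hx h0
    have := hN x
    rw [h0, map_zero] at this
    rcases mul_eq_zero.1 this.symm with h | h
    · exact hx h
    · exact hx ((map_eq_zero_iff σ hσinj).1 h)
  have hrep : ∀ c : ClassGroup S, ∃ (I : (Ideal S)⁰) (α : S), c ^ 2 = 1 →
      (ClassGroup.mk0 I = c ∧ (I : Ideal S) ^ 2 = Ideal.span {α} ∧ α ≠ 0) := by
    intro c
    by_cases h : c ^ 2 = 1
    · obtain ⟨I, α, h⟩ := two_torsion_rep c h
      exact ⟨I, α, fun _ => h⟩
    · exact ⟨1, 0, fun h' => absurd h' h⟩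
  choose I α hI using hrep
  have hνsq : ∀ c, c ^ 2 = 1 → (ν (I c)) ^ 2 = Ideal.span {N (α c)} := by
    intro c hc
    rw [← map_pow, (hI c hc).2.1, hνN]
  have hν0 : ∀ c, c ^ 2 = 1 → ν (I c) ≠ 0 := by
    intro c hc h0
    have := hνsq c hc
    rw [h0, zero_pow two_ne_zero, eq_comm, Ideal.zero_eq_bot, Ideal.span_singleton_eq_bot] at this
    exact hN0 _ (hI c hc).2.2 this
  have hA : ∀ c, ∃ A : (Ideal R)⁰, c ^ 2 = 1 → (A : Ideal R) = ν (I c) := by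
    intro c
    by_cases h : c ^ 2 = 1
    · exact ⟨⟨ν (I c), mem_nonZeroDivisors_of_ne_zero (hν0 c h)⟩, fun _ => rfl⟩
    · exact ⟨1, fun h' => absurd h' h⟩
  choose A hA using hA
  have e1 : Nat.card {c : ClassGroup S // c ^ 2 = 1} = (univ.filter (fun c : ClassGroup S => c ^ 2 = 1)).card := by
    rw [Nat.card_eq_fintype_card, Fintype.card_subtype]
  have e2 : Nat.card {c : ClassGroup R // c ^ 2 = 1} = (univ.filter (fun c : ClassGroup R => c ^ 2 = 1)).card := by
    rw [Nat.card_eq_fintype_card, Fintype.card_subtype]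
  rw [e1]
  nth_rewrite 2 [e2]
  refine card_le_mul_card_image_of_maps_to (f := fun c => ClassGroup.mk0 (A c)) ?_ _ ?_
  · intro c hc
    have hc := (mem_filter.1 hc).2
    refine mem_filter.2 ⟨mem_univ _, ?_⟩
    rw [← map_pow, ClassGroup.mk0_eq_one_iff]
    refine ⟨N (α c), ?_⟩
    have h3 := hνsq c hc
    rw [← hA c hc] at h3
    exact h3
  intro d hd
  set s := (univ.filter (fun c : ClassGroup S => c ^ 2 = 1)).filter (fun c => ClassGroup.mk0 (A c) = d) with hs
  have hs1 : ∀ c ∈ s, c ^ 2 = 1 := fun c hc => (mem_filter.1 (mem_filter.1 hc).1).2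
  have hs2 : ∀ c ∈ s, ClassGroup.mk0 (A c) = d := fun c hc => (mem_filter.1 hc).2
  rcases s.eq_empty_or_nonempty with he | ⟨c0, hc0⟩
  · rw [he]; simp
  have hu : ∀ c, ∃ (u : Rˣ) (x y : R), c ∈ s → (x ≠ 0 ∧ N (α c) * x ^ 2 = u * N (α c0) * y ^ 2) := by
    intro c
    by_cases h : c ∈ s
    · obtain ⟨x, y, hx, hy, hxy⟩ := ClassGroup.mk0_eq_mk0_iff.1 ((hs2 c h).trans (hs2 c0 hc0).symm)
      rw [hA c (hs1 c h), hA c0 (hs1 c0 hc0)] at hxy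
      have h2 := congrArg (· ^ 2) hxy
      simp only [mul_pow] at h2
      rw [hνsq c (hs1 c h), hνsq c0 (hs1 c0 hc0), Ideal.span_singleton_pow, Ideal.span_singleton_pow,
        Ideal.span_singleton_mul_span_singleton, Ideal.span_singleton_mul_span_singleton,
        Ideal.span_singleton_eq_span_singleton] at h2
      obtain ⟨u, hu⟩ := h2.symm
      exact ⟨u, x, y, fun _ => ⟨hx, by rw [mul_comm (N (α c)), ← hu]; ring⟩⟩
    · exact ⟨1, 0, 0, fun h' => absurd h' h⟩
  choose u x y hu using hu
  rw [← Finset.card_univ (α := ι)]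
  refine card_le_mul_card_image_of_maps_to (f := fun c => κ (u c)) (fun _ _ => mem_univ _) _ ?_
  intro i _
  rcases (s.filter (fun c => κ (u c) = i)).eq_empty_or_nonempty with he | ⟨c1, hc1⟩
  · rw [he]; simp
  obtain ⟨hc1s, hc1i⟩ := mem_filter.1 hc1
  rw [← card_image_of_injective _ (mul_left_injective c1)]
  refine good_card hinj (4 * φ) D hD _ ?_
  intro c' hc'
  obtain ⟨c, hc, rfl⟩ := mem_image.1 hc'
  obtain ⟨hcs, hci⟩ := mem_filter.1 hc
  obtain ⟨g1, g2, g3⟩ := hI c (hs1 c hcs)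
  obtain ⟨k1, k2, k3⟩ := hI c1 (hs1 c1 hc1s)
  obtain ⟨w, hw⟩ := hκ (u c) (u c1) (hci.trans hc1i.symm)
  obtain ⟨hx, hxy⟩ := hu c hcs
  obtain ⟨hx1, hxy1⟩ := hu c1 hc1s
  have hw' : (u c : R) * (u c1 : R) = (w : R) ^ 2 := by exact_mod_cast congrArg Units.val hw
  obtain ⟨b, hb⟩ : ∃ b, N (α c) * N (α c1) = b ^ 2 := by
    refine sq_of_mul_sq (mul_ne_zero hx hx1) (t := w * N (α c0) * (y c * y c1)) ?_
    calc N (α c) * N (α c1) * (x c * x c1) ^ 2 = (N (α c) * x c ^ 2) * (N (α c1) * x c1 ^ 2) := by ring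
      _ = ((u c : R) * (u c1 : R)) * (N (α c0)) ^ 2 * (y c * y c1) ^ 2 := by rw [hxy, hxy1]; ring
      _ = _ := by rw [hw']; ring
  have hcc : c * c1 = ClassGroup.mk0 (I c * I c1) := by rw [map_mul, g1, k1]
  rw [hcc]
  refine good_of_norm ν hνmap σ hσR T hT θ φ hθ hσθ hinj _ (α c * α c1) (mul_ne_zero g3 k3) ?_ b ?_
  · rw [Submonoid.coe_mul, mul_pow, g2, k2, Ideal.span_singleton_mul_span_singleton]
  · rw [← hN, hNmul, hb, map_pow]

end Abstract

end PureTwoTorsion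


namespace PureTwoTorsion
open NumberField Finset

lemma unit_key (F : Type) [Field F] [NumberField F] :
    ∃ κ : (𝓞 F)ˣ → (ZMod 2 × (Fin (Units.rank F) → ZMod 2)), ∀ u v, κ u = κ v → ∃ w, u * v = w ^ 2 := by
  obtain ⟨ζ, hζ⟩ := IsCyclic.exists_generator (α := Units.torsion F)
  have h : ∀ u : (𝓞 F)ˣ, ∃ (k : ℤ) (e : Fin (Units.rank F) → ℤ),
      u = (ζ : (𝓞 F)ˣ) ^ k * ∏ i, (Units.fundSystem F i) ^ (e i) := by
    intro u
    obtain ⟨⟨z, e⟩, hu, _⟩ := Units.exist_unique_eq_mul_prod F u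
    obtain ⟨k, hk⟩ := Subgroup.mem_zpowers_iff.1 (hζ z)
    refine ⟨k, e, ?_⟩
    rw [hu, ← hk]; rfl
  choose k e hu using h
  refine ⟨fun u => (k u, fun i => (e u i : ZMod 2)), ?_⟩
  intro u v huv
  have h1 : ((k u : ℤ) : ZMod 2) = (k v : ℤ) := congrArg Prod.fst huv
  have h2 : ∀ i, ((e u i : ℤ) : ZMod 2) = (e v i : ℤ) := fun i => congrFun (congrArg Prod.snd huv) i
  have half : ∀ a b : ℤ, ((a : ℤ) : ZMod 2) = b → ∃ c, a + b = 2 * c := by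
    intro a b hab
    rw [ZMod.intCast_eq_intCast_iff_dvd_sub] at hab
    obtain ⟨d, hd⟩ := hab
    exact ⟨a + d, by push_cast at hd; linarith⟩
  obtain ⟨c, hc⟩ := half _ _ h1
  choose f hf using fun i => half _ _ (h2 i)
  refine ⟨(ζ : (𝓞 F)ˣ) ^ c * ∏ i, (Units.fundSystem F i) ^ (f i), ?_⟩
  rw [hu u, hu v, mul_pow, ← Finset.prod_pow, mul_mul_mul_comm, ← zpow_add, hc, ← Finset.prod_mul_distrib]
  congr 1
  · rw [mul_comm, zpow_mul]; rfl
  · refine Finset.prod_congr rfl (fun i _ => ?_)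
    rw [← zpow_add, hf i, mul_comm, zpow_mul]; rfl

lemma card_unit_key (F : Type) [Field F] [NumberField F] {m : ℕ} (hm : Module.finrank ℚ F = m) :
    Fintype.card (ZMod 2 × (Fin (Units.rank F) → ZMod 2)) ≤ 2 ^ m := by
  rw [Fintype.card_prod, ZMod.card, Fintype.card_fun, ZMod.card, Fintype.card_fin, ← pow_succ']
  apply Nat.pow_le_pow_right (by norm_num)
  have h1 : Fintype.card (InfinitePlace F) ≤ m := card_places_le hm
  have h2 : 0 < Fintype.card (InfinitePlace F) := Fintype.card_pos
  unfold Units.rank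
  lia

section Quad
variable {F K : Type} [Field F] [NumberField F] [Field K] [NumberField K] [Algebra F K]

lemma exists_conj (h2 : Module.finrank F K = 2) (θ : 𝓞 K) (φ : 𝓞 F) (hθ : θ ^ 2 = algebraMap (𝓞 F) (𝓞 K) φ)
    (hnot : ∀ x : F, algebraMap F K x ≠ θ) :
    ∃ σ : K ≃ₐ[F] K, σ (θ : K) = -(θ : K) ∧ (∀ x, algebraMap F K (Algebra.norm F x) = x * σ x) ∧
      (∀ x, algebraMap F K (Algebra.trace F K x) = x + σ x) := by
  classical
  have hq : Algebra.IsQuadraticExtension F K := { finrank_eq_two' := h2 }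
  have hgal : IsGalois F K := inferInstance
  have hex : ∃ σ : K ≃ₐ[F] K, σ (θ : K) ≠ θ := by
    by_contra hcon
    push Not at hcon
    obtain ⟨x, hx⟩ := IntermediateField.mem_bot.1 ((IsGalois.mem_bot_iff_fixed (F := F) (θ : K)).2 hcon)
    exact hnot x hx
  obtain ⟨σ, hσ⟩ := hex
  have hθK : (θ : K) ^ 2 = algebraMap F K (φ : F) := by
    have := congrArg (algebraMap (𝓞 K) K) hθ
    rw [map_pow] at this
    rw [this]; rfl
  have huniv : (univ : Finset (K ≃ₐ[F] K)) = {1, σ} := by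
    symm
    apply Finset.eq_univ_of_card
    have hne : (1 : K ≃ₐ[F] K) ≠ σ := by
      rintro rfl; exact hσ rfl
    rw [card_pair hne, ← Nat.card_eq_fintype_card, IsGalois.card_aut_eq_finrank, h2]
  have hne : (1 : K ≃ₐ[F] K) ≠ σ := by
    rintro rfl; exact hσ rfl
  refine ⟨σ, ?_, ?_, ?_⟩
  · have : (σ (θ : K)) ^ 2 = (θ : K) ^ 2 := by rw [← map_pow, hθK, AlgEquiv.commutes]
    exact (sq_eq_sq_iff_eq_or_eq_neg.1 this).resolve_left hσ
  · intro x
    rw [Algebra.norm_eq_prod_automorphisms, huniv, prod_pair hne]; rfl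
  · intro x
    rw [trace_eq_sum_automorphisms, huniv, sum_pair hne]; rfl

lemma quad_count (h2 : Module.finrank F K = 2) (θ : 𝓞 K) (φ : 𝓞 F) (hθ : θ ^ 2 = algebraMap (𝓞 F) (𝓞 K) φ)
    (hnot : ∀ x : F, algebraMap F K x ≠ θ) {m : ℕ} (hm : Module.finrank ℚ F = m)
    (D : Finset (Ideal (𝓞 F))) (hD : ∀ r : Ideal (𝓞 F), r ∣ Ideal.span {4 * φ} → r ∈ D) :
    Nat.card {c : ClassGroup (𝓞 K) // c ^ 2 = 1} ≤
      Nat.card {d : ClassGroup (𝓞 F) // d ^ 2 = 1} * D.card * 2 ^ m * Nat.card {d : ClassGroup (𝓞 F) // d ^ 2 = 1} := by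
  obtain ⟨σ, hσθ, hN, hT⟩ := exists_conj h2 θ φ hθ hnot
  obtain ⟨κ, hκ⟩ := unit_key F
  have hinjF : Function.Injective (algebraMap (𝓞 K) K) := RingOfIntegers.coe_injective
  have hfr : Module.finrank (𝓞 F) (𝓞 K) = 2 := by
    rw [← IsFractionRing.finrank_eq (𝓞 F) F (𝓞 K) K, h2]
  have hcomp : ∀ x : 𝓞 F, algebraMap (𝓞 K) K (algebraMap (𝓞 F) (𝓞 K) x) = algebraMap F K (algebraMap (𝓞 F) F x) :=
    fun x => rfl
  refine (abstract_count (R := 𝓞 F) (S := 𝓞 K) (Ideal.relNorm (𝓞 F)).toMonoidHom ?_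
    (RingOfIntegers.mapRingHom (σ : K →+* K)) ?_ (Algebra.intTrace (𝓞 F) (𝓞 K)) ?_ (Algebra.intNorm (𝓞 F) (𝓞 K)) ?_ ?_
    θ φ hθ ?_ ?_ ?_ _ κ hκ D hD).trans ?_
  · intro I
    exact (Ideal.relNorm_algebraMap (𝓞 K) I).trans (by rw [hfr])
  · intro x
    apply hinjF
    rw [hcomp]
    exact σ.commutes _
  · intro x
    apply hinjF
    rw [hcomp, Algebra.algebraMap_intTrace (L := K), hT]
    rfl
  · intro x
    apply hinjF
    rw [hcomp, Algebra.algebraMap_intNorm (L := K), hN]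
    rfl
  · intro x
    exact Ideal.relNorm_singleton (𝓞 F) x
  · apply hinjF
    rw [map_neg]
    exact hσθ
  · intro x y hxy
    have := congrArg (algebraMap (𝓞 K) K) hxy
    rw [hcomp, hcomp] at this
    exact RingOfIntegers.coe_injective ((algebraMap F K).injective this)
  · intro x y hxy
    apply hinjF
    exact σ.injective (congrArg (algebraMap (𝓞 K) K) hxy)
  · have := card_unit_key F hm
    gcongr

end Quad

end PureTwoTorsion


namespace PureTwoTorsion
open NumberField Finset

lemma exists_divisors {F : Type} [Field F] [NumberField F] {m q : ℕ} (hm1 : 1 ≤ m) (hF : Module.finrank ℚ F = m)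
    (hq : q.Prime) {φ : 𝓞 F} (hφ : φ ^ m = (q : 𝓞 F)) :
    ∃ D : Finset (Ideal (𝓞 F)), (∀ r : Ideal (𝓞 F), r ∣ Ideal.span {4 * φ} → r ∈ D) ∧
      (D.card : ℝ) ≤ 4 ^ m * (1 + Real.log (4 ^ m)) ^ m * 2 := by
  classical
  have hnq : Ideal.absNorm (Ideal.span {φ}) = q := by
    rw [Ideal.absNorm_span_singleton]
    have hφF : (φ : F) ^ m = q := by
      have := congrArg (algebraMap (𝓞 F) F) hφ
      rwa [map_pow, map_natCast] at this
    have h := natAbs_norm_theta hm1 hF hφF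
    rw [← Algebra.coe_norm_int, ← Int.cast_abs] at h
    have h' : |Algebra.norm ℤ φ| = (q : ℤ) := by exact_mod_cast h
    rw [Int.abs_eq_natAbs] at h'
    exact_mod_cast h'
  have hn4 : Ideal.absNorm (Ideal.span {(4 : 𝓞 F)}) = 4 ^ m := by
    rw [Ideal.absNorm_span_singleton]
    have : (4 : 𝓞 F) = algebraMap ℤ (𝓞 F) 4 := by simp
    rw [this, Algebra.norm_algebraMap, RingOfIntegers.rank, hF, Int.natAbs_pow]
    rfl
  refine ⟨((idealsLE F ⌊((4 : ℝ) ^ m)⌋₊) ×ˢ ({⊤, Ideal.span {φ}} : Finset (Ideal (𝓞 F)))).image (fun p => p.1 * p.2), ?_, ?_⟩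
  · intro r hr
    rw [← Ideal.span_singleton_mul_span_singleton] at hr
    obtain ⟨a, b, ha, hb, rfl⟩ := exists_dvd_and_dvd_of_dvd_mul hr
    have hda : Ideal.absNorm a ∣ 4 ^ m := hn4 ▸ map_dvd Ideal.absNorm ha
    refine mem_image.2 ⟨(a, b), mem_product.2 ⟨mem_idealsLE.2 ⟨?_, ?_⟩, ?_⟩, rfl⟩
    · rintro rfl
      rw [Ideal.absNorm_bot] at hda
      have := Nat.eq_zero_of_zero_dvd hda
      exact absurd this (by positivity)
    · have h1 := Nat.le_of_dvd (by positivity) hda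
      refine h1.trans (Nat.le_floor ?_)
      push_cast; exact le_rfl
    · obtain ⟨c, hc⟩ := hb
      have hN : Ideal.absNorm b * Ideal.absNorm c = q := by rw [← map_mul, ← hc, hnq]
      rcases (Nat.dvd_prime hq).1 ⟨_, hN.symm⟩ with h | h
      · have hbt : b = ⊤ := Ideal.absNorm_eq_one_iff.1 h
        simp [hbt]
      · have hc1 : Ideal.absNorm c = 1 := by
          rw [h] at hN
          exact Nat.eq_of_mul_eq_mul_left hq.pos (by rw [hN, mul_one])
        have hct : c = ⊤ := Ideal.absNorm_eq_one_iff.1 hc1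
        rw [hct, Ideal.mul_top] at hc
        simp [hc]
  · have h4 : (1 : ℝ) ≤ 4 ^ m := one_le_pow₀ (by norm_num)
    have h1 := card_idealsLE hF ((4 : ℝ) ^ m) h4
    have h2 : (({⊤, Ideal.span {φ}} : Finset (Ideal (𝓞 F))).card : ℝ) ≤ 2 := by exact_mod_cast card_le_two
    refine le_trans (Nat.cast_le.2 card_image_le) ?_
    rw [card_product]
    push_cast
    exact mul_le_mul h1 h2 (Nat.cast_nonneg _) ((Nat.cast_nonneg _).trans h1)

lemma even_step {m q : ℕ} (hm : 1 ≤ m) (hq : q.Prime) (K : Type) [Field K] [NumberField K]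
    (hK : Module.finrank ℚ K = 2 * m) (θ : 𝓞 K) (hθ : θ ^ (2 * m) = (q : 𝓞 K)) :
    ∃ (F : Type) (_ : Field F) (_ : NumberField F) (φ : 𝓞 F), Module.finrank ℚ F = m ∧ φ ^ m = (q : 𝓞 F) ∧
      (Nat.card {c : ClassGroup (𝓞 K) // c ^ 2 = 1} : ℝ) ≤
        (4 ^ m * (1 + Real.log (4 ^ m)) ^ m * 2 * 2 ^ m) * (Nat.card {d : ClassGroup (𝓞 F) // d ^ 2 = 1} : ℝ) *
          (Nat.card {d : ClassGroup (𝓞 F) // d ^ 2 = 1} : ℝ) := by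
  have hθK : (θ : K) ^ (2 * m) = q := by
    have := congrArg (algebraMap (𝓞 K) K) hθ
    rwa [map_pow, map_natCast] at this
  have hintg : IsIntegral ℚ ((θ : K) ^ 2) := Algebra.IsIntegral.isIntegral _
  have hsq : ((θ : K) ^ 2) ^ m = q := by rw [← pow_mul, hθK]
  have hF : Module.finrank ℚ (IntermediateField.adjoin ℚ {(θ : K) ^ 2}) = m := by
    rw [IntermediateField.adjoin.finrank hintg, minpoly_theta hm hq hsq]
    exact Polynomial.natDegree_X_pow_sub_C
  have hmem : (θ : K) ^ 2 ∈ IntermediateField.adjoin ℚ {(θ : K) ^ 2} := IntermediateField.mem_adjoin_simple_self _ _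
  have h2 : Module.finrank (IntermediateField.adjoin ℚ {(θ : K) ^ 2}) K = 2 := by
    have := Module.finrank_mul_finrank ℚ (IntermediateField.adjoin ℚ {(θ : K) ^ 2}) K
    rw [hF, hK, mul_comm] at this
    exact Nat.eq_of_mul_eq_mul_right hm this
  generalize hFF : IntermediateField.adjoin ℚ {(θ : K) ^ 2} = F at hF hmem h2
  have hphi : IsIntegral ℤ (⟨(θ : K) ^ 2, hmem⟩ : F) := by
    have h1 : IsIntegral ℤ ((θ : K) ^ 2) := θ.isIntegral_coe.pow 2
    exact (isIntegral_algHom_iff (F.val.restrictScalars ℤ) Subtype.val_injective).1 h1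
  refine ⟨F, inferInstance, inferInstance, ⟨⟨(θ : K) ^ 2, hmem⟩, hphi⟩, hF, ?_, ?_⟩
  · apply RingOfIntegers.coe_injective
    apply Subtype.val_injective
    exact hsq
  · obtain ⟨D, hD, hDc⟩ := exists_divisors (F := F) hm hF hq (φ := ⟨⟨(θ : K) ^ 2, hmem⟩, hphi⟩) (by
      apply RingOfIntegers.coe_injective
      apply Subtype.val_injective
      exact hsq)
    have := quad_count (F := F) (K := K) h2 θ ⟨⟨(θ : K) ^ 2, hmem⟩, hphi⟩ (by
      apply RingOfIntegers.coe_injective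
      rfl) (by
      intro x hx
      have hx2 : x ^ (2 * m) = (q : F) := by
        apply (algebraMap F K).injective
        rw [map_pow, hx, hθK, map_natCast]
      have hmin := minpoly_theta (K := F) (by lia) hq hx2
      have hle := minpoly.natDegree_le (A := ℚ) x
      rw [hmin, Polynomial.natDegree_X_pow_sub_C, hF] at hle
      lia) hF D hD
    refine le_trans (Nat.cast_le.2 this) ?_
    push_cast
    calc _ = (D.card : ℝ) * (2 ^ m * (Nat.card {d : ClassGroup (𝓞 F) // d ^ 2 = 1} : ℝ) *
          (Nat.card {d : ClassGroup (𝓞 F) // d ^ 2 = 1} : ℝ)) := by ring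
      _ ≤ _ := mul_le_mul_of_nonneg_right hDc (by positivity)
      _ = _ := by ring

end PureTwoTorsion


namespace PureTwoTorsion
open NumberField

lemma torBd_even (m : ℕ) (hm : 1 ≤ m) (e : ℝ) (hT : TorBd m e) : TorBd (2 * m) (e + ((m : ℝ) - 1) / 2) := by
  intro ε hε
  obtain ⟨C₁, hC₁, h₁⟩ := hT (ε / 2) (by positivity)
  obtain ⟨C₂, hC₂, h₂⟩ := torBd_triv m hm (ε / 2) (by positivity)
  have hA : (0 : ℝ) ≤ 4 ^ m * (1 + Real.log (4 ^ m)) ^ m * 2 * 2 ^ m := by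
    have : 0 ≤ Real.log (4 ^ m) := Real.log_nonneg (one_le_pow₀ (by norm_num))
    positivity
  generalize hAA : (4 : ℝ) ^ m * (1 + Real.log (4 ^ m)) ^ m * 2 * 2 ^ m = A at hA
  refine ⟨(A + 1) * C₁ * C₂, ?_, ?_⟩
  · have : 1 ≤ C₁ * C₂ := one_le_mul_of_one_le_of_one_le hC₁ hC₂
    nlinarith
  · intro q hq K _ _ hK θ hθ
    obtain ⟨F, _, _, φ, hF, hφ, hle⟩ := even_step hm hq K hK θ hθ
    rw [hAA] at hle
    have hq0 : (0 : ℝ) < q := by exact_mod_cast hq.pos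
    have k₁ := h₁ q hq F hF φ hφ
    have k₂ := h₂ q hq F hF φ hφ
    have hpow : (q : ℝ) ^ (e + ((m : ℝ) - 1) / 2 + ε) =
        (q : ℝ) ^ (e + ε / 2) * (q : ℝ) ^ (((m : ℝ) - 1) / 2 + ε / 2) := by
      rw [← Real.rpow_add hq0]; congr 1; ring
    refine hle.trans ?_
    rw [hpow]
    calc _ ≤ (A + 1) * (C₁ * (q : ℝ) ^ (e + ε / 2)) * (C₂ * (q : ℝ) ^ (((m : ℝ) - 1) / 2 + ε / 2)) := by
          have : A ≤ A + 1 := by linarith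
          gcongr
      _ = _ := by ring

lemma torBd_all (n : ℕ) : 1 ≤ n → TorBd n ((n : ℝ) / 2 - 7 / 6 + 1 / n) := by
  induction n using Nat.strong_induction_on with
  | _ n ih =>
    intro hn
    rcases Nat.even_or_odd n with h | h
    · obtain ⟨m, rfl⟩ := h
      have hm : 1 ≤ m := by lia
      rw [← two_mul]
      refine torBd_mono ?_ (torBd_even m hm _ (ih m (by lia) hm))
      have hm' : (1 : ℝ) ≤ m := by exact_mod_cast hm
      have h1 : (1 : ℝ) / m ≤ 1 := by rw [div_le_one (by linarith)]; exact hm'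
      have h2 : (1 : ℝ) / ((2 * m : ℕ) : ℝ) = (1 / m) / 2 := by push_cast; field_simp
      rw [h2]
      push_cast
      linarith
    · by_cases h3 : 3 ≤ n
      · exact torBd_odd n h3 h
      · have : n = 1 := by obtain ⟨k, rfl⟩ := h; lia
        subst this
        refine torBd_mono ?_ (torBd_triv 1 le_rfl)
        norm_num

lemma final_bd (n : ℕ) (hn : 5 ≤ n) (ε : ℝ) (hε : 0 < ε) :
    ∃ C : ℝ, 0 < C ∧ ∀ q : ℕ, q.Prime →
        ∀ (K : Type) [Field K] [NumberField K], Module.finrank ℚ K = n →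
          ∀ α : K, α ^ n = (q : K) →
            (Nat.card {c : ClassGroup (𝓞 K) // c ^ 2 = 1} : ℝ) ≤
              C * |(discr K : ℝ)| ^ ((1 : ℝ) / 2 - 2 / (3 * (n : ℝ)) + 1 / (3 * (n : ℝ) * ((n : ℝ) - 1)) + ε) := by
  have hn' : (5 : ℝ) ≤ n := by exact_mod_cast hn
  have hn1 : (0 : ℝ) < (n : ℝ) - 1 := by linarith
  obtain ⟨C, hC, h⟩ := torBd_all n (by lia) (ε * ((n : ℝ) - 1)) (by positivity)
  generalize hs : (1 : ℝ) / 2 - 2 / (3 * (n : ℝ)) + 1 / (3 * (n : ℝ) * ((n : ℝ) - 1)) + ε = s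
  have hs0 : 0 ≤ s := by
    have h1 : 2 / (3 * (n : ℝ)) ≤ 1 / 2 := by
      rw [div_le_div_iff₀ (by positivity) (by norm_num)]; linarith
    have h2 : 0 ≤ 1 / (3 * (n : ℝ) * ((n : ℝ) - 1)) := by positivity
    rw [← hs]; linarith
  have hexp : (n : ℝ) / 2 - 7 / 6 + 1 / n + ε * ((n : ℝ) - 1) = ((n - 1 : ℕ) : ℝ) * s := by
    rw [Nat.cast_sub (by lia), ← hs]
    have : (n : ℝ) ≠ 0 := by positivity
    have := hn1.ne'
    push_cast
    field_simp
    ring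
  refine ⟨C * ((n : ℝ) ^ n) ^ s, by positivity, ?_⟩
  intro q hq K _ _ hK α hα
  have hintg : IsIntegral ℤ α := by
    refine IsIntegral.of_pow (n := n) (by lia) ?_
    rw [hα]
    have := isIntegral_algebraMap (R := ℤ) (A := K) (x := (q : ℤ))
    simpa using this
  have hθ : (⟨α, hintg⟩ : 𝓞 K) ^ n = (q : 𝓞 K) := by
    apply RingOfIntegers.coe_injective
    exact hα
  refine (h q hq K hK ⟨α, hintg⟩ hθ).trans ?_
  have hd := (discr_le (by lia) hK hq hθ).2
  rw [hexp, Real.rpow_mul (by positivity), Real.rpow_natCast, mul_assoc,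
    ← Real.mul_rpow (by positivity) (abs_nonneg _)]
  gcongr

end PureTwoTorsion

/-- For every integer `n ≥ 5` and every real `ε > 0` there exists a constant
`C = C(n,ε) > 0` such that for every prime number `q`, the polynomial `Xⁿ − q` is irreducible
over `ℚ` and the number field `K = ℚ[X]/(Xⁿ − q)` (i.e. any number field of degree `n` generated
by, hence containing, an `n`-th root of `q`) satisfies
`#h₂(K) ≤ C · D_K^{1/2 − 2/(3n) + 1/(3n(n−1)) + ε}`. -/
theorem stmt6 (n : ℕ) (hn : 5 ≤ n) (ε : ℝ) (hε : 0 < ε) :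
    ∃ C : ℝ, 0 < C ∧
      ∀ q : ℕ, q.Prime →
        Irreducible (Polynomial.X ^ n - Polynomial.C (q : ℚ)) ∧
        ∀ (K : Type) [Field K] [NumberField K],
          Module.finrank ℚ K = n →
          ∀ α : K, α ^ n = (q : K) →
            (Nat.card {c : ClassGroup (𝓞 K) // c ^ 2 = 1} : ℝ) ≤
              C * (|discr K| : ℝ) ^
                ((1 : ℝ) / 2 - 2 / (3 * (n : ℝ)) + 1 / (3 * (n : ℝ) * ((n : ℝ) - 1)) + ε) := by
  obtain ⟨C, hC, h⟩ := PureTwoTorsion.final_bd n hn ε hε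
  refine ⟨C, hC, fun q hq => ⟨PureTwoTorsion.irred_pure n (by lia) q hq, ?_⟩⟩
  intro K _ _ hK α hα
  have := h q hq K hK α hα
  simpa using this
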